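/- arXiv:1304.5342 — 2 statements merged into one kernel-verified Lean document; each statement's English description precedes it below -/
import Mathlib

section
/- Let G be a connected finite simple graph with at least 3 vertices and vertex-width at most 3. Then the c2-invariant of G is constant: there exists an integer c such that [X_G]_q ≡ c·q² (mod q³) for every prime power q. -/
open scoped Classical
open Matrix

/-- The graph polynomial (Kirchhoff polynomial) of a finite simple graph `G`:
`Ψ_G = Σ_T Π_{e ∉ T} x_e`, summed over spanning trees `T` of `G`. -/
noncomputable def graphPoly {V : Type*} [Fintype V] (G : SimpleGraph V) :
    MvPolynomial G.edgeSet ℤ :=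
  letI : Fintype G.edgeSet := Fintype.ofFinite _
  ∑ T : Finset G.edgeSet,
    if (SimpleGraph.fromEdgeSet (Subtype.val '' (T : Set G.edgeSet))).IsTree then
      ∏ e ∈ Tᶜ, MvPolynomial.X e
    else 0

/-- `[X_G]_q`: the number of points `x ∈ K^{E(G)}` with `Ψ_G(x) = 0`. -/
noncomputable def Xcount {V : Type*} [Fintype V] (G : SimpleGraph V)
    (K : Type*) [CommRing K] : ℕ :=
  Nat.card {x : G.edgeSet → K // MvPolynomial.aeval x (graphPoly G) = 0}

/-- `G` has vertex-width at most `n`. -/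
def VertexWidthLE {V : Type*} (G : SimpleGraph V) (n : ℕ) : Prop :=
  ∃ (N : ℕ) (σ : Fin N ≃ G.edgeSet), ∀ k : ℕ,
    Nat.card {v : V // (∃ i : Fin N, (i : ℕ) < k ∧ v ∈ (σ i : Sym2 V)) ∧
                       (∃ i : Fin N, k ≤ (i : ℕ) ∧ v ∈ (σ i : Sym2 V))} ≤ n


namespace C2

structure St (K : Type) where
  a : K
  b1 : K
  b2 : K
  b3 : K
  c : K

inductive Ix
  | a | b1 | b2 | b3 | d1 | d2 | d3 | c | A1 | A2 | A3 | E1 | E2 | E3 | pa | pc | p1 | p2 | p3 | z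

/-- the coordinate conditions on states -/
def Ix.mem {K : Type} [Field K] : Ix → St K → Prop
  | .a, s => s.a = 0
  | .b1, s => s.b1 = 0
  | .b2, s => s.b2 = 0
  | .b3, s => s.b3 = 0
  | .d1, s => s.b2 + s.b3 = 0
  | .d2, s => s.b1 + s.b3 = 0
  | .d3, s => s.b1 + s.b2 = 0
  | .c, s => s.c = 0
  | .A1, s => s.b2 = 0 ∧ s.b3 = 0 ∧ s.c = 0
  | .A2, s => s.b1 = 0 ∧ s.b3 = 0 ∧ s.c = 0
  | .A3, s => s.b1 = 0 ∧ s.b2 = 0 ∧ s.c = 0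
  | .E1, s => s.b2 = 0 ∧ s.b3 = 0 ∧ s.a = 0
  | .E2, s => s.b1 = 0 ∧ s.b3 = 0 ∧ s.a = 0
  | .E3, s => s.b1 = 0 ∧ s.b2 = 0 ∧ s.a = 0
  | .pa, s => s.b1 = 0 ∧ s.b2 = 0 ∧ s.b3 = 0 ∧ s.c = 0
  | .pc, s => s.b1 = 0 ∧ s.b2 = 0 ∧ s.b3 = 0 ∧ s.a = 0
  | .p1, s => s.b2 = 0 ∧ s.b3 = 0 ∧ s.a = 0 ∧ s.c = 0
  | .p2, s => s.b1 = 0 ∧ s.b3 = 0 ∧ s.a = 0 ∧ s.c = 0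
  | .p3, s => s.b1 = 0 ∧ s.b2 = 0 ∧ s.a = 0 ∧ s.c = 0
  | .z, s => s.b1 = 0 ∧ s.b2 = 0 ∧ s.b3 = 0 ∧ s.a = 0 ∧ s.c = 0

abbrev Fam := ∀ (K : Type) [Field K] [Fintype K], St K → ℤ

noncomputable def cmp (i : Ix) : Fam := fun _ _ _ s => if i.mem s then 0 else 1

def Quad {K : Type} [Field K] (s : St K) : Prop :=
  s.a * s.c = s.b1 * s.b2 + s.b1 * s.b3 + s.b2 * s.b3

def mP {K : Type} [Field K] (x : K) (s : St K) : St K :=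
  ⟨x * s.a + (s.b1 + s.b2), x * s.b1, x * s.b2, x * s.b3 + s.c, x * s.c⟩
def mS {K : Type} [Field K] (x : K) (s : St K) : St K :=
  ⟨s.a, s.b1, s.b2, x * s.a + s.b3, s.c + x * (s.b1 + s.b2)⟩
def mR {K : Type} [Field K] (s : St K) : St K := ⟨0, 0, 0, s.a, s.b1 + s.b2⟩
/-- swap terminals 1 and 2 -/
def mX {K : Type} [Field K] (s : St K) : St K := ⟨s.a, s.b2, s.b1, s.b3, s.c⟩
/-- swap terminals 2 and 3 -/
def mY {K : Type} [Field K] (s : St K) : St K := ⟨s.a, s.b1, s.b3, s.b2, s.c⟩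
def s0 {K : Type} [Field K] : St K := ⟨0, 0, 0, 0, 1⟩

inductive Mv
  | P | S | R | X | Y | F

noncomputable def T (m : Mv) (f : Fam) : Fam := fun K _ _ s => match m with
  | .P => ∑ x : K, f K (mP x s)
  | .S => ∑ x : K, f K (mS x s)
  | .R => f K (mR s)
  | .X => f K (mX s)
  | .Y => f K (mY s)
  | .F => ∑ _x : K, f K s

def fadd (f f' : Fam) : Fam := fun K _ _ s => f K s + f' K s
def fneg (f : Fam) : Fam := fun K _ _ s => - f K s
def fzero : Fam := fun _ _ _ _ => 0

/-- closure with corrections -/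
inductive Cl (g : Ix → Prop) (low : Fam → Prop) : Fam → Prop
  | gen (i) : g i → Cl g low (cmp i)
  | zero : Cl g low fzero
  | add {f f'} : Cl g low f → Cl g low f' → Cl g low (fadd f f')
  | neg {f} : Cl g low f → Cl g low (fneg f)
  | step {f f' h : Fam} : Cl g low f → low h →
      (∀ (K : Type) [Field K] [Fintype K] (s : St K), Quad s →
        f' K s = f K s + (Fintype.card K : ℤ) * h K s) → Cl g low f'

theorem Quad_P {K : Type} [Field K] {x : K} {s : St K} (h : Quad s) : Quad (mP x s) := by
  simp only [Quad, mP] at *; linear_combination x^2 * h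
theorem Quad_S {K : Type} [Field K] {x : K} {s : St K} (h : Quad s) : Quad (mS x s) := by
  simp only [Quad, mS] at *; linear_combination h
theorem Quad_R {K : Type} [Field K] {s : St K} : Quad (mR s) := by
  simp [Quad, mR] 
theorem Quad_X {K : Type} [Field K] {s : St K} (h : Quad s) : Quad (mX s) := by
  simp only [Quad, mX] at *; linear_combination h
theorem Quad_Y {K : Type} [Field K] {s : St K} (h : Quad s) : Quad (mY s) := by
  simp only [Quad, mY] at *; linear_combination h

theorem Cl.T {g low} (m : Mv) (hlow : ∀ f, low f → low (T m f))
    (hg : ∀ i, g i → Cl g low (T m (cmp i))) {f : Fam} (hf : Cl g low f) : Cl g low (T m f) := by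
  induction hf with
  | gen i hi => exact hg i hi
  | zero => 
    have : C2.T m fzero = fzero := by
      funext K _ _ s; cases m <;> simp [C2.T, fzero]
    rw [this]; exact .zero
  | @add f f' _ _ h1 h2 =>
    have : C2.T m (fadd f f') = fadd (C2.T m f) (C2.T m f') := by
      funext K _ _ s; cases m <;> simp [C2.T, fadd, Finset.sum_add_distrib, mul_add]
    rw [this]; exact .add h1 h2
  | @neg f _ h1 =>
    have : C2.T m (fneg f) = fneg (C2.T m f) := by
      funext K _ _ s; cases m <;> simp [C2.T, fneg]
    rw [this]; exact .neg h1
  | @step f f' h _ hh he ih =>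
    refine .step ih (hlow _ hh) ?_
    intro K _ _ s hs
    cases m <;> simp only [C2.T]
    · rw [Finset.mul_sum, ← Finset.sum_add_distrib]
      exact Finset.sum_congr rfl fun x _ => he K _ (Quad_P hs)
    · rw [Finset.mul_sum, ← Finset.sum_add_distrib]
      exact Finset.sum_congr rfl fun x _ => he K _ (Quad_S hs)
    · exact he K _ Quad_R
    · exact he K _ (Quad_X hs)
    · exact he K _ (Quad_Y hs)
    · rw [Finset.mul_sum, ← Finset.sum_add_distrib]
      exact Finset.sum_congr rfl fun x _ => he K _ hs

def M3 : Fam → Prop := Cl (fun _ => True) (fun _ => True)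
def g2 : Ix → Prop
  | .a | .b1 | .b2 | .b3 | .d1 | .d2 | .d3 | .E1 | .E2 | .E3 => True
  | _ => False
def M2 : Fam → Prop := Cl g2 M3
def M1 : Fam → Prop := Cl (fun i => i = Ix.a) M2

def HasVal (k : ℕ) (f : Fam) : Prop := ∃ c : ℤ, ∀ (K : Type) [Field K] [Fintype K],
  (Fintype.card K : ℤ) ^ (k+1) ∣ f K s0 - c * (Fintype.card K : ℤ) ^ k

theorem Quad_s0 {K : Type} [Field K] : Quad (s0 : St K) := by simp [Quad, s0]

theorem val_zero {f : Fam} {g : Ix → Prop} (hf : Cl g (fun _ => True) f) : HasVal 0 f := by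
  induction hf with
  | gen i _ =>
    cases i <;> first
      | (refine ⟨0, fun K _ _ => ?_⟩; simp [cmp, Ix.mem, s0]; done)
      | (refine ⟨1, fun K _ _ => ?_⟩; simp [cmp, Ix.mem, s0]; done)
  | zero => exact ⟨0, fun K _ _ => by simp [fzero]⟩
  | add _ _ h1 h2 =>
    obtain ⟨c, h1⟩ := h1
    obtain ⟨d, h2⟩ := h2
    refine ⟨c + d, fun K _ _ => ?_⟩
    obtain ⟨u, hu⟩ := h1 K
    obtain ⟨v, hv⟩ := h2 K
    exact ⟨u + v, by simp only [fadd]; linear_combination hu + hv⟩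
  | neg _ h1 => 
    obtain ⟨c, h1⟩ := h1
    refine ⟨-c, fun K _ _ => ?_⟩
    obtain ⟨u, hu⟩ := h1 K
    exact ⟨-u, by simp only [fneg]; linear_combination - hu⟩
  | @step f f' h _ _ he ih =>
    obtain ⟨c, ih⟩ := ih
    refine ⟨c, fun K _ _ => ?_⟩
    rw [he K s0 Quad_s0]
    obtain ⟨u, hu⟩ := ih K
    exact ⟨u + h K s0, by linear_combination hu⟩

theorem val_succ {f : Fam} {g : Ix → Prop} {low : Fam → Prop} {k : ℕ}
    (hg : ∀ i, g i → ∀ (K : Type) [Field K], i.mem (s0 : St K))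
    (hl : ∀ h, low h → HasVal k h) (hf : Cl g low f) : HasVal (k+1) f := by
  induction hf with
  | gen i hi =>
    exact ⟨0, fun K _ _ => by simp [cmp, hg i hi K]⟩
  | zero => exact ⟨0, fun K _ _ => by simp [fzero]⟩
  | add _ _ h1 h2 =>
    obtain ⟨c, h1⟩ := h1
    obtain ⟨d, h2⟩ := h2
    refine ⟨c + d, fun K _ _ => ?_⟩
    obtain ⟨u, hu⟩ := h1 K
    obtain ⟨v, hv⟩ := h2 K
    exact ⟨u + v, by simp only [fadd]; linear_combination hu + hv⟩
  | neg _ h1 => 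
    obtain ⟨c, h1⟩ := h1
    refine ⟨-c, fun K _ _ => ?_⟩
    obtain ⟨u, hu⟩ := h1 K
    exact ⟨-u, by simp only [fneg]; linear_combination - hu⟩
  | @step f f' h _ hh he ih =>
    obtain ⟨c, ih⟩ := ih
    obtain ⟨d, hd⟩ := hl h hh
    refine ⟨c + d, fun K _ _ => ?_⟩
    rw [he K s0 Quad_s0]
    obtain ⟨u, hu⟩ := ih K
    obtain ⟨v, hv⟩ := hd K
    exact ⟨u + v, by linear_combination hu + (Fintype.card K : ℤ) * hv⟩

end C2

/-! tables -/
namespace C2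
section helpers
variable {K : Type} [Fintype K]

theorem sum_none {P : K → Prop} (h : ∀ x, ¬ P x) :
    (∑ x : K, if P x then (0:ℤ) else 1) = Fintype.card K := by
  simp [h]
theorem sum_all {P : K → Prop} (h : ∀ x, P x) :
    (∑ x : K, if P x then (0:ℤ) else 1) = 0 := by
  simp [h]
theorem sum_one {P : K → Prop} (x0 : K) (h : ∀ x, P x ↔ x = x0) :
    (∑ x : K, if P x then (0:ℤ) else 1) = Fintype.card K - 1 := by
  simp only [h]
  have : ∀ x : K, (if x = x0 then (0:ℤ) else 1) = 1 - (if x = x0 then 1 else 0) := by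
    intro x; split_ifs <;> simp
  simp only [this, Finset.sum_sub_distrib]
  simp
end helpers

noncomputable def lcf (p n : List Ix) : Fam := fun K _ _ s =>
  (p.map (fun i => cmp i K s)).sum - (n.map (fun i => cmp i K s)).sum

/-- leading part -/
def tab : Mv → Ix → List Ix × List Ix
  | .P, .a => ([], [.a])
  | .P, .b1 => ([], [.b1])
  | .P, .b2 => ([], [.b2])
  | .P, .b3 => ([], [.b3])
  | .P, .d1 => ([], [.d1])
  | .P, .d2 => ([], [.d2])
  | .P, .d3 => ([], [.d3])
  | .P, .E1 => ([.b2], [.E1])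
  | .P, .E2 => ([.b1], [.E2])
  | .P, .E3 => ([.d3], [.E3])
  | .P, .c => ([], [.c])
  | .P, .A1 => ([.c], [.A1])
  | .P, .A2 => ([.c], [.A2])
  | .P, .A3 => ([], [.A3])
  | .P, .pa => ([.c], [.pa])
  | .P, .pc => ([.A3, .E3], [.p3, .pc])
  | .P, .p1 => ([.A3, .A1], [.p1, .pa])
  | .P, .p2 => ([.A3, .A2], [.p2, .pa])
  | .P, .p3 => ([.d3], [.p3])
  | .P, .z => ([.A3], [.z])
  | .S, .b3 => ([], [.a])
  | .S, .d1 => ([], [.a])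
  | .S, .d2 => ([], [.a])
  | .S, .c => ([], [.d3])
  | .S, .A1 => ([.b2], [.E3])
  | .S, .A2 => ([.b1], [.E3])
  | .S, .pa => ([.A3], [.p3])
  | .S, .p1 => ([.E1], [.pc])
  | .S, .p2 => ([.E2], [.pc])
  | .S, _ => ([], [])
  | .R, .b3 => ([.a], [])
  | .R, .d1 => ([.a], [])
  | .R, .d2 => ([.a], [])
  | .R, .E1 => ([.a], [])
  | .R, .E2 => ([.a], [])
  | .R, .c => ([.d3], [])
  | .R, .A1 => ([.E3], [])
  | .R, .A2 => ([.E3], [])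
  | .R, .A3 => ([.d3], [])
  | .R, .pa => ([.E3], [])
  | .R, .pc => ([.a], [])
  | .R, .p1 => ([.E3], [])
  | .R, .p2 => ([.E3], [])
  | .R, .p3 => ([.d3], [])
  | .R, .z => ([.E3], [])
  | .R, _ => ([], [])
  | .X, .b1 => ([.b2], [])
  | .X, .b2 => ([.b1], [])
  | .X, .d1 => ([.d2], [])
  | .X, .d2 => ([.d1], [])
  | .X, .A1 => ([.A2], [])
  | .X, .A2 => ([.A1], [])
  | .X, .E1 => ([.E2], [])
  | .X, .E2 => ([.E1], [])
  | .X, .p1 => ([.p2], [])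
  | .X, .p2 => ([.p1], [])
  | .X, i => ([i], [])
  | .Y, .b3 => ([.b2], [])
  | .Y, .b2 => ([.b3], [])
  | .Y, .d3 => ([.d2], [])
  | .Y, .d2 => ([.d3], [])
  | .Y, .A3 => ([.A2], [])
  | .Y, .A2 => ([.A3], [])
  | .Y, .E3 => ([.E2], [])
  | .Y, .E2 => ([.E3], [])
  | .Y, .p3 => ([.p2], [])
  | .Y, .p2 => ([.p3], [])
  | .Y, i => ([i], [])
  | .F, _ => ([], [])

/-- correction part -/
def tabq : Mv → Ix → List Ix × List Ix
  | .P, .a => ([.E3], [])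
  | .P, .b1 => ([.b1], [])
  | .P, .b2 => ([.b2], [])
  | .P, .b3 => ([.A1, .A2], [.pa])
  | .P, .d1 => ([.A1], [])
  | .P, .d2 => ([.A2], [])
  | .P, .d3 => ([.d3], [])
  | .P, .E1 => ([.z], [])
  | .P, .E2 => ([.z], [])
  | .P, .E3 => ([.E3], [])
  | .S, .a => ([.a], [])
  | .S, .b1 => ([.b1], [])
  | .S, .b2 => ([.b2], [])
  | .S, .b3 => ([.E1, .E2], [.pc])
  | .S, .d1 => ([.E1], [])
  | .S, .d2 => ([.E2], [])
  | .S, .d3 => ([.d3], [])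
  | .S, .E1 => ([.E1], [])
  | .S, .E2 => ([.E2], [])
  | .S, .E3 => ([.E3], [])
  | .F, i => ([i], [])
  | _, _ => ([], [])

theorem tab_exact (m : Mv) (hm : m ≠ .P ∧ m ≠ .S) (i : Ix) (K : Type) [Field K] [Fintype K] (s : St K)
    (hs : Quad s) : T m (cmp i) K s = lcf (tab m i).1 (tab m i).2 K s
      + (Fintype.card K : ℤ) * lcf (tabq m i).1 (tabq m i).2 K s := by
  obtain ⟨a, b1, b2, b3, c⟩ := s
  simp only [Quad] at hs
  cases m
  · simp at hm
  · simp at hm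
  · cases i <;> simp [T, tab, tabq, lcf, cmp, Ix.mem, mR] <;>
      (try (split_ifs <;> first | rfl | grind))
  · cases i <;> simp [T, tab, tabq, lcf, cmp, Ix.mem, mX] <;>
      (try (split_ifs <;> first | rfl | grind))
  · cases i <;> simp [T, tab, tabq, lcf, cmp, Ix.mem, mY] <;>
      (try (split_ifs <;> first | rfl | grind))
  · simp [T, tab, tabq, lcf]


end C2

namespace C2

section helpers2
variable {K : Type} [Fintype K]
theorem dvd_none {P : K → Prop} {r : ℤ} (h : ∀ x, ¬ P x) (hr : r = 0) :
    (Fintype.card K : ℤ) ∣ (∑ x : K, if P x then (0:ℤ) else 1) - r := by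
  rw [sum_none h, hr]; simp
theorem dvd_all {P : K → Prop} {r : ℤ} (h : ∀ x, P x) (hr : r = 0) :
    (Fintype.card K : ℤ) ∣ (∑ x : K, if P x then (0:ℤ) else 1) - r := by
  rw [sum_all h, hr]; simp
theorem dvd_one {P : K → Prop} {r : ℤ} (x0 : K) (h : ∀ x, P x ↔ x = x0) (hr : r = -1) :
    (Fintype.card K : ℤ) ∣ (∑ x : K, if P x then (0:ℤ) else 1) - r := by
  rw [sum_one x0 h, hr]; simp
end helpers2

set_option maxHeartbeats 2000000 in
theorem tab_P2 (i : Ix) (hi : g2 i) (K : Type) [Field K] [Fintype K] (s : St K)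
    (hs : Quad s) : T .P (cmp i) K s = lcf (tab .P i).1 (tab .P i).2 K s
      + (Fintype.card K : ℤ) * lcf (tabq .P i).1 (tabq .P i).2 K s := by
  obtain ⟨a, b1, b2, b3, c⟩ := s
  simp only [Quad] at hs
  cases i <;> simp only [g2] at hi <;> simp only [T, tab, tabq, lcf, cmp, Ix.mem, mP, List.map, List.sum_cons, List.sum_nil]
  case a =>
    by_cases h0 : a = 0 <;> by_cases h1 : b1+b2 = 0 <;> first
    | (exfalso; grind; done)
    | (refine (sum_none ?_).trans ?_ <;> [(intro x; grind); grind])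
    | (refine (sum_all ?_).trans ?_ <;> [(intro x; grind); grind])
    | (refine (sum_one (-(b1+b2)/a) ?_).trans ?_ <;> [(intro x; grind); grind])
  case b1 =>
    by_cases h0 : b1 = 0 <;> first
    | (exfalso; grind; done)
    | (refine (sum_none ?_).trans ?_ <;> [(intro x; grind); grind])
    | (refine (sum_all ?_).trans ?_ <;> [(intro x; grind); grind])
    | (refine (sum_one (0) ?_).trans ?_ <;> [(intro x; grind); grind])
  case b2 =>
    by_cases h0 : b2 = 0 <;> first
    | (exfalso; grind; done)
    | (refine (sum_none ?_).trans ?_ <;> [(intro x; grind); grind])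
    | (refine (sum_all ?_).trans ?_ <;> [(intro x; grind); grind])
    | (refine (sum_one (0) ?_).trans ?_ <;> [(intro x; grind); grind])
  case b3 =>
    by_cases h0 : b3 = 0 <;> by_cases h1 : c = 0 <;> by_cases h2 : b1 = 0 <;> by_cases h3 : b2 = 0 <;> first
    | (exfalso; grind; done)
    | (refine (sum_none ?_).trans ?_ <;> [(intro x; grind); grind])
    | (refine (sum_all ?_).trans ?_ <;> [(intro x; grind); grind])
    | (refine (sum_one (-c/b3) ?_).trans ?_ <;> [(intro x; grind); grind])
  case d1 =>
    by_cases h0 : (b2+b3) = 0 <;> by_cases h1 : c = 0 <;> first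
    | (exfalso; grind; done)
    | (refine (sum_none ?_).trans ?_ <;> [(intro x; grind); grind])
    | (refine (sum_all ?_).trans ?_ <;> [(intro x; grind); grind])
    | (refine (sum_one (-c/(b2+b3)) ?_).trans ?_ <;> [(intro x; grind); grind])
  case d2 =>
    by_cases h0 : (b1+b3) = 0 <;> by_cases h1 : c = 0 <;> first
    | (exfalso; grind; done)
    | (refine (sum_none ?_).trans ?_ <;> [(intro x; grind); grind])
    | (refine (sum_all ?_).trans ?_ <;> [(intro x; grind); grind])
    | (refine (sum_one (-c/(b1+b3)) ?_).trans ?_ <;> [(intro x; grind); grind])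
  case d3 =>
    by_cases h0 : (b1+b2) = 0 <;> first
    | (exfalso; grind; done)
    | (refine (sum_none ?_).trans ?_ <;> [(intro x; grind); grind])
    | (refine (sum_all ?_).trans ?_ <;> [(intro x; grind); grind])
    | (refine (sum_one (0) ?_).trans ?_ <;> [(intro x; grind); grind])
  case E3 =>
    by_cases h0 : a = 0 <;> by_cases h1 : b1 = 0 <;> by_cases h2 : b2 = 0 <;> by_cases h3 : b1+b2 = 0 <;> first
    | (exfalso; grind; done)
    | (refine (sum_none ?_).trans ?_ <;> [(intro x; grind); grind])
    | (refine (sum_all ?_).trans ?_ <;> [(intro x; grind); grind])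
    | (refine (sum_one (0) ?_).trans ?_ <;> [(intro x; grind); grind])
  case E1 =>
    by_cases h0 : a = 0 <;> by_cases h1 : b1 = 0 <;> by_cases h2 : b2 = 0 <;> by_cases h3 : b3 = 0 <;> by_cases h4 : c = 0 <;> first
    | (exfalso; grind; done)
    | (refine (sum_none ?_).trans ?_ <;> [(intro x; grind); grind])
    | (refine (sum_all ?_).trans ?_ <;> [(intro x; grind); grind])
    | (refine (sum_one (-(b1+b2)/a) ?_).trans ?_ <;> [(intro x; grind); grind])
    | (refine (sum_one (-c/b3) ?_).trans ?_ <;> [(intro x; grind); grind])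
  case E2 =>
    by_cases h0 : a = 0 <;> by_cases h1 : b1 = 0 <;> by_cases h2 : b2 = 0 <;> by_cases h3 : b3 = 0 <;> by_cases h4 : c = 0 <;> first
    | (exfalso; grind; done)
    | (refine (sum_none ?_).trans ?_ <;> [(intro x; grind); grind])
    | (refine (sum_all ?_).trans ?_ <;> [(intro x; grind); grind])
    | (refine (sum_one (-(b1+b2)/a) ?_).trans ?_ <;> [(intro x; grind); grind])
    | (refine (sum_one (-c/b3) ?_).trans ?_ <;> [(intro x; grind); grind])

set_option maxHeartbeats 2000000 in
theorem tab_S2 (i : Ix) (hi : g2 i) (K : Type) [Field K] [Fintype K] (s : St K)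
    (hs : Quad s) : T .S (cmp i) K s = lcf (tab .S i).1 (tab .S i).2 K s
      + (Fintype.card K : ℤ) * lcf (tabq .S i).1 (tabq .S i).2 K s := by
  obtain ⟨a, b1, b2, b3, c⟩ := s
  simp only [Quad] at hs
  cases i <;> simp only [g2] at hi <;> simp only [T, tab, tabq, lcf, cmp, Ix.mem, mS, List.map, List.sum_cons, List.sum_nil]
  case a =>
    by_cases h0 : a = 0 <;> first
    | (exfalso; grind; done)
    | (refine (sum_none ?_).trans ?_ <;> [(intro x; grind); grind])
    | (refine (sum_all ?_).trans ?_ <;> [(intro x; grind); grind])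
  case b1 =>
    by_cases h0 : b1 = 0 <;> first
    | (exfalso; grind; done)
    | (refine (sum_none ?_).trans ?_ <;> [(intro x; grind); grind])
    | (refine (sum_all ?_).trans ?_ <;> [(intro x; grind); grind])
  case b2 =>
    by_cases h0 : b2 = 0 <;> first
    | (exfalso; grind; done)
    | (refine (sum_none ?_).trans ?_ <;> [(intro x; grind); grind])
    | (refine (sum_all ?_).trans ?_ <;> [(intro x; grind); grind])
  case b3 =>
    by_cases h0 : a = 0 <;> by_cases h1 : b3 = 0 <;> by_cases h2 : b1 = 0 <;> by_cases h3 : b2 = 0 <;> first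
    | (exfalso; grind; done)
    | (refine (sum_none ?_).trans ?_ <;> [(intro x; grind); grind])
    | (refine (sum_all ?_).trans ?_ <;> [(intro x; grind); grind])
    | (refine (sum_one (-b3/a) ?_).trans ?_ <;> [(intro x; grind); grind])
  case d1 =>
    by_cases h0 : a = 0 <;> by_cases h1 : b2 = 0 <;> by_cases h2 : b3 = 0 <;> by_cases h3 : b2+b3 = 0 <;> first
    | (exfalso; grind; done)
    | (refine (sum_none ?_).trans ?_ <;> [(intro x; grind); grind])
    | (refine (sum_all ?_).trans ?_ <;> [(intro x; grind); grind])
    | (refine (sum_one (-(b2+b3)/a) ?_).trans ?_ <;> [(intro x; grind); grind])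
  case d2 =>
    by_cases h0 : a = 0 <;> by_cases h1 : b1 = 0 <;> by_cases h2 : b3 = 0 <;> by_cases h3 : b1+b3 = 0 <;> first
    | (exfalso; grind; done)
    | (refine (sum_none ?_).trans ?_ <;> [(intro x; grind); grind])
    | (refine (sum_all ?_).trans ?_ <;> [(intro x; grind); grind])
    | (refine (sum_one (-(b1+b3)/a) ?_).trans ?_ <;> [(intro x; grind); grind])
  case d3 =>
    by_cases h0 : b1+b2 = 0 <;> first
    | (exfalso; grind; done)
    | (refine (sum_none ?_).trans ?_ <;> [(intro x; grind); grind])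
    | (refine (sum_all ?_).trans ?_ <;> [(intro x; grind); grind])
  case E3 =>
    by_cases h0 : a = 0 <;> by_cases h1 : b1 = 0 <;> by_cases h2 : b2 = 0 <;> first
    | (exfalso; grind; done)
    | (refine (sum_none ?_).trans ?_ <;> [(intro x; grind); grind])
    | (refine (sum_all ?_).trans ?_ <;> [(intro x; grind); grind])
  case E1 =>
    by_cases h0 : a = 0 <;> by_cases h1 : b1 = 0 <;> by_cases h2 : b2 = 0 <;> by_cases h3 : b3 = 0 <;> first
    | (exfalso; grind; done)
    | (refine (sum_none ?_).trans ?_ <;> [(intro x; grind); grind])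
    | (refine (sum_all ?_).trans ?_ <;> [(intro x; grind); grind])
  case E2 =>
    by_cases h0 : a = 0 <;> by_cases h1 : b1 = 0 <;> by_cases h2 : b2 = 0 <;> by_cases h3 : b3 = 0 <;> first
    | (exfalso; grind; done)
    | (refine (sum_none ?_).trans ?_ <;> [(intro x; grind); grind])
    | (refine (sum_all ?_).trans ?_ <;> [(intro x; grind); grind])

set_option maxHeartbeats 2000000 in
theorem tab_P3 (i : Ix) (hi : ¬ g2 i) (K : Type) [Field K] [Fintype K] (s : St K)
    (hs : Quad s) : (Fintype.card K : ℤ) ∣ T .P (cmp i) K s - lcf (tab .P i).1 (tab .P i).2 K s := by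
  obtain ⟨a, b1, b2, b3, c⟩ := s
  simp only [Quad] at hs
  cases i <;> simp only [g2, not_true] at hi <;> simp only [T, tab, lcf, cmp, Ix.mem, mP, List.map, List.sum_cons, List.sum_nil]
  case c =>
    by_cases h0 : c = 0 <;> first
    | (exfalso; grind; done)
    | (refine dvd_none ?_ ?_ <;> [(intro x; grind); grind])
    | (refine dvd_all ?_ ?_ <;> [(intro x; grind); grind])
    | (refine dvd_one (0) ?_ ?_ <;> [(intro x; grind); grind])
  case A1 =>
    by_cases h0 : c = 0 <;> by_cases h1 : b2 = 0 <;> by_cases h2 : b3 = 0 <;> first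
    | (exfalso; grind; done)
    | (refine dvd_none ?_ ?_ <;> [(intro x; grind); grind])
    | (refine dvd_all ?_ ?_ <;> [(intro x; grind); grind])
    | (refine dvd_one (0) ?_ ?_ <;> [(intro x; grind); grind])
  case A2 =>
    by_cases h0 : c = 0 <;> by_cases h1 : b1 = 0 <;> by_cases h2 : b3 = 0 <;> first
    | (exfalso; grind; done)
    | (refine dvd_none ?_ ?_ <;> [(intro x; grind); grind])
    | (refine dvd_all ?_ ?_ <;> [(intro x; grind); grind])
    | (refine dvd_one (0) ?_ ?_ <;> [(intro x; grind); grind])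
  case A3 =>
    by_cases h0 : c = 0 <;> by_cases h1 : b1 = 0 <;> by_cases h2 : b2 = 0 <;> first
    | (exfalso; grind; done)
    | (refine dvd_none ?_ ?_ <;> [(intro x; grind); grind])
    | (refine dvd_all ?_ ?_ <;> [(intro x; grind); grind])
    | (refine dvd_one (0) ?_ ?_ <;> [(intro x; grind); grind])
  case pa =>
    by_cases h0 : c = 0 <;> by_cases h1 : b1 = 0 <;> by_cases h2 : b2 = 0 <;> by_cases h3 : b3 = 0 <;> first
    | (exfalso; grind; done)
    | (refine dvd_none ?_ ?_ <;> [(intro x; grind); grind])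
    | (refine dvd_all ?_ ?_ <;> [(intro x; grind); grind])
    | (refine dvd_one (0) ?_ ?_ <;> [(intro x; grind); grind])
  case pc =>
    by_cases h0 : b1 = 0 <;> by_cases h1 : b2 = 0 <;> by_cases h2 : a = 0 <;> by_cases h3 : b3 = 0 <;> by_cases h4 : c = 0 <;> first
    | (exfalso; grind; done)
    | (refine dvd_none ?_ ?_ <;> [(intro x; grind); grind])
    | (refine dvd_all ?_ ?_ <;> [(intro x; grind); grind])
    | (refine dvd_one (0) ?_ ?_ <;> [(intro x; grind); grind])
    | (refine dvd_one (-c/b3) ?_ ?_ <;> [(intro x; grind); grind])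
  case p1 =>
    by_cases h0 : c = 0 <;> by_cases h1 : b1 = 0 <;> by_cases h2 : b2 = 0 <;> by_cases h3 : b3 = 0 <;> by_cases h4 : a = 0 <;> first
    | (exfalso; grind; done)
    | (refine dvd_none ?_ ?_ <;> [(intro x; grind); grind])
    | (refine dvd_all ?_ ?_ <;> [(intro x; grind); grind])
    | (refine dvd_one (0) ?_ ?_ <;> [(intro x; grind); grind])
    | (refine dvd_one (-b1/a) ?_ ?_ <;> [(intro x; grind); grind])
  case p2 =>
    by_cases h0 : c = 0 <;> by_cases h1 : b1 = 0 <;> by_cases h2 : b2 = 0 <;> by_cases h3 : b3 = 0 <;> by_cases h4 : a = 0 <;> first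
    | (exfalso; grind; done)
    | (refine dvd_none ?_ ?_ <;> [(intro x; grind); grind])
    | (refine dvd_all ?_ ?_ <;> [(intro x; grind); grind])
    | (refine dvd_one (0) ?_ ?_ <;> [(intro x; grind); grind])
    | (refine dvd_one (-b2/a) ?_ ?_ <;> [(intro x; grind); grind])
  case p3 =>
    by_cases h0 : b1+b2 = 0 <;> by_cases h1 : b1 = 0 <;> by_cases h2 : a = 0 <;> by_cases h3 : c = 0 <;> first
    | (exfalso; grind; done)
    | (refine dvd_none ?_ ?_ <;> [(intro x; grind); grind])
    | (refine dvd_all ?_ ?_ <;> [(intro x; grind); grind])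
    | (refine dvd_one (0) ?_ ?_ <;> [(intro x; grind); grind])
  case z =>
    by_cases h0 : c = 0 <;> by_cases h1 : b1 = 0 <;> by_cases h2 : b2 = 0 <;> by_cases h3 : b3 = 0 <;> by_cases h4 : a = 0 <;> first
    | (exfalso; grind; done)
    | (refine dvd_none ?_ ?_ <;> [(intro x; grind); grind])
    | (refine dvd_all ?_ ?_ <;> [(intro x; grind); grind])
    | (refine dvd_one (0) ?_ ?_ <;> [(intro x; grind); grind])

set_option maxHeartbeats 2000000 in
theorem tab_S3 (i : Ix) (hi : ¬ g2 i) (K : Type) [Field K] [Fintype K] (s : St K)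
    (hs : Quad s) : (Fintype.card K : ℤ) ∣ T .S (cmp i) K s - lcf (tab .S i).1 (tab .S i).2 K s := by
  obtain ⟨a, b1, b2, b3, c⟩ := s
  simp only [Quad] at hs
  cases i <;> simp only [g2, not_true] at hi <;> simp only [T, tab, lcf, cmp, Ix.mem, mS, List.map, List.sum_cons, List.sum_nil]
  case c =>
    by_cases h0 : (b1+b2) = 0 <;> by_cases h1 : c = 0 <;> first
    | (exfalso; grind; done)
    | (refine dvd_none ?_ ?_ <;> [(intro x; grind); grind])
    | (refine dvd_all ?_ ?_ <;> [(intro x; grind); grind])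
    | (refine dvd_one (-c/(b1+b2)) ?_ ?_ <;> [(intro x; grind); grind])
  case A1 =>
    by_cases h0 : a = 0 <;> by_cases h1 : b1 = 0 <;> by_cases h2 : b2 = 0 <;> by_cases h3 : b3 = 0 <;> by_cases h4 : c = 0 <;> first
    | (exfalso; grind; done)
    | (refine dvd_none ?_ ?_ <;> [(intro x; grind); grind])
    | (refine dvd_all ?_ ?_ <;> [(intro x; grind); grind])
    | (refine dvd_one (-b3/a) ?_ ?_ <;> [(intro x; grind); grind])
    | (refine dvd_one (-c/b1) ?_ ?_ <;> [(intro x; grind); grind])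
  case A2 =>
    by_cases h0 : a = 0 <;> by_cases h1 : b1 = 0 <;> by_cases h2 : b2 = 0 <;> by_cases h3 : b3 = 0 <;> by_cases h4 : c = 0 <;> first
    | (exfalso; grind; done)
    | (refine dvd_none ?_ ?_ <;> [(intro x; grind); grind])
    | (refine dvd_all ?_ ?_ <;> [(intro x; grind); grind])
    | (refine dvd_one (-b3/a) ?_ ?_ <;> [(intro x; grind); grind])
    | (refine dvd_one (-c/b2) ?_ ?_ <;> [(intro x; grind); grind])
  case A3 =>
    by_cases h0 : c = 0 <;> by_cases h1 : b1 = 0 <;> by_cases h2 : b2 = 0 <;> first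
    | (exfalso; grind; done)
    | (refine dvd_none ?_ ?_ <;> [(intro x; grind); grind])
    | (refine dvd_all ?_ ?_ <;> [(intro x; grind); grind])
  case pa =>
    by_cases h0 : a = 0 <;> by_cases h1 : b1 = 0 <;> by_cases h2 : b2 = 0 <;> by_cases h3 : c = 0 <;> by_cases h4 : b3 = 0 <;> first
    | (exfalso; grind; done)
    | (refine dvd_none ?_ ?_ <;> [(intro x; grind); grind])
    | (refine dvd_all ?_ ?_ <;> [(intro x; grind); grind])
    | (refine dvd_one (-b3/a) ?_ ?_ <;> [(intro x; grind); grind])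
  case pc =>
    by_cases h0 : b1 = 0 <;> by_cases h1 : b2 = 0 <;> by_cases h2 : a = 0 <;> by_cases h3 : b3 = 0 <;> first
    | (exfalso; grind; done)
    | (refine dvd_none ?_ ?_ <;> [(intro x; grind); grind])
    | (refine dvd_all ?_ ?_ <;> [(intro x; grind); grind])
  case p1 =>
    by_cases h0 : a = 0 <;> by_cases h1 : b2 = 0 <;> by_cases h2 : b3 = 0 <;> by_cases h3 : b1 = 0 <;> by_cases h4 : c = 0 <;> first
    | (exfalso; grind; done)
    | (refine dvd_none ?_ ?_ <;> [(intro x; grind); grind])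
    | (refine dvd_all ?_ ?_ <;> [(intro x; grind); grind])
    | (refine dvd_one (-c/b1) ?_ ?_ <;> [(intro x; grind); grind])
  case p2 =>
    by_cases h0 : a = 0 <;> by_cases h1 : b1 = 0 <;> by_cases h2 : b3 = 0 <;> by_cases h3 : b2 = 0 <;> by_cases h4 : c = 0 <;> first
    | (exfalso; grind; done)
    | (refine dvd_none ?_ ?_ <;> [(intro x; grind); grind])
    | (refine dvd_all ?_ ?_ <;> [(intro x; grind); grind])
    | (refine dvd_one (-c/b2) ?_ ?_ <;> [(intro x; grind); grind])
  case p3 =>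
    by_cases h0 : b1 = 0 <;> by_cases h1 : b2 = 0 <;> by_cases h2 : a = 0 <;> by_cases h3 : c = 0 <;> first
    | (exfalso; grind; done)
    | (refine dvd_none ?_ ?_ <;> [(intro x; grind); grind])
    | (refine dvd_all ?_ ?_ <;> [(intro x; grind); grind])
  case z =>
    by_cases h0 : a = 0 <;> by_cases h1 : b1 = 0 <;> by_cases h2 : b2 = 0 <;> by_cases h3 : b3 = 0 <;> by_cases h4 : c = 0 <;> first
    | (exfalso; grind; done)
    | (refine dvd_none ?_ ?_ <;> [(intro x; grind); grind])
    | (refine dvd_all ?_ ?_ <;> [(intro x; grind); grind])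

end C2

namespace C2

theorem lcf_mem {g : Ix → Prop} {low : Fam → Prop} (p n : List Ix)
    (hp : ∀ i ∈ p, g i) (hn : ∀ i ∈ n, g i) : Cl g low (lcf p n) := by
  induction p with
  | nil =>
    induction n with
    | nil =>
      have : lcf [] [] = fzero := by funext K _ _ s; simp [lcf, fzero]
      rw [this]; exact .zero
    | cons i n ih =>
      have : lcf [] (i :: n) = fadd (fneg (cmp i)) (lcf [] n) := by
        funext K _ _ s; simp [lcf, fadd, fneg]; ring
      rw [this]
      exact .add (.neg (.gen i (hn i (by simp)))) (ih fun j hj => hn j (by simp [hj]))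
  | cons i p ih =>
    have : lcf (i :: p) n = fadd (cmp i) (lcf p n) := by
      funext K _ _ s; simp [lcf, fadd]; ring
    rw [this]
    exact .add (.gen i (hp i (by simp))) (ih fun j hj => hp j (by simp [hj]))

theorem tab_g2 (m : Mv) (i : Ix) (hi : g2 i) (K : Type) [Field K] [Fintype K] (s : St K)
    (hs : Quad s) : T m (cmp i) K s = lcf (tab m i).1 (tab m i).2 K s
      + (Fintype.card K : ℤ) * lcf (tabq m i).1 (tabq m i).2 K s := by
  cases m
  · exact tab_P2 i hi K s hs
  · exact tab_S2 i hi K s hs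
  all_goals exact tab_exact _ (by simp) i K s hs

theorem tab_dvd (m : Mv) (i : Ix) (K : Type) [Field K] [Fintype K] (s : St K)
    (hs : Quad s) : (Fintype.card K : ℤ) ∣ T m (cmp i) K s - lcf (tab m i).1 (tab m i).2 K s := by
  by_cases hi : g2 i
  · rw [tab_g2 m i hi K s hs, add_sub_cancel_left]; exact dvd_mul_right _ _
  · cases m
    · exact tab_P3 i hi K s hs
    · exact tab_S3 i hi K s hs
    all_goals rw [tab_exact _ (by simp) i K s hs, add_sub_cancel_left]; exact dvd_mul_right _ _

theorem M3_T (m : Mv) (f : Fam) (hf : M3 f) : M3 (T m f) := by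
  refine Cl.T m (fun _ _ => trivial) (fun i _ => ?_) hf
  refine .step (lcf_mem (tab m i).1 (tab m i).2 (fun _ _ => trivial) (fun _ _ => trivial))
    (h := fun K _ _ s => (T m (cmp i) K s - lcf (tab m i).1 (tab m i).2 K s) / Fintype.card K)
    trivial ?_
  intro K _ _ s hs
  rw [Int.mul_ediv_cancel' (tab_dvd m i K s hs)]; ring

theorem M2_T (m : Mv) (f : Fam) (hf : M2 f) : M2 (T m f) := by
  refine Cl.T m (M3_T m) (fun i hi => ?_) hf
  refine .step (lcf_mem (tab m i).1 (tab m i).2 ?_ ?_)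
    (lcf_mem (tabq m i).1 (tabq m i).2 (fun _ _ => trivial) (fun _ _ => trivial))
    (fun K _ _ s hs => tab_g2 m i hi K s hs)
  · cases m <;> cases i <;> simp [tab, g2] at hi ⊢
  · cases m <;> cases i <;> simp [tab, g2] at hi ⊢

theorem M1_T (m : Mv) (f : Fam) (hf : M1 f) : M1 (T m f) := by
  refine Cl.T m (M2_T m) (fun i hi => ?_) hf
  subst hi
  refine .step (lcf_mem (tab m .a).1 (tab m .a).2 ?_ ?_)
    (lcf_mem (tabq m .a).1 (tabq m .a).2 ?_ ?_)
    (fun K _ _ s hs => tab_g2 m .a trivial K s hs)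
  all_goals cases m <;> simp [tab, tabq, g2]

/-- value of a word -/
noncomputable def run : List Mv → Fam
  | [] => cmp .a
  | m :: w => T m (run w)

theorem M1_run (w : List Mv) : M1 (run w) := by
  induction w with
  | nil => exact .gen _ rfl
  | cons m w ih => exact M1_T m _ ih

theorem run_val (w : List Mv) : HasVal 2 (run w) := by
  refine val_succ (g := fun i => i = Ix.a) (low := M2) ?_ ?_ (M1_run w)
  · rintro i rfl K _; simp [Ix.mem, s0]
  · intro h hh
    refine val_succ (g := g2) (low := M3) ?_ ?_ hh
    · intro i hi K _; cases i <;> simp [g2, Ix.mem, s0] at hi ⊢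
    · intro h hh; exact val_zero hh

end C2

namespace C2
set_option linter.unusedVariables false

section psi
variable {V : Type*} {K : Type} [Field K]

noncomputable def merge (f : V → V) (u v : V) : V → V := fun x => if f x = f u then f v else f x

noncomputable def psi (A : Set V) : List (V × V) → (V → V) → List K → K
  | [], f, _ => if ∀ a ∈ A, ∀ b ∈ A, f a = f b then 1 else 0
  | e :: l, f, x => x.headD 0 * psi A l f x.tail +
      if f e.1 = f e.2 then 0 else psi A l (merge f e.1 e.2) x.tail

def touch (l : List (V × V)) (v : V) : Prop := ∃ e ∈ l, v = e.1 ∨ v = e.2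

@[simp] theorem touch_nil (v : V) : touch [] v ↔ False := by simp [touch]
@[simp] theorem touch_cons (e : V × V) (l : List (V × V)) (v : V) :
    touch (e :: l) v ↔ v = e.1 ∨ v = e.2 ∨ touch l v := by simp [touch, or_assoc]
@[simp] theorem touch_append (l l' : List (V × V)) (v : V) :
    touch (l ++ l') v ↔ touch l v ∨ touch l' v := by
  induction l with
  | nil => simp
  | cons e l ih => simp [ih, or_assoc]

theorem psi_ext {A : Set V} {l : List (V × V)} (hl : ∀ v, touch l v → v ∈ A) {f f' : V → V}
    (h : ∀ x ∈ A, ∀ y ∈ A, f x = f y ↔ f' x = f' y) (x : List K) :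
    psi A l f x = psi A l f' x := by
  induction l generalizing f f' x with
  | nil =>
    simp only [psi]
    have : (∀ a ∈ A, ∀ b ∈ A, f a = f b) ↔ (∀ a ∈ A, ∀ b ∈ A, f' a = f' b) := by
      constructor
      · intro H a ha b hb; exact (h a ha b hb).1 (H a ha b hb)
      · intro H a ha b hb; exact (h a ha b hb).2 (H a ha b hb)
    simp [this]
  | cons e l ih =>
    obtain ⟨u, v⟩ := e
    have hu : u ∈ A := hl u (by simp)
    have hv : v ∈ A := hl v (by simp)
    have hl' : ∀ v, touch l v → v ∈ A := fun w hw => hl w (by simp [hw])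
    simp only [psi]
    rw [ih hl' h]
    congr 1
    rw [if_congr (h u hu v hv) rfl rfl]
    split_ifs with hh
    · rfl
    · apply ih hl'
      intro x hx y hy
      have h1 := h x hx u hu
      have h2 := h y hy u hu
      have h3 := h x hx v hv
      have h4 := h y hy v hv
      have h5 := h x hx y hy
      have h6 := h v hv y hy
      simp only [merge]
      grind

theorem psi_swap {A : Set V} {u v : V} {l : List (V × V)} (hl : ∀ w, touch ((u, v) :: l) w → w ∈ A)
    (f : V → V) (x : List K) : psi A ((u, v) :: l) f x = psi A ((v, u) :: l) f x := by
  have hl' : ∀ v, touch l v → v ∈ A := fun w hw => hl w (by simp [hw])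
  simp only [psi]
  congr 1
  rw [if_congr eq_comm rfl rfl]
  split_ifs with hh
  · rfl
  · apply psi_ext hl'
    intro x hx y hy
    simp only [merge]
    grind

theorem psi_drop {A : Set V} {l : List (V × V)} {d d' : V} (hd : ¬ touch l d)
    (hd' : d' ∈ A) (hne : d' ≠ d) {f : V → V} (h : f d = f d') (x : List K) :
    psi A l f x = psi (A \ {d}) l f x := by
  induction l generalizing f x with
  | nil =>
    simp only [psi]
    have : (∀ a ∈ A, ∀ b ∈ A, f a = f b) ↔ (∀ a ∈ A \ {d}, ∀ b ∈ A \ {d}, f a = f b) := by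
      constructor
      · intro H a ha b hb; exact H a ha.1 b hb.1
      · intro H
        have key : ∀ a ∈ A, f a = f d' := by
          intro a ha
          by_cases had : a = d
          · rw [had, h]
          · exact H a ⟨ha, had⟩ d' ⟨hd', hne⟩
        intro a ha b hb; rw [key a ha, key b hb]
    simp only [this]
  | cons e l ih =>
    have hd1 : ¬ touch l d := fun hw => hd (by simp [hw])
    simp only [psi]
    rw [ih hd1 h, ih hd1 (f := merge f e.1 e.2) (by simp only [merge, h])]

theorem psi_zero {A : Set V} {l : List (V × V)} (hl : ∀ v, touch l v → v ∈ A) {d d' : V}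
    (hd : ¬ touch l d) (hdA : d ∈ A)
    (hd' : d' ∈ A) (hne : d' ≠ d) {f : V → V} (h : ∀ y ∈ A, f y = f d → y = d) (x : List K) :
    psi A l f x = 0 := by
  induction l generalizing f x with
  | nil =>
    simp only [psi]
    rw [if_neg]
    intro H
    exact hne (h _ hd' (H _ hd' _ hdA))
  | cons e l ih =>
    obtain ⟨u, v⟩ := e
    have hd1 : ¬ touch l d := fun hw => hd (by simp [hw])
    have hu : u ∈ A := hl u (by simp)
    have hv : v ∈ A := hl v (by simp)
    have hl' : ∀ v, touch l v → v ∈ A := fun w hw => hl w (by simp [hw])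
    simp only [psi]
    rw [ih hl' hd1 h, ih hl' hd1 (f := merge f u v)]
    · simp
    · have hud : u ≠ d := by rintro rfl; exact hd (by simp)
      have hvd : v ≠ d := by rintro rfl; exact hd (by simp)
      intro y hy
      have h1 := h y hy
      have h2 := h u hu
      have h3 := h v hv
      simp only [merge]
      grind

end psi

section good
variable {V : Type*}

noncomputable def c3 (p q t : V) : V → V := fun x => if x = p ∨ x = q ∨ x = t then p else x
noncomputable def c2 (p q : V) : V → V := fun x => if x = p ∨ x = q then p else x

noncomputable def val {K : Type} [Field K] (A : Set V) (l : List (V × V)) (p q t : V) (s : St K)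
    (x : List K) : K :=
  s.a * psi A l (c3 p q t) x + s.b1 * psi A l (c2 q t) x + s.b2 * psi A l (c2 p t) x
    + s.b3 * psi A l (c2 p q) x + s.c * psi A l id x

noncomputable def sumL (K : Type) [Fintype K] : ℕ → (List K → ℤ) → ℤ
  | 0, F => F []
  | n + 1, F => ∑ y : K, sumL K n (fun x => F (y :: x))

def Good (l : List (V × V)) (A : Set V) (p q t : V) : Prop :=
  ∃ w : List Mv, ∀ (K : Type) [Field K] [Fintype K] (s : St K),
    sumL K l.length (fun x => if val A l p q t s x = 0 then 0 else 1) = run w K s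

theorem good_swap {l : List (V × V)} {A : Set V} {p q t u v : V}
    (hl : ∀ w, touch ((u, v) :: l) w → w ∈ A) 
    (h : Good ((v, u) :: l) A p q t) : Good ((u, v) :: l) A p q t := by
  obtain ⟨w, h⟩ := h
  refine ⟨w, fun K _ _ s => ?_⟩
  rw [← h K s]
  have : val A ((u, v) :: l) p q t s = val A ((v, u) :: l) p q t s := by
    funext x; simp only [val, psi_swap hl]
  rw [this]; rfl

theorem good_X {l : List (V × V)} {A : Set V} {p q t : V}
    (hl : ∀ w, touch l w → w ∈ A) (hpq : p ≠ q) (hpt : p ≠ t) (hqt : q ≠ t)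
    (h : Good l A q p t) : Good l A p q t := by
  obtain ⟨w, h⟩ := h
  refine ⟨.X :: w, fun K _ _ s => ?_⟩
  simp only [run, T]
  rw [← h K]
  congr 1; funext x
  have : val A l p q t s x = val A l q p t (mX s) x := by
    simp only [val, mX]
    rw [psi_ext hl (f := c3 p q t) (f' := c3 q p t), psi_ext hl (f := c2 p q) (f' := c2 q p)]
    · ring
    · simp only [c2]; grind
    · simp only [c3]; grind
  rw [this]

theorem good_Y {l : List (V × V)} {A : Set V} {p q t : V}
    (hl : ∀ w, touch l w → w ∈ A) (hpq : p ≠ q) (hpt : p ≠ t) (hqt : q ≠ t)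
    (h : Good l A p t q) : Good l A p q t := by
  obtain ⟨w, h⟩ := h
  refine ⟨.Y :: w, fun K _ _ s => ?_⟩
  simp only [run, T]
  rw [← h K]
  congr 1; funext x
  have : val A l p q t s x = val A l p t q (mY s) x := by
    simp only [val, mY]
    rw [psi_ext hl (f := c3 p q t) (f' := c3 p t q), psi_ext hl (f := c2 q t) (f' := c2 t q)]
    · ring
    · simp only [c2]; grind
    · simp only [c3]; grind
  rw [this]

theorem good_P {l : List (V × V)} {A : Set V} {p q t : V}
    (hl : ∀ w, touch l w → w ∈ A) (hpq : p ≠ q) (hpt : p ≠ t) (hqt : q ≠ t)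
    (h : Good l A p q t) : Good ((p, q) :: l) A p q t := by
  obtain ⟨w, h⟩ := h
  refine ⟨.P :: w, fun K _ _ s => ?_⟩
  simp only [run, T, ← h K, List.length_cons, sumL]
  refine Finset.sum_congr rfl fun y _ => ?_
  congr 1; funext x
  have : val A ((p, q) :: l) p q t s (y :: x) = val A l p q t (mP y s) x := by
    simp only [val, mP, psi, List.headD_cons, List.tail_cons]
    rw [if_pos (by simp [c3]), if_neg (by simp only [c2]; grind), if_neg (by simp only [c2]; grind),
      if_pos (by simp [c2]), if_neg (by simpa using hpq),
      psi_ext hl (f := merge (c2 q t) p q) (f' := c3 p q t),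
      psi_ext hl (f := merge (c2 p t) p q) (f' := c3 p q t),
      psi_ext hl (f := merge id p q) (f' := c2 p q)]
    · ring
    all_goals simp only [c2, c3, merge, id]; grind
  rw [this]

theorem good_F {l : List (V × V)} {A : Set V} {p q t u v : V}
    (hl : ∀ w, touch l w → w ∈ A) (hu : u ∈ A) (hv : v ∈ A) (huv : u ≠ v)
    (hvp : v ≠ p) (hvq : v ≠ q) (hvt : v ≠ t) (hd : ¬ touch l v)
    (h : Good l (A \ {v}) p q t) : Good ((u, v) :: l) A p q t := by
  obtain ⟨w, h⟩ := h
  refine ⟨.F :: w, fun K _ _ s => ?_⟩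
  simp only [run, T, ← h K, List.length_cons, sumL]
  refine Finset.sum_congr rfl fun y _ => ?_
  congr 1; funext x
  have hl' : ∀ w, touch l w → w ∈ A \ {v} := fun w hw => ⟨hl w hw, by rintro rfl; exact hd hw⟩
  have key : ∀ f : V → V, (∀ y, f y = f v → y = v) →
      psi A ((u, v) :: l) f (y :: x) = psi (A \ {v}) l f x := by
    intro f hf
    simp only [psi, List.headD_cons, List.tail_cons]
    rw [psi_zero hl hd hv hu huv (fun y _ => hf y), if_neg (fun h => huv (hf u h)),
      psi_drop (d := v) (d' := u) hd hu huv (by simp only [merge]; grind)]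
    rw [mul_zero, zero_add]
    apply psi_ext hl'
    rintro x ⟨hx, hxv⟩ y ⟨hy, hyv⟩
    have h1 := hf x
    have h2 := hf y
    simp only [merge]
    simp at hxv hyv
    grind
  have : val A ((u, v) :: l) p q t s (y :: x) = val (A \ {v}) l p q t s x := by
    simp only [val]
    rw [key, key, key, key, key]
    all_goals simp only [c2, c3, id]; grind
  rw [this]

theorem good_S {l : List (V × V)} {A : Set V} {p q t v : V}
    (hl : ∀ w, touch l w → w ∈ A) (hpq : p ≠ q) (hpt : p ≠ t) (hqt : q ≠ t)
    (hpA : p ∈ A) (hqA : q ∈ A) (htA : t ∈ A) (hv : v ∈ A)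
    (hvp : v ≠ p) (hvq : v ≠ q) (hvt : v ≠ t) (hd : ¬ touch l t)
    (h : Good l (A \ {t}) p q v) : Good ((t, v) :: l) A p q t := by
  obtain ⟨w, h⟩ := h
  refine ⟨.S :: w, fun K _ _ s => ?_⟩
  simp only [run, T, ← h K, List.length_cons, sumL]
  refine Finset.sum_congr rfl fun y _ => ?_
  congr 1; funext x
  have hl' : ∀ w, touch l w → w ∈ A \ {t} := fun w hw => ⟨hl w hw, by rintro rfl; exact hd hw⟩
  have : val A ((t, v) :: l) p q t s (y :: x) = val (A \ {t}) l p q v (mS y s) x := by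
    simp only [val, mS, psi, List.headD_cons, List.tail_cons]
    rw [if_neg (by simp only [c3]; grind), if_neg (by simp only [c2]; grind),
      if_neg (by simp only [c2]; grind), if_neg (by simp only [c2]; grind),
      if_neg (by simpa using hvt.symm)]
    rw [psi_zero (f := c2 p q) hl hd htA hpA hpt (by simp only [c2]; grind),
      psi_zero (f := id) hl hd htA hpA hpt (by simp)]
    rw [psi_drop (f := c3 p q t) (d' := p) hd hpA hpt (by simp [c3]),
      psi_drop (f := c2 q t) (d' := q) hd hqA hqt (by simp [c2]),
      psi_drop (f := c2 p t) (d' := p) hd hpA hpt (by simp [c2]),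
      psi_drop (f := merge (c3 p q t) t v) (d' := v) hd hv hvt (by simp [merge]),
      psi_drop (f := merge (c2 q t) t v) (d' := v) hd hv hvt (by simp [merge]),
      psi_drop (f := merge (c2 p t) t v) (d' := v) hd hv hvt (by simp [merge]),
      psi_drop (f := merge (c2 p q) t v) (d' := v) hd hv hvt (by simp [merge]),
      psi_drop (f := merge id t v) (d' := v) hd hv hvt (by simp [merge])]
    rw [psi_ext hl' (f := c3 p q t) (f' := c2 p q),
      psi_ext hl' (f := c2 q t) (f' := id),
      psi_ext hl' (f := c2 p t) (f' := id),
      psi_ext hl' (f := merge (c3 p q t) t v) (f' := c3 p q v),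
      psi_ext hl' (f := merge (c2 q t) t v) (f' := c2 q v),
      psi_ext hl' (f := merge (c2 p t) t v) (f' := c2 p v),
      psi_ext hl' (f := merge (c2 p q) t v) (f' := c2 p q),
      psi_ext hl' (f := merge id t v) (f' := id)]
    · ring
    all_goals
      simp only [c2, c3, merge, id]
      rintro x ⟨hx, hxv⟩ y ⟨hy, hyv⟩
      simp at hxv hyv
      grind
  rw [this]

theorem good_R {l : List (V × V)} {A : Set V} {p q t v : V}
    (hl : ∀ w, touch l w → w ∈ A) (hpq : p ≠ q) (hpt : p ≠ t) (hqt : q ≠ t)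
    (hpA : p ∈ A) (hqA : q ∈ A) (htA : t ∈ A) 
    (hvp : v ≠ p) (hvq : v ≠ q) (hvt : v ≠ t) (hd : ¬ touch l t)
    (h : Good l (A \ {t}) p q v) : Good l A p q t := by
  obtain ⟨w, h⟩ := h
  refine ⟨.R :: w, fun K _ _ s => ?_⟩
  simp only [run, T, ← h K]
  congr 1; funext x
  have hl' : ∀ w, touch l w → w ∈ A \ {t} := fun w hw => ⟨hl w hw, by rintro rfl; exact hd hw⟩
  have : val A l p q t s x = val (A \ {t}) l p q v (mR s) x := by
    simp only [val, mR]
    rw [psi_zero (f := c2 p q) hl hd htA hpA hpt (by simp only [c2]; grind),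
      psi_zero (f := id) hl hd htA hpA hpt (by simp)]
    rw [psi_drop (f := c3 p q t) (d' := p) hd hpA hpt (by simp [c3]),
      psi_drop (f := c2 q t) (d' := q) hd hqA hqt (by simp [c2]),
      psi_drop (f := c2 p t) (d' := p) hd hpA hpt (by simp [c2])]
    rw [psi_ext hl' (f := c3 p q t) (f' := c2 p q),
      psi_ext hl' (f := c2 q t) (f' := id),
      psi_ext hl' (f := c2 p t) (f' := id)]
    · ring
    all_goals
      simp only [c2, c3, id]
      rintro x ⟨hx, hxv⟩ y ⟨hy, hyv⟩
      simp at hxv hyv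
      grind
  rw [this]

theorem good_nil {A : Set V} {p q t : V} (hpq : p ≠ q) (hpt : p ≠ t) (hqt : q ≠ t)
    (hA : ∀ v, v ∈ A ↔ v = p ∨ v = q ∨ v = t) : Good [] A p q t := by
  refine ⟨[], fun K _ _ s => ?_⟩
  have : val A [] p q t s [] = s.a := by
    simp only [val, psi]
    rw [if_pos, if_neg, if_neg, if_neg, if_neg]
    · ring
    · intro H
      have h1 := H p (by simp [hA]) q (by simp [hA])
      simp at h1; grind
    · intro H
      have h1 := H p (by simp [hA]) t (by simp [hA])
      simp only [c2] at h1; grind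
    · intro H
      have h1 := H p (by simp [hA]) q (by simp [hA])
      simp only [c2] at h1; grind
    · intro H
      have h1 := H p (by simp [hA]) q (by simp [hA])
      simp only [c2] at h1; grind
    · simp only [hA, c3]; grind
  simp only [sumL, run, cmp, this, List.length_nil]
  by_cases h : s.a = 0
  · rw [if_pos h, if_pos (show Ix.a.mem s from h)]
  · rw [if_neg h, if_neg (show ¬ Ix.a.mem s from h)]

end good
end C2

namespace C2
set_option linter.unusedTactic false
set_option linter.unreachableTactic false
section main
variable {V : Type*}

def Ext (Bd : V → Prop) (e : V × V) : V → Prop := fun v => Bd v ∨ v = e.1 ∨ v = e.2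

def I3 (T : V → Prop) : (V → Prop) → List (V × V) → Prop
  | _, [] => True
  | Bd, e :: l => (¬ (T e.1 ∧ T e.2) → ∀ v, T v → Ext Bd e v) ∧ I3 T (Ext Bd e) l

def I5 : (V → Prop) → List (V × V) → Prop
  | _, [] => True
  | Bd, e :: l => (∃ v, (v = e.1 ∨ v = e.2) ∧ (Bd v ∨ touch l v)) ∧ I5 (Ext Bd e) l

def No4 (Bd : V → Prop) (l : List (V × V)) : Prop :=
  ∀ a b c d : V, a ≠ b → a ≠ c → a ≠ d → b ≠ c → b ≠ d → c ≠ d →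
    Bd a → Bd b → Bd c → Bd d → touch l a → touch l b → touch l c → touch l d → False

def I6 : (V → Prop) → List (V × V) → Prop
  | _, [] => True
  | Bd, e :: l => No4 (Ext Bd e) l ∧ I6 (Ext Bd e) l

theorem I3_sub {T Bd : V → Prop} {l : List (V × V)} (h : ∀ v, T v → Bd v) : I3 T Bd l := by
  induction l generalizing Bd with
  | nil => trivial
  | cons e l ih => exact ⟨fun _ v hv => Or.inl (h v hv), ih fun v hv => Or.inl (h v hv)⟩

theorem I6_of {Bd : V → Prop} {l : List (V × V)}
    (h : ∀ l1 l2, l = l1 ++ l2 → No4 (fun v => Bd v ∨ touch l1 v) l2) : I6 Bd l := by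
  induction l generalizing Bd with
  | nil => trivial
  | cons e l ih =>
    refine ⟨?_, ih ?_⟩
    · have := h [e] l rfl
      convert this using 2
      simp [Ext]
    · rintro l1 l2 rfl
      have := h (e :: l1) l2 rfl
      convert this using 2
      simp [Ext, or_assoc]

theorem I5_of {Bd : V → Prop} {l : List (V × V)}
    (h : ∀ l1 e l2, l = l1 ++ e :: l2 →
      ∃ v, (v = e.1 ∨ v = e.2) ∧ (Bd v ∨ touch l1 v ∨ touch l2 v)) : I5 Bd l := by
  induction l generalizing Bd with
  | nil => trivial
  | cons e l ih =>
    refine ⟨?_, ih ?_⟩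
    · simpa using h [] e l rfl
    · rintro l1 e' l2 rfl
      have := h (e :: l1) e' l2 rfl
      simpa [Ext, or_assoc] using this

structure Inv (l : List (V × V)) (Bd : V → Prop) (A : Set V) (T : V → Prop) : Prop where
  TA : ∀ v, T v → v ∈ A
  lA : ∀ v, touch l v → v ∈ A
  ne : ∀ e ∈ l, e.1 ≠ e.2
  i2 : ∀ v ∈ A, Bd v → T v
  i3 : I3 T Bd l
  i4 : ∀ v ∈ A, ¬ T v → touch l v
  i5 : I5 Bd l
  i6 : I6 Bd l

def Tri (T : V → Prop) (p q t : V) : Prop :=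
  p ≠ q ∧ p ≠ t ∧ q ≠ t ∧ ∀ v, T v ↔ v = p ∨ v = q ∨ v = t

theorem Inv.swap {u v : V} {l : List (V × V)} {Bd : V → Prop} {A : Set V} {T : V → Prop}
    (h : Inv ((u, v) :: l) Bd A T) : Inv ((v, u) :: l) Bd A T := by
  have he : Ext Bd (v, u) = Ext Bd (u, v) := by
    funext x; simp only [Ext]; exact propext (by tauto)
  have ht : ∀ x, touch ((v, u) :: l) x ↔ touch ((u, v) :: l) x := by
    intro x; simp only [touch_cons]; tauto
  obtain ⟨h1, h2, h3, h4, h5, h6, h7, h8⟩ := h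
  refine ⟨h1, by simpa only [ht] using h2, ?_, h4, ?_, by simpa only [ht] using h6, ?_, ?_⟩
  · simp only [List.mem_cons, forall_eq_or_imp] at h3 ⊢
    exact ⟨h3.1.symm, h3.2⟩
  · simp only [I3, he] at h5 ⊢
    exact ⟨fun h => h5.1 (by tauto), h5.2⟩
  · simp only [I5, he] at h7 ⊢
    obtain ⟨⟨x, hx, hx'⟩, h⟩ := h7
    exact ⟨⟨x, hx.symm, hx'⟩, h⟩
  · simp only [I6, he] at h8 ⊢
    exact h8

theorem Tri.perm {T : V → Prop} {l : List (V × V)} {A : Set V} {p q t p' q' t' : V}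
    (hl : ∀ v, touch l v → v ∈ A) (h : Tri T p q t) (h' : Tri T p' q' t')
    (hg : Good l A p' q' t') : Good l A p q t := by
  obtain ⟨h1, h2, h3, hT⟩ := h
  obtain ⟨h1', h2', h3', hT'⟩ := h'
  have hp := (hT p').1 ((hT' p').2 (by simp))
  have hq := (hT q').1 ((hT' q').2 (by simp))
  have ht := (hT t').1 ((hT' t').2 (by simp))
  rcases hp with rfl | rfl | rfl <;> rcases hq with rfl | rfl | rfl <;>
    rcases ht with rfl | rfl | rfl <;> first
    | contradiction
    | exact hg
    | (apply good_X hl <;> first | assumption | (apply Ne.symm; assumption))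
    | (apply good_Y hl <;> first | assumption | (apply Ne.symm; assumption))
    | (apply good_X hl <;> first | assumption | (apply Ne.symm; assumption) |
        (apply good_Y hl <;> first | assumption | (apply Ne.symm; assumption)))
    | (apply good_Y hl <;> first | assumption | (apply Ne.symm; assumption) |
        (apply good_X hl <;> first | assumption | (apply Ne.symm; assumption)))
    | (apply good_X hl <;> first | assumption | (apply Ne.symm; assumption) |
        (apply good_Y hl <;> first | assumption | (apply Ne.symm; assumption) |
          (apply good_X hl <;> first | assumption | (apply Ne.symm; assumption))))

theorem Tri.last {T : V → Prop} {p q t w : V} (h : Tri T p q t) (hw : T w) :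
    ∃ a b, Tri T a b w := by
  obtain ⟨h1, h2, h3, hT⟩ := h
  rcases (hT w).1 hw with rfl | rfl | rfl
  · exact ⟨q, t, by simp only [Tri]; grind⟩
  · exact ⟨p, t, by simp only [Tri]; grind⟩
  · exact ⟨p, q, by simp only [Tri]; grind⟩

theorem Tri.third {T : V → Prop} {p q t u v : V} (h : Tri T p q t) (hu : T u) (hv : T v)
    (huv : u ≠ v) : ∃ r, Tri T u v r := by
  obtain ⟨a, b, h1, h2, h3, hT⟩ := h.last hu
  rcases (hT v).1 hv with rfl | rfl | rfl
  · exact ⟨b, by simp only [Tri]; grind⟩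
  · exact ⟨a, by simp only [Tri]; grind⟩
  · exact absurd rfl huv

def IH (l : List (V × V)) : Prop := ∀ (Bd : V → Prop) (A : Set V) (T : V → Prop) (p q t : V),
  Inv l Bd A T → Tri T p q t → Good l A p q t

theorem step_i {u v : V} {l : List (V × V)} {Bd : V → Prop} {A : Set V} {T : V → Prop} {p q t : V}
    (ih : IH l) (h : Inv ((u, v) :: l) Bd A T) (hT : Tri T p q t) (hu : T u) (hv : T v) :
    Good ((u, v) :: l) A p q t := by
  have huv : u ≠ v := h.ne (u, v) (by simp)
  obtain ⟨r, hr⟩ := hT.third hu hv huv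
  refine Tri.perm h.lA hT hr ?_
  have hl : ∀ w, touch l w → w ∈ A := fun w hw => h.lA w (by simp [hw])
  refine good_P hl hr.1 hr.2.1 hr.2.2.1 ?_
  refine ih (Ext Bd (u, v)) A T u v r ⟨h.TA, hl, fun e he => h.ne e (by simp [he]), ?_, h.i3.2, ?_,
    h.i5.2, h.i6.2⟩ hr
  · rintro w hw (h1 | rfl | rfl)
    · exact h.i2 w hw h1
    · exact hu
    · exact hv
  · intro w hw hn
    have := h.i4 w hw hn
    simp only [touch_cons] at this
    rcases this with rfl | rfl | h1
    · exact absurd hu hn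
    · exact absurd hv hn
    · exact h1

def rep (T : V → Prop) (w x : V) : V → Prop := fun v => (T v ∧ v ≠ w) ∨ v = x

theorem Tri.rep {T : V → Prop} {a b w x : V} (h : Tri T a b w) (hx : ¬ T x) :
    Tri (rep T w x) a b x := by
  obtain ⟨h1, h2, h3, hT⟩ := h
  have := hT x
  simp only [Tri, C2.rep]
  grind

theorem step_R {u v x w : V} {l : List (V × V)} {Bd : V → Prop} {A : Set V} {T : V → Prop}
    {p q t : V}
    (h : Inv ((u, v) :: l) Bd A T) (hT : Tri T p q t) (hw : T w) (hw1 : w ≠ u) (hw2 : w ≠ v)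
    (hwl : ¬ touch l w) (hx : x = u ∨ x = v) (hxT : ¬ T x)
    (H : ∀ A' p' q' t', Inv ((u, v) :: l) Bd A' (rep T w x) → Tri (rep T w x) p' q' t' →
      Good ((u, v) :: l) A' p' q' t') : Good ((u, v) :: l) A p q t := by
  obtain ⟨a, b, hr⟩ := hT.last hw
  refine Tri.perm h.lA hT hr ?_
  have hwt : ¬ touch ((u, v) :: l) w := by simp [hw1, hw2, hwl]
  have ha : T a := (hr.2.2.2 a).2 (by simp)
  have hb : T b := (hr.2.2.2 b).2 (by simp)
  have hxA : x ∈ A := h.lA x (by rcases hx with rfl | rfl <;> simp)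
  have hne : ∀ z, T z → x ≠ z := by rintro z hz rfl; exact hxT hz
  have hhead : ∀ z, T z → Ext Bd (u, v) z := by
    apply h.i3.1
    rintro ⟨h1, h2⟩
    rcases hx with rfl | rfl
    · exact hxT h1
    · exact hxT h2
  have hsub : ∀ z, rep T w x z → Ext Bd (u, v) z := by
    rintro z (h1 | rfl)
    · exact hhead z h1.1
    · exact Or.inr hx
  refine good_R h.lA hr.1 hr.2.1 hr.2.2.1 (h.TA a ha) (h.TA b hb) (h.TA w hw)
    (hne a ha) (hne b hb) (hne w hw) hwt ?_
  refine H _ _ _ _ ⟨?_, ?_, h.ne, ?_, ?_, ?_, h.i5, h.i6⟩ (hr.rep hxT)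
  · rintro z (h1 | rfl)
    · exact ⟨h.TA z h1.1, h1.2⟩
    · exact ⟨hxA, by rintro rfl; exact hxT hw⟩
  · intro z hz
    exact ⟨h.lA z hz, by rintro rfl; exact hwt hz⟩
  · rintro z ⟨hz, hzw⟩ hB
    exact Or.inl ⟨h.i2 z hz hB, hzw⟩
  · exact ⟨fun _ => hsub, I3_sub hsub⟩
  · rintro z ⟨hz, hzw⟩ hn
    refine h.i4 z hz fun hTz => hn (Or.inl ⟨hTz, hzw⟩)

theorem step_ii {u v : V} {l : List (V × V)} {Bd : V → Prop} {A : Set V} {T : V → Prop} {p q t : V}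
    (ih : IH l) (h : Inv ((u, v) :: l) Bd A T) (hT : Tri T p q t) (hu : T u) (hv : ¬ T v) :
    Good ((u, v) :: l) A p q t := by
  have huv : u ≠ v := h.ne (u, v) (by simp)
  have hl : ∀ w, touch l w → w ∈ A := fun w hw => h.lA w (by simp [hw])
  have hhead : ∀ z, T z → Ext Bd (u, v) z := h.i3.1 (fun h1 => hv h1.2)
  have hvA : v ∈ A := h.lA v (by simp)
  have hne : ∀ z, T z → z ≠ v := by rintro z hz rfl; exact hv hz
  have hTp : T p := (hT.2.2.2 p).2 (by simp)
  have hTq : T q := (hT.2.2.2 q).2 (by simp)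
  have hTt : T t := (hT.2.2.2 t).2 (by simp)
  by_cases hvl : touch l v
  · have : ∃ w, T w ∧ ¬ touch l w := by
      by_contra hcon
      push Not at hcon
      exact h.i6.1 p q t v hT.1 hT.2.1 (hne p hTp) hT.2.2.1 (hne q hTq) (hne t hTt)
        (hhead p hTp) (hhead q hTq) (hhead t hTt) (Or.inr (Or.inr rfl))
        (hcon p hTp) (hcon q hTq) (hcon t hTt) hvl
    obtain ⟨w, hw, hwl⟩ := this
    by_cases hwu : w = u
    · subst hwu
      obtain ⟨a, b, hr⟩ := hT.last hw
      refine Tri.perm h.lA hT hr ?_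
      have ha : T a := (hr.2.2.2 a).2 (by simp)
      have hb : T b := (hr.2.2.2 b).2 (by simp)
      have hsub : ∀ z, rep T w v z → Ext Bd (w, v) z := by
        rintro z (h1 | rfl)
        · exact hhead z h1.1
        · exact Or.inr (Or.inr rfl)
      refine good_S hl hr.1 hr.2.1 hr.2.2.1 (h.TA a ha) (h.TA b hb) (h.TA w hw) hvA
        (hne a ha).symm (hne b hb).symm (hne w hw).symm hwl ?_
      refine ih (Ext Bd (w, v)) _ (rep T w v) _ _ _ ⟨?_, ?_, fun e he => h.ne e (by simp [he]), ?_,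
        I3_sub hsub, ?_, h.i5.2, h.i6.2⟩ (hr.rep hv)
      · rintro z (h1 | rfl)
        · exact ⟨h.TA z h1.1, h1.2⟩
        · exact ⟨hvA, huv.symm⟩
      · intro z hz
        exact ⟨hl z hz, by rintro rfl; exact hwl hz⟩
      · rintro z ⟨hz, hzw⟩ (h1 | h1 | h1)
        · exact Or.inl ⟨h.i2 z hz h1, hzw⟩
        · exact absurd h1 hzw
        · exact Or.inr h1
      · rintro z ⟨hz, hzw⟩ hn
        have h1 := h.i4 z hz fun hTz => hn (Or.inl ⟨hTz, hzw⟩)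
        simp only [touch_cons] at h1
        rcases h1 with h1 | h1 | h1
        · exact absurd h1 hzw
        · exact absurd (Or.inr h1) hn
        · exact h1
    · refine step_R h hT hw hwu (hne w hw) hwl (Or.inr rfl) hv ?_
      intro A' p' q' t' h' hT'
      exact step_i ih h' hT' (Or.inl ⟨hu, fun h => hwu h.symm⟩) (Or.inr rfl)
  · refine good_F hl (h.TA u hu) hvA huv (hne p hTp).symm (hne q hTq).symm (hne t hTt).symm hvl ?_
    refine ih (Ext Bd (u, v)) _ T _ _ _ ⟨?_, ?_, fun e he => h.ne e (by simp [he]), ?_,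
        I3_sub hhead, ?_, h.i5.2, h.i6.2⟩ hT
    · intro z hz
      exact ⟨h.TA z hz, hne z hz⟩
    · intro z hz
      exact ⟨hl z hz, by rintro rfl; exact hvl hz⟩
    · rintro z ⟨hz, hzw⟩ (h1 | h1 | h1)
      · exact h.i2 z hz h1
      · rw [h1]; exact hu
      · exact absurd h1 hzw
    · rintro z ⟨hz, hzw⟩ hn
      have h1 := h.i4 z hz hn
      simp only [touch_cons] at h1
      rcases h1 with h1 | h1 | h1
      · rw [h1] at hn; exact absurd hu hn
      · exact absurd h1 hzw
      · exact h1

theorem step_iv {u v : V} {l : List (V × V)} {Bd : V → Prop} {A : Set V} {T : V → Prop} {p q t : V}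
    (ih : IH l) (h : Inv ((u, v) :: l) Bd A T) (hT : Tri T p q t) (hu : ¬ T u) (hv : ¬ T v) :
    Good ((u, v) :: l) A p q t := by
  have hhead : ∀ z, T z → Ext Bd (u, v) z := h.i3.1 (fun h1 => hv h1.2)
  have hTp : T p := (hT.2.2.2 p).2 (by simp)
  have hTq : T q := (hT.2.2.2 q).2 (by simp)
  have hTt : T t := (hT.2.2.2 t).2 (by simp)
  obtain ⟨x, hx, hx'⟩ := h.i5.1
  have hxT : ¬ T x := by
    rcases hx with rfl | rfl
    · exact hu
    · exact hv
  have hxA : x ∈ A := h.lA x (by rcases hx with rfl | rfl <;> simp)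
  have hxl : touch l x := by
    rcases hx' with h1 | h1
    · exact absurd (h.i2 x hxA h1) hxT
    · exact h1
  have hne : ∀ z, T z → z ≠ x := by rintro z hz rfl; exact hxT hz
  have : ∃ w, T w ∧ ¬ touch l w := by
    by_contra hcon
    push Not at hcon
    exact h.i6.1 p q t x hT.1 hT.2.1 (hne p hTp) hT.2.2.1 (hne q hTq) (hne t hTt)
      (hhead p hTp) (hhead q hTq) (hhead t hTt) (Or.inr hx)
      (hcon p hTp) (hcon q hTq) (hcon t hTt) hxl
  obtain ⟨w, hw, hwl⟩ := this
  have hwu : w ≠ u := by rintro rfl; exact hu hw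
  have hwv : w ≠ v := by rintro rfl; exact hv hw
  refine step_R h hT hw hwu hwv hwl (Or.inl rfl) hu ?_
  intro A' p' q' t' h' hT'
  refine step_ii ih h' hT' (Or.inr rfl) ?_
  rintro (h1 | h1)
  · exact hv h1.1
  · exact h.ne (u, v) (by simp) h1.symm

theorem main (l : List (V × V)) : IH l := by
  induction l with
  | nil =>
    intro Bd A T p q t h hT
    refine good_nil hT.1 hT.2.1 hT.2.2.1 fun v => ?_
    rw [← hT.2.2.2 v]
    refine ⟨fun hv => ?_, h.TA v⟩
    by_contra hn
    simpa using h.i4 v hv hn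
  | cons e l ih =>
    obtain ⟨u, v⟩ := e
    intro Bd A T p q t h hT
    by_cases hu : T u <;> by_cases hv : T v
    · exact step_i ih h hT hu hv
    · exact step_ii ih h hT hu hv
    · exact good_swap h.lA (step_ii ih h.swap hT hv hu)
    · exact step_iv ih h hT hu hv

theorem val_s0 {K : Type} [Field K] (A : Set V) (l : List (V × V)) (p q t : V) (x : List K) :
    val A l p q t s0 x = psi A l id x := by simp [val, s0]

/-- The initial configuration. -/
theorem start {e1 e2 : V × V} {l : List (V × V)} (hne : ∀ e ∈ e1 :: e2 :: l, e.1 ≠ e.2)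
    (h12 : s(e1.1, e1.2) ≠ s(e2.1, e2.2)) (ht : ∀ v, touch (e1 :: e2 :: l) v)
    (h5 : I5 (fun _ => False) (e1 :: e2 :: l)) (h6 : I6 (fun _ => False) (e1 :: e2 :: l)) :
    ∃ c : ℤ, ∀ (K : Type) [Field K] [Fintype K],
      (Fintype.card K : ℤ) ^ 3 ∣ sumL K (e1 :: e2 :: l).length
        (fun x => if psi (K := K) Set.univ (e1 :: e2 :: l) id x = 0 then 0 else 1)
        - c * (Fintype.card K : ℤ) ^ 2 := by
  obtain ⟨p, q⟩ := e1
  have hpq : p ≠ q := hne (p, q) (by simp)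
  have : ∃ t, t ≠ p ∧ t ≠ q ∧ (t = e2.1 ∨ t = e2.2) := by
    by_contra hcon
    push Not at hcon
    have h1 := hcon e2.1
    have h2 := hcon e2.2
    have h3 := hne e2 (by simp)
    apply h12
    rw [Sym2.eq_iff]
    simp only
    grind
  obtain ⟨t, htp, htq, hte⟩ := this
  have hg : Good ((p, q) :: e2 :: l) Set.univ p q t := by
    refine main _ (fun _ => False) Set.univ (fun v => v = p ∨ v = q ∨ v = t) p q t
      ⟨by simp, by simp, hne, by simp, ⟨fun h => absurd (by simp) h, ?_, ?_⟩, fun v _ _ => ht v,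
        h5, h6⟩
      ⟨hpq, htp.symm, htq.symm, by simp⟩
    · rintro _ v (rfl | rfl | rfl)
      · simp [Ext]
      · simp [Ext]
      · exact Or.inr hte
    · apply I3_sub
      rintro v (rfl | rfl | rfl)
      · simp [Ext]
      · simp [Ext]
      · exact Or.inr hte
  obtain ⟨w, hw⟩ := hg
  obtain ⟨c, hc⟩ := run_val w
  refine ⟨c, fun K _ _ => ?_⟩
  have h1 := hc K
  rw [← hw K s0] at h1
  simpa only [val_s0] using h1

end main
end C2

namespace C2
section tree
variable {V : Type*}

def conn (f : V → V) {n : ℕ} (e : Fin n → V × V) (B : Fin n → Bool) : Prop :=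
  ∀ S : Set V, (∀ x y, f x = f y → (x ∈ S ↔ y ∈ S)) →
    (∀ i, B i = true → ((e i).1 ∈ S ↔ (e i).2 ∈ S)) → ∀ x y, (x ∈ S ↔ y ∈ S)

def nb {n : ℕ} (B : Fin n → Bool) : ℕ := ∑ i, if B i = true then 1 else 0

theorem conn_false (f : V → V) {n : ℕ} (e : Fin (n+1) → V × V) (B : Fin n → Bool) :
    conn f e (Fin.cons false B) ↔ conn f (fun i => e i.succ) B := by
  simp [conn, Fin.forall_fin_succ]

theorem conn_true (f : V → V) {n : ℕ} (e : Fin (n+1) → V × V) (B : Fin n → Bool) :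
    conn f e (Fin.cons true B) ↔ conn (merge f (e 0).1 (e 0).2) (fun i => e i.succ) B := by
  simp only [conn, Fin.forall_fin_succ, Fin.cons_zero, Fin.cons_succ, forall_const]
  refine forall_congr' fun S => ?_
  constructor
  · intro h h1 h2
    refine h (fun x y hxy => h1 x y (by simp only [merge, hxy])) ⟨h1 _ _ ?_, h2⟩
    simp only [merge]; grind
  · rintro h h1 ⟨h0, h2⟩
    refine h ?_ h2
    intro x y
    have a1 := h1 x y
    have a2 := h1 x (e 0).1
    have a3 := h1 x (e 0).2
    have a4 := h1 y (e 0).1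
    have a5 := h1 y (e 0).2
    simp only [merge]
    grind

theorem nb_false {n : ℕ} (B : Fin n → Bool) : nb (Fin.cons false B : Fin (n+1) → Bool) = nb B := by
  rw [nb, Fin.sum_univ_succ]
  simp only [Fin.cons_zero, Fin.cons_succ]
  rw [nb, if_neg (by simp), zero_add]
theorem nb_true {n : ℕ} (B : Fin n → Bool) : nb (Fin.cons true B : Fin (n+1) → Bool) = nb B + 1 := by
  rw [nb, Fin.sum_univ_succ]
  simp only [Fin.cons_zero, Fin.cons_succ]
  rw [nb, if_pos (by simp), add_comm]

variable [Fintype V]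

noncomputable def rk (f : V → V) : ℕ := (Finset.univ.image f).card

theorem rk_le (f : V → V) (u v : V) : rk f ≤ rk (merge f u v) + 1 := by
  have : Finset.univ.image f ⊆ insert (f u) (Finset.univ.image (merge f u v)) := by
    intro y hy
    simp only [Finset.mem_image, Finset.mem_univ, true_and, Finset.mem_insert] at hy ⊢
    obtain ⟨x, rfl⟩ := hy
    by_cases h : f x = f u
    · exact Or.inl h
    · exact Or.inr ⟨x, by simp [merge, h]⟩
  exact (Finset.card_le_card this).trans (Finset.card_insert_le _ _)

theorem rk_merge (f : V → V) (u v : V) (h : f u ≠ f v) : rk f = rk (merge f u v) + 1 := by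
  have : Finset.univ.image f = insert (f u) (Finset.univ.image (merge f u v)) := by
    ext y
    simp only [Finset.mem_image, Finset.mem_univ, true_and, Finset.mem_insert]
    constructor
    · rintro ⟨x, rfl⟩
      by_cases h : f x = f u
      · exact Or.inl h
      · exact Or.inr ⟨x, by simp [merge, h]⟩
    · rintro (rfl | ⟨x, rfl⟩)
      · exact ⟨u, rfl⟩
      · simp only [merge]; split_ifs
        · exact ⟨v, rfl⟩
        · exact ⟨x, rfl⟩
  rw [rk, this, Finset.card_insert_of_notMem]
  · rfl
  · simp only [Finset.mem_image, Finset.mem_univ, true_and, not_exists, merge]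
    intro x; grind

theorem rk_conn [Nonempty V] {n : ℕ} (f : V → V) (e : Fin n → V × V) (B : Fin n → Bool)
    (h : conn f e B) : rk f ≤ nb B + 1 := by
  induction n generalizing f with
  | zero =>
    have h0 : ∀ a b, f a = f b := by
      intro a b
      have := h {x | f x = f b} (fun x y hxy => by simp [hxy]) (fun i => i.elim0) a b
      simpa using this
    rw [rk]
    refine le_trans (Finset.card_le_one.2 ?_) (by omega)
    simp only [Finset.mem_image, Finset.mem_univ, true_and]
    rintro _ ⟨x, rfl⟩ _ ⟨y, rfl⟩
    exact h0 x y
  | succ n ih =>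
    obtain ⟨b, B, rfl⟩ : ∃ b B', B = Fin.cons b B' := ⟨B 0, Fin.tail B, (Fin.cons_self_tail B).symm⟩
    cases b
    · rw [conn_false] at h
      rw [nb_false]
      exact ih _ _ _ h
    · rw [conn_true] at h
      rw [nb_true]
      have := ih _ _ _ h
      have := rk_le f (e 0).1 (e 0).2
      omega

theorem ite_iff {α : Type*} {p q : Prop} {i : Decidable p} {j : Decidable q} {a b : α}
    (h : p ↔ q) : @ite α p i a b = @ite α q j a b := by
  by_cases hp : p
  · rw [if_pos hp, if_pos (h.1 hp)]
  · rw [if_neg hp, if_neg (fun hq => hp (h.2 hq))]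

theorem psi_sum [Nonempty V] {K : Type} [Field K] {n : ℕ} (f : V → V) (e : Fin n → V × V)
    (x : Fin n → K) : psi Set.univ (List.ofFn e) f (List.ofFn x) =
      ∑ B : Fin n → Bool, if conn f e B ∧ nb B + 1 = rk f then
        ∏ i, (if B i = true then 1 else x i) else 0 := by
  induction n generalizing f with
  | zero =>
    simp only [List.ofFn_zero, psi, Finset.univ_unique, Finset.sum_singleton, Finset.univ_eq_empty,
      Finset.prod_empty]
    refine ite_iff ?_
    constructor
    · intro h
      refine ⟨?_, ?_⟩
      · intro S h1 _ a b
        exact h1 a b (h a trivial b trivial)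
      · obtain ⟨a⟩ := ‹Nonempty V›
        have : Finset.univ.image f = {f a} := by
          ext y; simp only [Finset.mem_image, Finset.mem_univ, true_and, Finset.mem_singleton]
          constructor
          · rintro ⟨z, rfl⟩; exact h z trivial a trivial
          · rintro rfl; exact ⟨a, rfl⟩
        simp [rk, this, nb]
    · rintro ⟨h, _⟩ a _ b _
      have := h {x | f x = f b} (fun x y hxy => by simp [hxy]) (fun i => i.elim0) a b
      simpa using this
  | succ n ih =>
    rw [List.ofFn_succ, List.ofFn_succ]
    simp only [psi, List.headD_cons, List.tail_cons]
    rw [← (Fin.consEquiv (fun _ : Fin (n+1) => Bool)).sum_comp, Fintype.sum_prod_type,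
      Fintype.sum_bool]
    simp only [Fin.consEquiv, Equiv.coe_fn_mk, conn_true, conn_false, nb_true, nb_false,
      Fin.prod_univ_succ, Fin.cons_zero, Fin.cons_succ]
    rw [add_comm]
    congr 1
    · split_ifs with h
      · symm
        apply Finset.sum_eq_zero
        intro B _
        rw [if_neg]
        rintro ⟨h1, h2⟩
        have h3 : merge f (e 0).1 (e 0).2 = f := by
          funext z; simp only [merge]; grind
        rw [h3] at h1
        have := rk_conn _ _ _ h1
        omega
      · rw [ih]
        refine Finset.sum_congr rfl fun B _ => ?_
        have h3 := rk_merge f _ _ h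
        simp only [h3, Nat.add_right_cancel_iff]
        simp
    · rw [ih, Finset.mul_sum]
      refine Finset.sum_congr rfl fun B _ => ?_
      simp

theorem sumL_eq (K : Type) [Fintype K] (n : ℕ) (F : List K → ℤ) :
    sumL K n F = ∑ y : Fin n → K, F (List.ofFn y) := by
  induction n generalizing F with
  | zero => simp [sumL]
  | succ n ih =>
    rw [sumL, ← (Fin.consEquiv (fun _ : Fin (n+1) => K)).sum_comp, Fintype.sum_prod_type]
    refine Finset.sum_congr rfl fun a _ => ?_
    rw [ih]
    refine Finset.sum_congr rfl fun B _ => ?_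
    simp [Fin.consEquiv, List.ofFn_succ]

end tree
end C2

namespace C2
section link
variable {V : Type*}

theorem cut {H : SimpleGraph V} (hH : H.Connected) (S : Set V)
    (hS : ∀ a b, H.Adj a b → (a ∈ S ↔ b ∈ S)) (x y : V) : x ∈ S ↔ y ∈ S := by
  obtain ⟨w⟩ := hH.preconnected x y
  induction w with
  | nil => rfl
  | cons h _ ih => exact (hS _ _ h).trans ih

theorem conn_iff [Nonempty V] {n : ℕ} (e : Fin n → V × V) (B : Fin n → Bool) (H : SimpleGraph V)
    (h1 : ∀ i, B i = true → H.Adj (e i).1 (e i).2)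
    (h2 : ∀ a b, H.Adj a b → ∃ i, B i = true ∧ s((e i).1, (e i).2) = s(a, b)) :
    conn id e B ↔ H.Connected := by
  constructor
  · intro h
    rw [SimpleGraph.connected_iff]
    refine ⟨fun x y => ?_, inferInstance⟩
    have := h {z | H.Reachable x z} (fun a b hab => by rw [show a = b from hab])
      (fun i hi => ⟨fun hr => hr.trans (h1 i hi).reachable,
        fun hr => hr.trans (h1 i hi).symm.reachable⟩) x y
    exact this.1 (SimpleGraph.Reachable.refl x)
  · intro h S _ hS x y
    refine cut h S (fun a b hab => ?_) x y
    obtain ⟨i, hi, he⟩ := h2 a b hab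
    have := hS i hi
    rw [Sym2.eq_iff] at he
    rcases he with ⟨rfl, rfl⟩ | ⟨rfl, rfl⟩
    · exact this
    · exact this.symm

theorem touch_take {n : ℕ} {e : Fin n → V × V} {l1 l2 : List (V × V)}
    (h : List.ofFn e = l1 ++ l2) {v : V} (ht : touch l1 v) :
    ∃ i : Fin n, (i : ℕ) < l1.length ∧ (v = (e i).1 ∨ v = (e i).2) := by
  obtain ⟨d, hd, hv⟩ := ht
  obtain ⟨k, hk, rfl⟩ := List.mem_iff_getElem.1 hd
  have hn : n = l1.length + l2.length := by
    have := congrArg List.length h; simpa using this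
  have h3 : (List.ofFn e)[k]'(by simp; omega) = l1[k] := by
    simp only [h]; exact List.getElem_append_left hk
  rw [List.getElem_ofFn] at h3
  exact ⟨⟨k, by omega⟩, hk, by rw [h3]; exact hv⟩

theorem touch_drop {n : ℕ} {e : Fin n → V × V} {l1 l2 : List (V × V)}
    (h : List.ofFn e = l1 ++ l2) {v : V} (ht : touch l2 v) :
    ∃ i : Fin n, l1.length ≤ (i : ℕ) ∧ (v = (e i).1 ∨ v = (e i).2) := by
  obtain ⟨d, hd, hv⟩ := ht
  obtain ⟨k, hk, rfl⟩ := List.mem_iff_getElem.1 hd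
  have hn : n = l1.length + l2.length := by
    have := congrArg List.length h; simpa using this
  have h3 : (List.ofFn e)[l1.length + k]'(by simp; omega) = l2[k] := by
    simp only [h]; rw [List.getElem_append_right (by omega)]; simp
  rw [List.getElem_ofFn] at h3
  exact ⟨⟨l1.length + k, by omega⟩, by simp, by rw [h3]; exact hv⟩

variable [Fintype V]

theorem touch_all {G : SimpleGraph V} (hG : G.Connected) (hV : 3 ≤ Fintype.card V)
    {l : List (V × V)} (hl : ∀ a b, G.Adj a b → ∃ d ∈ l, s(d.1, d.2) = s(a, b)) (v : V) :
    touch l v := by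
  by_contra hv
  have hc := cut hG {v} (fun a b hab => by
    obtain ⟨d, hd, he⟩ := hl a b hab
    have : ∀ z, touch l z → z ≠ v := fun z hz h => hv (h ▸ hz)
    have h1 : a ≠ v := this a ⟨d, hd, by rw [Sym2.eq_iff] at he; grind⟩
    have h2 : b ≠ v := this b ⟨d, hd, by rw [Sym2.eq_iff] at he; grind⟩
    simp [h1, h2])
  obtain ⟨w, hw⟩ := Fintype.exists_ne_of_one_lt_card (by omega : 1 < Fintype.card V) v
  exact hw ((hc w v).2 rfl)

theorem I5_conn {G : SimpleGraph V} (hG : G.Connected) (hV : 3 ≤ Fintype.card V)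
    {l : List (V × V)} (hl : ∀ a b, G.Adj a b → ∃ d ∈ l, s(d.1, d.2) = s(a, b)) :
    I5 (fun _ => False) l := by
  refine I5_of fun l1 e l2 hs => ?_
  by_contra hcon
  push Not at hcon
  have hc := cut hG {z | z = e.1 ∨ z = e.2} (fun a b hab => by
    obtain ⟨d, hd, he⟩ := hl a b hab
    have ha : a = d.1 ∨ a = d.2 := by rw [Sym2.eq_iff] at he; grind
    have hb : b = d.1 ∨ b = d.2 := by rw [Sym2.eq_iff] at he; grind
    rw [hs, List.mem_append, List.mem_cons] at hd
    have key : ∀ z, (touch l1 z ∨ touch l2 z) → ¬ (z = e.1 ∨ z = e.2) := fun z hz h => by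
      have := hcon z h
      tauto
    rcases hd with hd | rfl | hd
    · exact iff_of_false (key a (Or.inl ⟨d, hd, ha⟩)) (key b (Or.inl ⟨d, hd, hb⟩))
    · exact iff_of_true ha hb
    · exact iff_of_false (key a (Or.inr ⟨d, hd, ha⟩)) (key b (Or.inr ⟨d, hd, hb⟩)))
  have : ∃ w, w ∉ ({e.1, e.2} : Finset V) := by
    by_contra h
    push Not at h
    have h1 := Finset.card_le_card (fun z _ => h z : (Finset.univ : Finset V) ⊆ {e.1, e.2})
    have := Finset.card_le_two (a := e.1) (b := e.2)
    rw [Finset.card_univ] at h1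
    omega
  obtain ⟨w, hw⟩ := this
  apply hw
  have := (hc w e.1).2 (Or.inl rfl)
  simpa using this

theorem I6_width {n : ℕ} {e : Fin n → V × V}
    (h : ∀ k : ℕ, Nat.card {v : V // (∃ i : Fin n, (i : ℕ) < k ∧ v ∈ s((e i).1, (e i).2)) ∧
                       (∃ i : Fin n, k ≤ (i : ℕ) ∧ v ∈ s((e i).1, (e i).2))} ≤ 3) :
    I6 (fun _ => False) (List.ofFn e) := by
  refine I6_of fun l1 l2 hs => ?_
  intro a b c d hab hac had hbc hbd hcd ha hb hc hd ha' hb' hc' hd'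
  have hk := h l1.length
  have mem : ∀ z, (False ∨ touch l1 z) → touch l2 z →
      (∃ i : Fin n, (i : ℕ) < l1.length ∧ z ∈ s((e i).1, (e i).2)) ∧
                       (∃ i : Fin n, l1.length ≤ (i : ℕ) ∧ z ∈ s((e i).1, (e i).2)) := by
    intro z h1 h2
    rw [false_or] at h1
    simp only [Sym2.mem_iff]
    exact ⟨touch_take hs h1, touch_drop hs h2⟩
  rw [Nat.card_eq_fintype_card, Fintype.card_subtype] at hk
  have : ({a, b, c, d} : Finset V) ⊆ Finset.univ.filter (fun z =>
      (∃ i : Fin n, (i : ℕ) < l1.length ∧ z ∈ s((e i).1, (e i).2)) ∧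
                       (∃ i : Fin n, l1.length ≤ (i : ℕ) ∧ z ∈ s((e i).1, (e i).2))) := by
    intro z hz
    simp only [Finset.mem_insert, Finset.mem_singleton] at hz
    rw [Finset.mem_filter]
    refine ⟨Finset.mem_univ _, ?_⟩
    rcases hz with rfl | rfl | rfl | rfl
    · exact mem _ ha ha'
    · exact mem _ hb hb'
    · exact mem _ hc hc'
    · exact mem _ hd hd'
  have h1 := Finset.card_le_card this
  have h2 : ({a, b, c, d} : Finset V).card = 4 := by
    rw [Finset.card_insert_of_notMem, Finset.card_insert_of_notMem, Finset.card_insert_of_notMem,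
      Finset.card_singleton] <;> simp [*]
  omega

theorem gp_psi [Nonempty V] (G : SimpleGraph V) {n : ℕ} (σ : Fin n ≃ G.edgeSet)
    (e : Fin n → V × V) (he : ∀ i, s((e i).1, (e i).2) = (σ i : Sym2 V))
    {K : Type} [Field K] (x : G.edgeSet → K) :
    MvPolynomial.aeval x (graphPoly G) =
      psi Set.univ (List.ofFn e) id (List.ofFn fun i => x (σ i)) := by
  rw [psi_sum]
  letI : Fintype G.edgeSet := Fintype.ofFinite _
  have hgp : graphPoly G = ∑ T : Finset G.edgeSet,
    if (SimpleGraph.fromEdgeSet (Subtype.val '' (T : Set G.edgeSet))).IsTree then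
      ∏ e ∈ Tᶜ, MvPolynomial.X e
    else 0 := rfl
  rw [hgp, map_sum]
  let toB : Finset G.edgeSet → (Fin n → Bool) := fun T i => decide (σ i ∈ T)
  have hbij : Function.Bijective toB := by
    constructor
    · intro T T' h
      ext z
      have := congrFun h (σ.symm z)
      simpa [toB] using this
    · intro B
      refine ⟨Finset.univ.filter (fun z => B (σ.symm z) = true), ?_⟩
      funext i
      simp [toB]
  refine Fintype.sum_bijective toB hbij _ _ fun T => ?_
  have hB : ∀ i, toB T i = true ↔ σ i ∈ T := fun i => by simp [toB]
  have hadj : ∀ i, (e i).1 ≠ (e i).2 := by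
    intro i h
    have h1 := (σ i).2
    rw [← he i, SimpleGraph.mem_edgeSet] at h1
    exact h1.ne h
  have key : (SimpleGraph.fromEdgeSet (Subtype.val '' (T : Set G.edgeSet))).IsTree ↔
      (conn id e (toB T) ∧ nb (toB T) + 1 = rk (id : V → V)) := by
    rw [SimpleGraph.isTree_iff_connected_and_card]
    have h1 : conn id e (toB T) ↔
        (SimpleGraph.fromEdgeSet (Subtype.val '' (T : Set G.edgeSet))).Connected := by
      apply conn_iff
      · intro i hi
        rw [SimpleGraph.fromEdgeSet_adj]
        exact ⟨⟨σ i, (hB i).1 hi, (he i).symm⟩, hadj i⟩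
      · intro a b hab
        rw [SimpleGraph.fromEdgeSet_adj] at hab
        obtain ⟨⟨z, hz, hz'⟩, _⟩ := hab
        refine ⟨σ.symm z, (hB _).2 (by simpa using hz), ?_⟩
        rw [he]; simpa using hz'
    have h2 : nb (toB T) = T.card := by
      have : nb (toB T) = (Finset.univ.filter (fun i => σ i ∈ T)).card := by
        rw [nb, Finset.card_filter]
        exact Finset.sum_congr rfl fun i _ => ite_iff (hB i)
      rw [this]
      refine Finset.card_bij (fun i _ => σ i) (fun i hi => (Finset.mem_filter.1 hi).2)
        (fun i _ j _ h => σ.injective h) (fun z hz => ⟨σ.symm z, by simpa using hz, by simp⟩)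
    have h3 : Nat.card (SimpleGraph.fromEdgeSet (Subtype.val '' (T : Set G.edgeSet))).edgeSet
        = T.card := by
      have h4 : (SimpleGraph.fromEdgeSet (Subtype.val '' (T : Set G.edgeSet))).edgeSet =
          Subtype.val '' (T : Set G.edgeSet) := by
        rw [SimpleGraph.edgeSet_fromEdgeSet]
        ext d
        constructor
        · exact fun h => h.1
        · rintro ⟨z, hz, rfl⟩
          exact ⟨⟨z, hz, rfl⟩, fun hd => G.not_isDiag_of_mem_edgeSet z.2 hd⟩
      rw [h4, Nat.card_image_of_injective Subtype.val_injective]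
      simp
    have h5 : rk (id : V → V) = Nat.card V := by simp [rk]
    rw [h1, h2, h3, h5]
  by_cases hT : (SimpleGraph.fromEdgeSet (Subtype.val '' (T : Set G.edgeSet))).IsTree
  · rw [if_pos hT, if_pos (key.1 hT), map_prod]
    simp only [MvPolynomial.aeval_X]
    rw [← Equiv.prod_comp σ.symm]
    have : ∀ z : G.edgeSet, (if toB T (σ.symm z) = true then 1 else x (σ (σ.symm z))) =
        if z ∈ Tᶜ then x z else 1 := by
      intro z
      have := hB (σ.symm z)
      rw [Equiv.apply_symm_apply] at this ⊢
      by_cases hz : z ∈ T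
      · rw [if_pos (this.2 hz), if_neg (by simpa using hz)]
      · rw [if_neg (fun h => hz (this.1 h)), if_pos (by simpa using hz)]
    simp only [this]
    rw [Finset.prod_ite_mem, Finset.univ_inter]
  · rw [if_neg hT, if_neg (fun h => hT (key.2 h)), map_zero]

theorem count_eq [Nonempty V] (G : SimpleGraph V) {n : ℕ} (σ : Fin n ≃ G.edgeSet)
    (e : Fin n → V × V) (he : ∀ i, s((e i).1, (e i).2) = (σ i : Sym2 V))
    (K : Type) [Field K] [Fintype K] :
    sumL K n (fun x => if psi (K := K) Set.univ (List.ofFn e) id x = 0 then 0 else 1) =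
      (Fintype.card K : ℤ) ^ n - Xcount G K := by
  rw [sumL_eq]
  have h1 : Xcount G K = (Finset.univ.filter (fun y : Fin n → K =>
      psi (K := K) Set.univ (List.ofFn e) id (List.ofFn y) = 0)).card := by
    rw [Xcount, ← Fintype.card_subtype, ← Nat.card_eq_fintype_card]
    refine Nat.card_congr ((Equiv.arrowCongr σ.symm (Equiv.refl K)).subtypeEquiv fun x => ?_)
    rw [gp_psi G σ e he]
    rfl
  have h2 : (∑ y : Fin n → K,
      (if psi (K := K) Set.univ (List.ofFn e) id (List.ofFn y) = 0 then (0:ℤ) else 1)) +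
      (Finset.univ.filter (fun y : Fin n → K =>
      psi (K := K) Set.univ (List.ofFn e) id (List.ofFn y) = 0)).card = 
      (Fintype.card K : ℤ) ^ n := by
    rw [Finset.card_filter, Nat.cast_sum, ← Finset.sum_add_distrib]
    have : ∀ y : Fin n → K, (if psi (K := K) Set.univ (List.ofFn e) id (List.ofFn y) = 0 then (0:ℤ)
      else 1) + ((if psi (K := K) Set.univ (List.ofFn e) id (List.ofFn y) = 0 then 1 else 0 : ℕ) : ℤ)
      = 1 := by intro y; split_ifs <;> simp
    simp only [this]
    simp
  rw [h1, ← h2]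
  ring

end link
end C2

theorem stmt9 {V : Type*} [Fintype V] (G : SimpleGraph V) (hG : G.Connected)
    (hV : 3 ≤ Fintype.card V) (hw : VertexWidthLE G 3) :
    ∃ c : ℤ, ∀ (K : Type) [Field K] [Fintype K],
      (Xcount G K : ℤ) ≡ c * (Fintype.card K : ℤ) ^ 2
        [ZMOD ((Fintype.card K : ℤ)) ^ 3] := by
  obtain ⟨N, σ, hσ⟩ := hw
  haveI : Nonempty V := hG.nonempty
  have hex : ∀ i, ∃ d : V × V, s(d.1, d.2) = (σ i : Sym2 V) := by
    intro i
    induction (σ i : Sym2 V) using Sym2.ind with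
    | _ a b => exact ⟨(a, b), rfl⟩
  choose e he using hex
  have hl : ∀ a b, G.Adj a b → ∃ d ∈ List.ofFn e, s(d.1, d.2) = s(a, b) := by
    intro a b hab
    refine ⟨e (σ.symm ⟨s(a, b), hab⟩), by simp [List.mem_ofFn], ?_⟩
    rw [he]; simp
  have hne : ∀ d ∈ List.ofFn e, d.1 ≠ d.2 := by
    intro d hd h
    rw [List.mem_ofFn] at hd
    obtain ⟨i, rfl⟩ := hd
    have h1 := (σ i).2
    rw [← he i, SimpleGraph.mem_edgeSet] at h1
    exact h1.ne h
  have hN : 2 ≤ N := by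
    have h1 := hG.card_vert_le_card_edgeSet_add_one
    have h2 : Nat.card G.edgeSet = N := by
      rw [← Nat.card_congr σ]; simp
    rw [h2, Nat.card_eq_fintype_card] at h1
    omega
  obtain ⟨M, rfl⟩ : ∃ M, N = M + 2 := ⟨N - 2, by omega⟩
  have ht := C2.touch_all hG hV hl
  have h5 := C2.I5_conn hG hV hl
  have h6 : C2.I6 (fun _ => False) (List.ofFn e) := C2.I6_width (fun k => by
    simp only [he]; exact hσ k)
  have h12 : s((e 0).1, (e 0).2) ≠ s((e 1).1, (e 1).2) := by
    rw [he, he]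
    intro h
    have := σ.injective (Subtype.ext h)
    simp at this
  have hofn : List.ofFn e = e 0 :: e 1 :: List.ofFn (fun i : Fin M => e i.succ.succ) := by
    rw [List.ofFn_succ, List.ofFn_succ]; rfl
  have hst : ∃ c : ℤ, ∀ (K : Type) [Field K] [Fintype K],
      (Fintype.card K : ℤ) ^ 3 ∣ C2.sumL K (List.ofFn e).length
        (fun x => if C2.psi (K := K) Set.univ (List.ofFn e) id x = 0 then 0 else 1)
        - c * (Fintype.card K : ℤ) ^ 2 := by
    rw [hofn] at hne ht h5 h6 ⊢
    exact C2.start hne h12 ht h5 h6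
  obtain ⟨c, hc⟩ := hst
  refine ⟨(if M = 0 then 1 else 0) - c, fun K _ _ => ?_⟩
  have h1 := hc K
  rw [List.length_ofFn, C2.count_eq G σ e he K] at h1
  apply Int.ModEq.symm
  rw [Int.modEq_iff_dvd]
  have h2 : (Fintype.card K : ℤ) ^ 3 ∣ (Fintype.card K : ℤ) ^ (M + 2) -
      (if M = 0 then 1 else 0) * (Fintype.card K : ℤ) ^ 2 := by
    split_ifs with hM
    · subst hM; simp
    · rw [zero_mul, sub_zero]; exact pow_dvd_pow _ (by omega)
  have h3 := dvd_sub h2 h1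
  have h4 : ∀ a x d b u : ℤ, a - b * u - (a - x - d * u) = x - (b - d) * u := by intros; ring
  rwa [h4] at h3
end

section
/- Let G be a connected finite simple graph with at least 3 vertices, every vertex of degree at most 4, and N_G = 2h_G (a log-divergent graph in φ⁴ theory). Suppose G has a non-trivial subdivergence, i.e. a subgraph γ spanned by a proper non-empty subset of the edges with 2h_γ ≥ N_γ. Then [X_G]_q ≡ 0 (mod q³) for every prime power q; that is, c2(G)_q ≡ 0 (mod q). -/
open scoped Classical
open Matrix

/-- The first Betti number of the subgraph spanned by an edge set `S`
(isolated vertices of `fromEdgeSet S` cancel in `|S| - |V| + #components`). -/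
noncomputable def edgeBetti {V : Type*} [Fintype V] (S : Set (Sym2 V)) : ℤ :=
  (Nat.card S : ℤ) - (Fintype.card V : ℤ) +
    (Nat.card (SimpleGraph.fromEdgeSet S).ConnectedComponent : ℤ)

/-- A graph is in φ⁴ theory if every vertex has degree at most 4. -/
def InPhi4 {V : Type*} (G : SimpleGraph V) : Prop :=
  ∀ v : V, Nat.card (G.neighborSet v) ≤ 4


section alg

set_option linter.unusedSectionVars false

lemma free_dvd {Γ X : Type*} [AddGroup Γ] [Fintype Γ] [Fintype X]
    (τ : Γ → X → X) (h0 : ∀ x, τ 0 x = x) (hadd : ∀ g h x, τ (g + h) x = τ g (τ h x))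
    (P : X → Prop) [DecidablePred P] (hP : ∀ g x, P x → P (τ g x))
    (hfree : ∀ x, P x → ∀ g, τ g x = x → g = 0)
    (f : X → ℕ) (hf : ∀ g x, P x → f (τ g x) = f x) (n : ℕ) (hn : ∀ x, P x → n ∣ f x) :
    Fintype.card Γ * n ∣ ∑ x with P x, f x := by
  let S : Setoid X :=
    { r := fun x y => ∃ g, τ g x = y
      iseqv := ⟨fun x => ⟨0, h0 x⟩, by
        rintro x y ⟨g, rfl⟩
        exact ⟨-g, by rw [← hadd]; simp [h0]⟩, by
        rintro x y z ⟨g, rfl⟩ ⟨h, rfl⟩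
        exact ⟨h + g, hadd _ _ _⟩⟩ }
  rw [← Finset.sum_fiberwise (s := Finset.univ.filter P) (g := fun x => (Quotient.mk S x))]
  apply Finset.dvd_sum
  intro ω _
  by_cases hω : ∃ x, P x ∧ Quotient.mk S x = ω
  · obtain ⟨x0, hx0, rfl⟩ := hω
    have : (Finset.univ.filter P).filter (fun x => Quotient.mk S x = Quotient.mk S x0)
        = Finset.univ.image (fun g => τ g x0) := by
      ext y
      simp only [Finset.mem_filter, Finset.mem_univ, true_and, Finset.mem_image]
      constructor
      · rintro ⟨_, h2⟩
        exact S.symm (Quotient.exact h2)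
      · rintro ⟨g, rfl⟩
        exact ⟨hP g _ hx0, Quotient.sound (S.symm ⟨g, rfl⟩)⟩
    rw [this, Finset.sum_image]
    · have h2 : ∀ g ∈ (Finset.univ : Finset Γ), f (τ g x0) = f x0 := fun g _ => hf g x0 hx0
      rw [Finset.sum_congr rfl h2]
      simp only [Finset.sum_const, Finset.card_univ, smul_eq_mul]
      exact Nat.mul_dvd_mul_left _ (hn _ hx0)
    · intro g _ h _ hgh
      have h3 : τ (-g + h) x0 = x0 := by
        rw [hadd]
        simp only at hgh
        rw [← hgh, ← hadd]; simp [h0]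
      have := hfree _ hx0 _ h3
      rw [neg_add_eq_zero] at this
      exact this
  · rw [Finset.sum_eq_zero]
    · simp
    · intro x hx
      simp only [Finset.mem_filter, Finset.mem_univ, true_and] at hx
      exact absurd ⟨x, hx⟩ hω

lemma free_card_dvd {Γ X : Type*} [AddGroup Γ] [Fintype Γ] [Fintype X]
    (τ : Γ → X → X) (h0 : ∀ x, τ 0 x = x) (hadd : ∀ g h x, τ (g + h) x = τ g (τ h x))
    (P : X → Prop) [DecidablePred P] (hP : ∀ g x, P x → P (τ g x))
    (hfree : ∀ x, P x → ∀ g, τ g x = x → g = 0) :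
    Fintype.card Γ ∣ (Finset.univ.filter P).card := by
  have := free_dvd τ h0 hadd P hP hfree (fun _ => 1) (fun _ _ _ => rfl) 1 (fun _ _ => dvd_rfl)
  simpa using this

variable {K : Type*} [Field K] [Fintype K]

/-- number of matrix valued points of a shifted linear space on the product of cones -/
noncomputable def Fcount {ι W : Type*} [AddCommGroup W] [Module K W] [Fintype W]
    (T : W →ₗ[K] (ι → K)) (a b c d : ι → K) : ℕ :=
  (Finset.univ.filter (fun y : W × W × W × W =>
    (a + T y.1) * (d + T y.2.2.2) = (b + T y.2.1) * (c + T y.2.2.1))).card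

variable {ι W : Type*} [AddCommGroup W] [Module K W] [Fintype W] (T : W →ₗ[K] (ι → K))

lemma Fcount_swap (a b c d : ι → K) : Fcount T a b c d = Fcount T a c b d := by
  unfold Fcount
  refine Finset.card_bij' (fun y _ => (y.1, y.2.2.1, y.2.1, y.2.2.2))
    (fun y _ => (y.1, y.2.2.1, y.2.1, y.2.2.2)) ?_ ?_ ?_ ?_
  · intro y hy
    simp only [Finset.mem_filter, Finset.mem_univ, true_and] at hy ⊢
    rw [hy, mul_comm]
  · intro y hy
    simp only [Finset.mem_filter, Finset.mem_univ, true_and] at hy ⊢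
    rw [hy, mul_comm]
  · intros; rfl
  · intros; rfl

lemma Fcount_inv (a b c d : ι → K) (s : K) :
    Fcount T (a + s • c) (b + s • d) c d = Fcount T a b c d := by
  unfold Fcount
  refine Finset.card_bij' (fun y _ => (y.1 - s • y.2.2.1, y.2.1 - s • y.2.2.2, y.2.2.1, y.2.2.2))
    (fun y _ => (y.1 + s • y.2.2.1, y.2.1 + s • y.2.2.2, y.2.2.1, y.2.2.2)) ?_ ?_ ?_ ?_
  · intro y hy
    simp only [Finset.mem_filter, Finset.mem_univ, true_and] at hy ⊢
    funext i
    have := congrFun hy i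
    simp at this ⊢
    linear_combination this
  · intro y hy
    simp only [Finset.mem_filter, Finset.mem_univ, true_and] at hy ⊢
    funext i
    have := congrFun hy i
    simp at this ⊢
    linear_combination this
  · intro y hy; simp
  · intro y hy; simp

lemma Fcount_inv' (a b c d : ι → K) (t : K) :
    Fcount T (a + t • b) b (c + t • d) d = Fcount T a b c d := by
  rw [Fcount_swap, Fcount_inv, Fcount_swap]

lemma Fcount_A (a b : ι → K) (w : W) (hw : w ≠ 0) :
    Fintype.card K ∣ Fcount T a b 0 0 := by
  unfold Fcount
  rw [← Finset.card_filter_add_card_filter_not (fun y : W × W × W × W => y.2.2 = 0)]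
  apply dvd_add
  · rw [Finset.filter_filter]
    apply free_card_dvd (fun (s : K) (y : W × W × W × W) => (y.1 + s • w, y.2))
    · intro x; simp
    · intro g h x; simp [add_smul]; abel
    · rintro g ⟨y1, y2, y3, y4⟩ ⟨h1, h2⟩
      simp only [Prod.mk_eq_zero] at h2
      obtain ⟨rfl, rfl⟩ := h2
      simp
    · intro x hx g hg
      have := congrArg Prod.fst hg
      simpa [hw] using this
  · rw [Finset.filter_filter]
    apply free_card_dvd (fun (s : K) (y : W × W × W × W) =>
      (y.1 + s • y.2.2.1, y.2.1 + s • y.2.2.2, y.2.2))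
    · intro x; simp
    · intro g h x; simp [add_smul]; constructor <;> abel
    · rintro g ⟨y1, y2, y3, y4⟩ ⟨h1, h2⟩
      refine ⟨?_, h2⟩
      funext i
      have := congrFun h1 i
      simp at this ⊢
      linear_combination this
    · rintro ⟨y1, y2, y3, y4⟩ ⟨hx, hy⟩ g hg
      simp at hg hy
      by_contra hne
      rcases hg with ⟨h1, h2⟩
      rcases h1 with h1 | h1
      · exact hne h1
      rcases h2 with h2 | h2
      · exact hne h2
      exact hy h1 h2

lemma Fcount_B (a : ι → K) (w w' : W) (hw : ∀ s t : K, s • w + t • w' = 0 → s = 0 ∧ t = 0) :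
    Fintype.card K ^ 2 ∣ Fcount T a 0 0 0 := by
  have hc : Fintype.card K ^ 2 = Fintype.card (K × K) := by simp [sq]
  rw [hc]
  unfold Fcount
  rw [← Finset.card_filter_add_card_filter_not (fun y : W × W × W × W => y.2.2.2 = 0)]
  apply dvd_add
  · rw [Finset.filter_filter]
    apply free_card_dvd (fun (s : K × K) (y : W × W × W × W) => (y.1 + (s.1 • w + s.2 • w'), y.2))
    · intro x; simp
    · intro g h x; simp [add_smul]; abel
    · rintro g ⟨y1, y2, y3, y4⟩ ⟨h1, h2⟩
      simp only at h2
      subst h2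
      simp at h1 ⊢
      exact h1
    · intro x hx g hg
      have := congrArg Prod.fst hg
      simp only [add_eq_left] at this
      have := hw _ _ this
      exact Prod.ext this.1 this.2
  · rw [Finset.filter_filter]
    apply free_card_dvd (fun (s : K × K) (y : W × W × W × W) =>
      (y.1 + s.1 • y.2.2.1 + s.2 • y.2.1 + (s.1 * s.2) • y.2.2.2, y.2.1 + s.1 • y.2.2.2,
        y.2.2.1 + s.2 • y.2.2.2, y.2.2.2))
    · intro x; simp
    · intro g h x
      ext <;> simp only [Prod.fst_add, Prod.snd_add] <;> module
    · rintro g ⟨y1, y2, y3, y4⟩ ⟨h1, h2⟩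
      refine ⟨?_, h2⟩
      funext i
      have := congrFun h1 i
      simp at this ⊢
      linear_combination this
    · rintro ⟨y1, y2, y3, y4⟩ ⟨hx, hy⟩ g hg
      simp only [Prod.mk.injEq, add_eq_left, smul_eq_zero] at hg hy
      obtain ⟨-, h2, h3, -⟩ := hg
      exact Prod.ext (h2.resolve_right hy) (h3.resolve_right hy)

lemma Fcount_D (a b : ι → K) (κ : K) (hκ : κ ≠ 0) (hb : ∀ y, b + T y ≠ 0) :
    Fintype.card K ∣ Fcount T a b (κ • b) 0 := by
  unfold Fcount
  apply free_card_dvd (fun (s : K) (y : W × W × W × W) =>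
      (y.1 + s • y.2.2.1 - (κ * s) • y.2.1 - (κ * s ^ 2) • y.2.2.2, y.2.1 + s • y.2.2.2,
        y.2.2.1 - (κ * s) • y.2.2.2, y.2.2.2))
  · intro x; simp
  · intro g h x
    ext <;> simp only [] <;> module
  · rintro g ⟨y1, y2, y3, y4⟩ h1
    funext i
    have := congrFun h1 i
    simp at this ⊢
    linear_combination this
  · rintro ⟨y1, y2, y3, y4⟩ hx g hg
    simp only [Prod.mk.injEq] at hg
    obtain ⟨h1, h2, h3, -⟩ := hg
    by_contra hne
    have h4 : y4 = 0 := by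
      simpa [hne] using h2
    subst h4
    have h5 : g • (y3 - κ • y2) = 0 := by
      have h6 : (y1 + g • y3 - (κ * g) • y2 - (κ * g ^ 2) • (0 : W)) - y1 = 0 := by
        rw [h1]; simp
      rw [← h6]; module
    have h7 : y3 = κ • y2 := by
      rw [smul_eq_zero] at h5
      exact sub_eq_zero.mp (h5.resolve_left hne)
    subst h7
    apply hb y2
    funext i
    have := congrFun hx i
    simp at this
    have h8 : κ * (b i + T y2 i) ^ 2 = 0 := by
      rcases this with h | h
      · rw [h]; simp
      · linear_combination (b i + T y2 i) * h
    simpa [hκ] using h8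

lemma fiber_modEq {U Z : Type*} [AddCommGroup U] [Module K U] [Fintype U] [AddCommGroup Z]
    [Module K Z] [FiniteDimensional K Z] (f : U →ₗ[K] Z)
    (hd : Module.finrank K Z ≤ Module.finrank K U) (z : Z) :
    (Finset.univ.filter (fun u => f u = z)).card ≡ (Finset.univ.filter (fun u => f u = 0)).card
      [MOD Fintype.card K] := by
  by_cases hf : Function.Injective f
  · have hs : Function.Surjective f := by
      have := LinearMap.finrank_le_finrank_of_injective hf
      exact (LinearMap.injective_iff_surjective_of_finrank_eq_finrank (le_antisymm this hd)).mp hf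
    have key : ∀ z, (Finset.univ.filter (fun u => f u = z)).card = 1 := by
      intro z
      obtain ⟨u, rfl⟩ := hs z
      rw [Finset.card_eq_one]
      refine ⟨u, ?_⟩
      ext v
      simp [hf.eq_iff]
    rw [key, key]
  · have : ∃ w, f w = 0 ∧ w ≠ 0 := by
      by_contra h
      push Not at h
      exact hf ((injective_iff_map_eq_zero f).mpr h)
    obtain ⟨w, hw, hw0⟩ := this
    have key : ∀ z, Fintype.card K ∣ (Finset.univ.filter (fun u => f u = z)).card := by
      intro z
      apply free_card_dvd (fun (s : K) (u : U) => u + s • w)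
      · intro x; simp
      · intro g h x; module
      · intro g x hx; simp [hw, hx]
      · intro x _ g hg
        simpa [hw0] using hg
    exact ((Nat.modEq_zero_iff_dvd.mpr (key z))).trans (Nat.modEq_zero_iff_dvd.mpr (key 0)).symm

lemma card_filter_prod4 {W : Type*} [Fintype W] (P : W → W → W → W → Prop) :
    (Finset.univ.filter (fun y : W × W × W × W => P y.1 y.2.1 y.2.2.1 y.2.2.2)).card
    = ∑ y1, ∑ y2, (Finset.univ.filter (fun y : W × W => P y1 y2 y.1 y.2)).card := by
  simp only [Finset.card_filter]
  rw [Fintype.sum_prod_type]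
  apply Finset.sum_congr rfl
  intro y1 _
  rw [Fintype.sum_prod_type]

lemma Fcount_C [Fintype ι] (a b c d : ι → K) (w : W) (hw : w ≠ 0)
    (hd : Fintype.card ι ≤ 2 * Module.finrank K W) :
    Fintype.card K ∣ Fcount T a b c d := by
  have key : Fcount T a b c d ≡ Fcount T a b 0 0 [MOD Fintype.card K] := by
    unfold Fcount
    rw [card_filter_prod4 (fun y1 y2 y3 y4 => (a + T y1) * (d + T y4) = (b + T y2) * (c + T y3)),
      card_filter_prod4 (fun y1 y2 y3 y4 => (a + T y1) * (0 + T y4) = (b + T y2) * (0 + T y3))]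
    apply Nat.ModEq.sum
    intro y1 _
    apply Nat.ModEq.sum
    intro y2 _
    let f : (W × W) →ₗ[K] (ι → K) :=
      (LinearMap.mulLeft K (a + T y1)) ∘ₗ T ∘ₗ LinearMap.snd K W W
      - (LinearMap.mulLeft K (b + T y2)) ∘ₗ T ∘ₗ LinearMap.fst K W W
    have hf := fiber_modEq f (by simp; omega) ((b + T y2) * c - (a + T y1) * d)
    convert hf using 3
    · rename_i y
      simp only [f, LinearMap.sub_apply,
        LinearMap.comp_apply, LinearMap.mulLeft_apply, LinearMap.snd_apply, LinearMap.fst_apply]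
      constructor
      · intro h; linear_combination h
      · intro h; linear_combination h
    · rename_i y
      simp only [f, LinearMap.sub_apply,
        LinearMap.comp_apply, LinearMap.mulLeft_apply, LinearMap.snd_apply, LinearMap.fst_apply]
      constructor
      · intro h; linear_combination h
      · intro h; linear_combination h
  exact (Nat.modEq_zero_iff_dvd.mp (key.trans (Nat.modEq_zero_iff_dvd.mpr (Fcount_A T a b w hw))))

end alg


section algB
set_option linter.unusedSimpArgs false
set_option linter.unnecessarySeqFocus false

set_option linter.unusedSectionVars false

variable {K : Type*} [Field K] [Fintype K]
variable {ι₁ ι₂ H : Type*} [AddCommGroup H] [Module K H] [Fintype H]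
  (T₁ : H →ₗ[K] (ι₁ → K)) (T₂ : H →ₗ[K] (ι₂ → K))

noncomputable def Gcount (L Y Z : Submodule K H) (l : L × L × L × L) : ℕ :=
  Fcount (T₁ ∘ₗ Y.subtype) (T₁ l.1) (T₁ l.2.1) (T₁ l.2.2.1) (T₁ l.2.2.2) *
  Fcount (T₂ ∘ₗ Z.subtype) (T₂ l.1) (T₂ l.2.1) (T₂ l.2.2.1) (T₂ l.2.2.2)

lemma split_sum (L Y Z : Submodule K H) (hY : ∀ y ∈ Y, T₂ y = 0) (hZ : ∀ z ∈ Z, T₁ z = 0)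
    (hb : Function.Bijective (fun t : L × Y × Z => (t.1 : H) + t.2.1 + t.2.2)) :
    (Finset.univ.filter (fun y : H × H × H × H =>
      T₁ y.1 * T₁ y.2.2.2 = T₁ y.2.1 * T₁ y.2.2.1 ∧
      T₂ y.1 * T₂ y.2.2.2 = T₂ y.2.1 * T₂ y.2.2.1)).card
    = ∑ l : L × L × L × L, Gcount T₁ T₂ L Y Z l := by
  let e := Equiv.ofBijective _ hb
  have he : ∀ l y z, e (l, y, z) = (l : H) + y + z := fun _ _ _ => rfl
  let E : (L × L × L × L) × (Y × Y × Y × Y) × (Z × Z × Z × Z) ≃ H × H × H × H :=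
    { toFun := fun t => (e (t.1.1, t.2.1.1, t.2.2.1), e (t.1.2.1, t.2.1.2.1, t.2.2.2.1),
        e (t.1.2.2.1, t.2.1.2.2.1, t.2.2.2.2.1), e (t.1.2.2.2, t.2.1.2.2.2, t.2.2.2.2.2))
      invFun := fun m => (((e.symm m.1).1, (e.symm m.2.1).1, (e.symm m.2.2.1).1, (e.symm m.2.2.2).1),
        ((e.symm m.1).2.1, (e.symm m.2.1).2.1, (e.symm m.2.2.1).2.1, (e.symm m.2.2.2).2.1),
        ((e.symm m.1).2.2, (e.symm m.2.1).2.2, (e.symm m.2.2.1).2.2, (e.symm m.2.2.2).2.2))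
      left_inv := by
        rintro ⟨⟨a1, a2, a3, a4⟩, ⟨b1, b2, b3, b4⟩, ⟨c1, c2, c3, c4⟩⟩
        simp
      right_inv := by
        rintro ⟨a1, a2, a3, a4⟩
        simp }
  have h1 : ∀ l y z, T₁ (e (l, y, z)) = T₁ l + T₁ y := by
    intro l y z
    rw [he, map_add, map_add, hZ _ z.2, add_zero]
  have h2 : ∀ l y z, T₂ (e (l, y, z)) = T₂ l + T₂ z := by
    intro l y z
    rw [he, map_add, map_add, hY _ y.2, add_zero]
  rw [Finset.card_filter, ← E.sum_comp, Fintype.sum_prod_type]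
  apply Finset.sum_congr rfl
  intro l _
  rw [Fintype.sum_prod_type]
  unfold Gcount Fcount
  rw [Finset.card_filter, Finset.card_filter, Finset.sum_mul_sum]
  apply Finset.sum_congr rfl
  intro y _
  apply Finset.sum_congr rfl
  intro z _
  simp only [E, Equiv.coe_fn_mk, h1, h2, LinearMap.comp_apply, Submodule.subtype_apply]
  by_cases c1 : (T₁ l.1 + T₁ y.1) * (T₁ l.2.2.2 + T₁ y.2.2.2) = (T₁ l.2.1 + T₁ y.2.1) * (T₁ l.2.2.1 + T₁ y.2.2.1) <;>
  by_cases c2 : (T₂ l.1 + T₂ z.1) * (T₂ l.2.2.2 + T₂ z.2.2.2) = (T₂ l.2.1 + T₂ z.2.1) * (T₂ l.2.2.1 + T₂ z.2.2.1) <;>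
  simp [c1, c2]

lemma Gcount_inv (L Y Z : Submodule K H) (l : L × L × L × L) (s : K) :
    Gcount T₁ T₂ L Y Z (l.1 + s • l.2.2.1, l.2.1 + s • l.2.2.2, l.2.2.1, l.2.2.2)
    = Gcount T₁ T₂ L Y Z l := by
  unfold Gcount
  simp only [Submodule.coe_add, Submodule.coe_smul, map_add, map_smul, Fcount_inv]

lemma Gcount_inv' (L Y Z : Submodule K H) (l : L × L × L × L) (s : K) :
    Gcount T₁ T₂ L Y Z (l.1 + s • l.2.1, l.2.1, l.2.2.1 + s • l.2.2.2, l.2.2.2)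
    = Gcount T₁ T₂ L Y Z l := by
  unfold Gcount
  simp only [Submodule.coe_add, Submodule.coe_smul, map_add, map_smul, Fcount_inv']

lemma sum_dvd [Fintype ι₁] (L Y Z : Submodule K H)
    (hLb : ∀ b ∈ L, ∀ z ∈ Z, T₂ b + T₂ z = 0 → b = 0)
    (w w' : Y) (hw : ∀ s t : K, s • w + t • w' = 0 → s = 0 ∧ t = 0)
    (z : Z) (hz : z ≠ 0)
    (hd : Fintype.card ι₁ ≤ 2 * Module.finrank K Y) :
    Fintype.card K ^ 3 ∣ ∑ l : L × L × L × L, Gcount T₁ T₂ L Y Z l := by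
  have hw0 : w ≠ 0 := by
    rintro rfl
    have := (hw 1 0 (by simp)).1
    exact one_ne_zero this
  have hq1 : ∀ l, Fintype.card K ∣ Gcount T₁ T₂ L Y Z l := by
    intro l
    exact Dvd.dvd.mul_right (Fcount_C _ _ _ _ _ w hw0 hd) _
  have hcard : Fintype.card (K × K) * Fintype.card K = Fintype.card K ^ 3 := by
    rw [Fintype.card_prod]; ring
  rw [← Finset.sum_filter_add_sum_filter_not Finset.univ
    (fun l : L × L × L × L => l.2.2.2 ≠ 0)]
  apply dvd_add
  · rw [← hcard]
    refine free_dvd (fun (s : K × K) (y : L × L × L × L) =>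
      (y.1 + s.1 • y.2.2.1 + s.2 • y.2.1 + (s.1 * s.2) • y.2.2.2, y.2.1 + s.1 • y.2.2.2,
        y.2.2.1 + s.2 • y.2.2.2, y.2.2.2)) ?_ ?_ _ ?_ ?_ _ ?_ _ ?_
    · intro x; simp
    · intro g h x
      refine Prod.ext ?_ (Prod.ext ?_ (Prod.ext ?_ ?_)) <;> simp only [Prod.fst_add, Prod.snd_add] <;> module
    · intro g x hx
      exact hx
    · rintro ⟨y1, y2, y3, y4⟩ hy g hg
      simp only [Prod.mk.injEq, add_eq_left, smul_eq_zero] at hg hy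
      obtain ⟨-, h2, h3, -⟩ := hg
      exact Prod.ext (h2.resolve_right hy) (h3.resolve_right hy)
    · intro g x _
      refine Eq.trans ?_ ((Gcount_inv' T₁ T₂ L Y Z _ g.2).trans (Gcount_inv T₁ T₂ L Y Z x g.1))
      congr 1
      refine Prod.ext ?_ (Prod.ext ?_ (Prod.ext ?_ ?_)) <;> simp only [Prod.fst_add, Prod.snd_add] <;> module
    · intro x _; exact hq1 x
  rw [← Finset.sum_filter_add_sum_filter_not _
    (fun l : L × L × L × L => ∀ s t : K, s • l.2.1 + t • l.2.2.1 = 0 → s = 0 ∧ t = 0)]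
  rw [Finset.filter_filter, Finset.filter_filter]
  apply dvd_add
  · rw [← hcard]
    refine free_dvd (fun (s : K × K) (y : L × L × L × L) =>
      (y.1 + (s.1 • y.2.1 + s.2 • y.2.2.1), y.2)) ?_ ?_ _ ?_ ?_ _ ?_ _ ?_
    · intro x; simp
    · intro g h x
      refine Prod.ext ?_ (Prod.ext ?_ (Prod.ext ?_ ?_)) <;> simp only [Prod.fst_add, Prod.snd_add] <;> module
    · intro g x hx
      exact hx
    · rintro ⟨y1, y2, y3, y4⟩ hy g hg
      simp only [Prod.mk.injEq, add_eq_left] at hg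
      have := hy.2 _ _ hg.1
      exact Prod.ext this.1 this.2
    · rintro g ⟨y1, y2, y3, y4⟩ hx
      simp only [ne_eq, not_not] at hx
      obtain ⟨rfl, -⟩ := hx
      refine Eq.trans ?_ ((Gcount_inv' T₁ T₂ L Y Z _ g.1).trans (Gcount_inv T₁ T₂ L Y Z (y1, y2, y3, 0) g.2))
      congr 1
      refine Prod.ext ?_ (Prod.ext ?_ (Prod.ext ?_ ?_)) <;> simp only [Prod.fst_add, Prod.snd_add] <;> module
    · intro x _; exact hq1 x
  -- dependent case
  have hdep : ∀ (b c : L), ¬ (∀ s t : K, s • b + t • c = 0 → s = 0 ∧ t = 0) →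
      b = 0 ∨ ∃ κ : K, c = κ • b := by
    intro b c h
    push Not at h
    obtain ⟨s, t, h1, h2⟩ := h
    by_cases ht : t = 0
    · left
      subst ht
      have hs : s ≠ 0 := fun h => h2 h rfl
      simpa [hs] using h1
    · right
      refine ⟨-(t⁻¹ * s), ?_⟩
      have : t⁻¹ • (s • b + t • c) = 0 := by rw [h1]; simp
      rw [smul_add, smul_smul, smul_smul, inv_mul_cancel₀ ht, one_smul] at this
      rw [neg_smul]
      exact eq_neg_of_add_eq_zero_right this
  rw [← Finset.sum_filter_add_sum_filter_not _
    (fun l : L × L × L × L => l.2.1 = 0 ∧ l.2.2.1 = 0)]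
  rw [Finset.filter_filter, Finset.filter_filter]
  apply dvd_add
  · apply Finset.dvd_sum
    rintro ⟨y1, y2, y3, y4⟩ hl
    simp only [Finset.mem_filter, ne_eq, not_not, Finset.mem_univ, true_and] at hl
    obtain ⟨⟨rfl, -⟩, rfl, rfl⟩ := hl
    unfold Gcount
    rw [pow_succ]
    simp only [Submodule.coe_zero, map_zero]
    exact mul_dvd_mul (Fcount_B _ _ w w' hw) (Fcount_A _ _ _ z hz)
  · have hcard2 : Fintype.card K * (Fintype.card K * Fintype.card K) = Fintype.card K ^ 3 := by
      ring
    rw [← hcard2]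
    refine free_dvd (fun (s : K) (y : L × L × L × L) =>
      (y.1 + s • (if y.2.1 = 0 then y.2.2.1 else y.2.1), y.2)) ?_ ?_ _ ?_ ?_ _ ?_ _ ?_
    · intro x; simp
    · intro g h x
      refine Prod.ext ?_ (Prod.ext ?_ (Prod.ext ?_ ?_)) <;> simp only [Prod.fst_add, Prod.snd_add] <;> module
    · intro g x hx
      exact hx
    · rintro ⟨y1, y2, y3, y4⟩ hy g hg
      simp only [Prod.mk.injEq, add_eq_left, smul_eq_zero] at hg hy
      rcases hg.1 with h | h
      · exact h
      · exfalso
        apply hy.2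
        split_ifs at h with h3
        · exact ⟨h3, h⟩
        · exact absurd h h3
    · rintro g ⟨y1, y2, y3, y4⟩ hx
      simp only [ne_eq, not_not] at hx
      obtain ⟨⟨rfl, -⟩, -⟩ := hx
      simp only []
      split_ifs with h3
      · rw [← Gcount_inv T₁ T₂ L Y Z (y1, y2, y3, 0) g]
        simp
      · rw [← Gcount_inv' T₁ T₂ L Y Z (y1, y2, y3, 0) g]
        simp
    · rintro ⟨y1, y2, y3, y4⟩ hx
      simp only [ne_eq, not_not] at hx
      obtain ⟨⟨rfl, hnd⟩, hne⟩ := hx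
      unfold Gcount
      refine mul_dvd_mul (Fcount_C _ _ _ _ _ w hw0 hd) ?_
      simp only [Submodule.coe_zero, map_zero]
      rcases hdep y2 y3 hnd with rfl | ⟨κ, rfl⟩
      · simp only [Submodule.coe_zero, map_zero]
        rw [Fcount_swap]
        exact Fcount_A _ _ _ z hz
      · by_cases hκ : κ = 0
        · subst hκ
          simp only [zero_smul, Submodule.coe_zero, map_zero]
          exact Fcount_A _ _ _ z hz
        · simp only [Submodule.coe_smul, map_smul]
          apply Fcount_D _ _ _ _ hκ
          intro y h0
          have := hLb y2 y2.2 y y.2 h0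
          have h4 : y2 = 0 := by exact_mod_cast this
          subst h4
          apply hne
          simp

variable {ι : Type*} [Fintype ι]

theorem M_dvd (ℓ : H →ₗ[K] (ι → K)) (hinj : Function.Injective ℓ) (p : ι → Prop)
    (Y : Submodule K H) (hY : ∀ a, a ∈ Y ↔ ∀ i, ¬ p i → ℓ a i = 0)
    (hd : Fintype.card {i // p i} ≤ 2 * Module.finrank K Y) (h2 : 2 ≤ Module.finrank K Y)
    (z : H) (hz : z ≠ 0) (hzp : ∀ i, p i → ℓ z i = 0) :
    Fintype.card K ^ 3 ∣ Fcount ℓ 0 0 0 0 := by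
  let T₁ : H →ₗ[K] ({i // p i} → K) := LinearMap.funLeft K K Subtype.val ∘ₗ ℓ
  let T₂ : H →ₗ[K] ({i // ¬ p i} → K) := LinearMap.funLeft K K Subtype.val ∘ₗ ℓ
  have hT1 : ∀ a i, T₁ a i = ℓ a i := fun _ _ => rfl
  have hT2 : ∀ a i, T₂ a i = ℓ a i := fun _ _ => rfl
  let Z : Submodule K H := LinearMap.ker T₁
  have hYk : Y = LinearMap.ker T₂ := by
    ext a
    rw [hY, LinearMap.mem_ker, funext_iff]
    simp [hT2]
  have hZ : ∀ a, a ∈ Z ↔ ∀ i, p i → ℓ a i = 0 := by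
    intro a
    rw [LinearMap.mem_ker, funext_iff]
    simp [hT1]
  obtain ⟨L, hL⟩ := Submodule.exists_isCompl (Y ⊔ Z)
  have hYZ : ∀ a, a ∈ Y → a ∈ Z → a = 0 := by
    intro a h1 h2
    apply hinj
    funext i
    rw [map_zero]
    by_cases h : p i
    · exact (hZ a).1 h2 i h
    · exact (hY a).1 h1 i h
  have hLYZ : ∀ l ∈ L, ∀ y ∈ Y, ∀ z ∈ Z, l + y + z = 0 → l = 0 ∧ y = 0 ∧ z = 0 := by
    intro l hl y hy z hz h
    have hl0 : l = 0 := by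
      have : l ∈ (Y ⊔ Z) := by
        have h3 : l = (-y) + (-z) := by
          rw [add_assoc] at h
          rw [eq_neg_of_add_eq_zero_left h]; abel
        rw [h3]
        exact Submodule.add_mem_sup (neg_mem hy) (neg_mem hz)
      exact Submodule.disjoint_def.mp hL.disjoint l this hl
    subst hl0
    rw [zero_add] at h
    have hy0 : y = 0 := by
      apply hYZ y hy
      rw [eq_neg_of_add_eq_zero_left h]
      exact neg_mem hz
    subst hy0
    simpa using h
  have hb : Function.Bijective (fun t : L × Y × Z => (t.1 : H) + t.2.1 + t.2.2) := by
    constructor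
    · rintro ⟨l, y, z⟩ ⟨l', y', z'⟩ h
      simp only at h
      have := hLYZ (l - l') (sub_mem l.2 l'.2) (y - y') (sub_mem y.2 y'.2) (z - z')
        (sub_mem z.2 z'.2) (by
          have : (l : H) + y + z - (l' + y' + z') = 0 := by rw [h]; simp
          rw [← this]; abel)
      simp only [sub_eq_zero, SetLike.coe_eq_coe] at this
      obtain ⟨rfl, rfl, rfl⟩ := this
      rfl
    · intro a
      have : a ∈ (Y ⊔ Z) ⊔ L := by rw [hL.sup_eq_top]; trivial
      obtain ⟨u, hu, l, hl, rfl⟩ := Submodule.mem_sup.mp this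
      obtain ⟨y, hy, z, hz, rfl⟩ := Submodule.mem_sup.mp hu
      refine ⟨⟨⟨l, hl⟩, ⟨y, hy⟩, ⟨z, hz⟩⟩, ?_⟩
      simp only
      abel
  have key := split_sum T₁ T₂ L Y Z (fun y hy => by rw [hYk] at hy; exact hy)
    (fun z hz => hz) hb
  have h3 : Fcount ℓ 0 0 0 0 = ∑ l : L × L × L × L, Gcount T₁ T₂ L Y Z l := by
    rw [← key]
    unfold Fcount
    congr 1
    ext y
    simp only [zero_add, Finset.mem_filter, Finset.mem_univ, true_and]
    constructor
    · intro h
      constructor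
      · funext i
        exact congrFun h i
      · funext i
        exact congrFun h i
    · rintro ⟨ha, hb⟩
      funext i
      by_cases hi : p i
      · exact congrFun ha ⟨i, hi⟩
      · exact congrFun hb ⟨i, hi⟩
  rw [h3]
  obtain ⟨f, hf⟩ := exists_linearIndependent_of_le_finrank h2
  refine sum_dvd T₁ T₂ L Y Z ?_ (f 0) (f 1) ?_ ⟨z, (hZ z).2 hzp⟩ ?_ hd
  · intro b hbL z hz h
    have h5 : b + z ∈ Y := by
      rw [hYk, LinearMap.mem_ker, map_add, h]
    exact (hLYZ b hbL (-(b + z)) (neg_mem h5) z hz (by abel)).1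
  · intro s t h
    have := Fintype.linearIndependent_iff.mp hf ![s, t] (by simpa [Fin.sum_univ_two] using h)
    exact ⟨this 0, this 1⟩
  · intro h
    apply hz
    exact congrArg Subtype.val h

end algB

section algC
set_option linter.unusedSectionVars false
variable {K : Type*} [Field K] [Fintype K]

lemma card_ker_filter {U Z : Type*} [AddCommGroup U] [Module K U] [Fintype U]
    [AddCommGroup Z] [Module K Z] (f : U →ₗ[K] Z) (P : U → Prop) [DecidablePred P] (hP : ∀ u, P u ↔ f u = 0) :
    (Finset.univ.filter P).card = Fintype.card K ^ Module.finrank K (LinearMap.ker f) := by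
  rw [← Module.card_eq_pow_finrank, Fintype.card_subtype]
  congr 1
  ext u
  simp [hP]

lemma lemO {ι U : Type*} [Fintype ι] [AddCommGroup U] [Module K U] [Fintype U]
    (f : U →ₗ[K] (ι → K)) :
    (Finset.univ.filter (fun x : ι → K => ∀ u, ∑ i, x i * f u i = 0)).card *
      Fintype.card K ^ Module.finrank K U
    = Fintype.card K ^ Fintype.card ι * (Finset.univ.filter (fun u => f u = 0)).card := by
  let g : (ι → K) →ₗ[K] Module.Dual K U :=
    f.dualMap ∘ₗ (dotProductEquiv K ι).toLinearMap
  have hg : ∀ x u, g x u = ∑ i, x i * f u i := by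
    intro x u
    simp [g, dotProductEquiv, dotProduct]
  rw [card_ker_filter g _ (fun x => by
    rw [LinearMap.ext_iff]; simp [hg]), card_ker_filter f _ (fun u => Iff.rfl), ← pow_add, ← pow_add]
  congr 1
  have h1 := LinearMap.finrank_range_add_finrank_ker g
  have h2 := LinearMap.finrank_range_add_finrank_ker f
  have h3 : Module.finrank K (LinearMap.range g) = Module.finrank K (LinearMap.range f) := by
    rw [← LinearMap.finrank_range_dualMap_eq_finrank_range f]
    simp only [g]
    rw [LinearMap.range_comp_of_range_eq_top]
    exact LinearEquiv.range _
  rw [Module.finrank_fintype_fun_eq_card] at h1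
  omega

variable {ι H : Type*} [Fintype ι] [AddCommGroup H] [Module K H] [Fintype H]

/-- the radical of the quadratic form attached to `x` -/
def kerX (ℓ : H →ₗ[K] (ι → K)) (x : ι → K) : Submodule K H where
  carrier := {a | ∀ c, ∑ i, x i * (ℓ a i * ℓ c i) = 0}
  add_mem' := by
    intro a b ha hb c
    have : ∑ i, x i * (ℓ (a + b) i * ℓ c i) = ∑ i, x i * (ℓ a i * ℓ c i) +
      ∑ i, x i * (ℓ b i * ℓ c i) := by
      rw [← Finset.sum_add_distrib]
      apply Finset.sum_congr rfl
      intro i _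
      rw [map_add, Pi.add_apply]; ring
    rw [this, ha c, hb c, add_zero]
  zero_mem' := by intro c; simp
  smul_mem' := by
    intro s a ha c
    have : ∑ i, x i * (ℓ (s • a) i * ℓ c i) = s * ∑ i, x i * (ℓ a i * ℓ c i) := by
      rw [Finset.mul_sum]
      apply Finset.sum_congr rfl
      intro i _
      rw [map_smul, Pi.smul_apply, smul_eq_mul]; ring
    rw [this, ha c, mul_zero]

lemma mem_kerX (ℓ : H →ₗ[K] (ι → K)) (x : ι → K) (a : H) :
    a ∈ kerX ℓ x ↔ ∀ c, ∑ i, x i * (ℓ a i * ℓ c i) = 0 := Iff.rfl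

/-- number of `x` with degenerate form -/
noncomputable def Xdeg (ℓ : H →ₗ[K] (ι → K)) : ℕ :=
  (Finset.univ.filter (fun x : ι → K =>
    ∃ a : H, a ≠ 0 ∧ ∀ c, ∑ i, x i * (ℓ a i * ℓ c i) = 0)).card

lemma deg_iff (ℓ : H →ₗ[K] (ι → K)) (x : ι → K) :
    (∃ a : H, a ≠ 0 ∧ ∀ c, ∑ i, x i * (ℓ a i * ℓ c i) = 0) ↔ kerX ℓ x ≠ ⊥ := by
  rw [Submodule.ne_bot_iff]
  constructor
  · rintro ⟨a, h, h'⟩; exact ⟨a, h', h⟩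
  · rintro ⟨a, h, h'⟩; exact ⟨a, h', h⟩

lemma S1_eq (ℓ : H →ₗ[K] (ι → K)) (P : H → Prop) :
    ∑ x : ι → K, (Finset.univ.filter (fun a => a ∈ kerX ℓ x ∧ P a)).card
    = ∑ a ∈ Finset.univ.filter P, (Finset.univ.filter (fun x : ι → K => ∀ c, ∑ i, x i * (ℓ a i * ℓ c i) = 0)).card := by
  simp only [Finset.card_filter]
  rw [Finset.sum_comm, Finset.sum_filter]
  apply Finset.sum_congr rfl
  intro a _
  by_cases h : P a <;> simp [h, mem_kerX]

lemma S1_term (ℓ : H →ₗ[K] (ι → K)) (a : H) (j : ℕ)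
    (hj : j + Module.finrank K H ≤ Fintype.card ι) :
    Fintype.card K ^ j ∣ (Finset.univ.filter (fun x : ι → K => ∀ c, ∑ i, x i * (ℓ a i * ℓ c i) = 0)).card := by
  let f : H →ₗ[K] (ι → K) := LinearMap.mulLeft K (ℓ a) ∘ₗ ℓ
  have h := lemO f
  have hf : ∀ c i, f c i = ℓ a i * ℓ c i := fun _ _ => rfl
  simp only [hf] at h
  have hq : 0 < Fintype.card K ^ Module.finrank K H := pow_pos Fintype.card_pos _
  apply Nat.dvd_of_mul_dvd_mul_right hq
  rw [h, ← pow_add]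
  exact Dvd.dvd.mul_right (pow_dvd_pow _ hj) _

lemma S2_eq (ℓ : H →ₗ[K] (ι → K)) (hN : Fintype.card ι = 2 * Module.finrank K H) :
    ∑ x : ι → K, (Fintype.card (kerX ℓ x))^2 = Fcount ℓ 0 0 0 0 := by
  have h1 : ∀ x, (Fintype.card (kerX ℓ x))^2
      = ∑ a : H, ∑ b : H, if (a ∈ kerX ℓ x ∧ b ∈ kerX ℓ x) then 1 else 0 := by
    intro x
    rw [Fintype.card_subtype, Finset.card_filter, sq, Finset.sum_mul_sum]
    apply Finset.sum_congr rfl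
    intro a _
    apply Finset.sum_congr rfl
    intro b _
    by_cases h : a ∈ kerX ℓ x <;> by_cases h' : b ∈ kerX ℓ x <;> simp [h, h']
  simp only [h1]
  unfold Fcount
  rw [card_filter_prod4 (fun a b c d => (0 + ℓ a) * (0 + ℓ d) = (0 + ℓ b) * (0 + ℓ c))]
  rw [Finset.sum_comm]
  apply Finset.sum_congr rfl
  intro a _
  rw [Finset.sum_comm]
  apply Finset.sum_congr rfl
  intro b _
  let f : H × H →ₗ[K] (ι → K) := (LinearMap.mulLeft K (ℓ a) ∘ₗ ℓ) ∘ₗ LinearMap.snd K H H -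
    (LinearMap.mulLeft K (ℓ b) ∘ₗ ℓ) ∘ₗ LinearMap.fst K H H
  have hf : ∀ u i, f u i = ℓ a i * ℓ u.2 i - ℓ b i * ℓ u.1 i := fun _ _ => rfl
  have h := lemO f
  rw [Module.finrank_prod, ← two_mul, ← hN, mul_comm] at h
  have hq : 0 < Fintype.card K ^ Fintype.card ι := pow_pos Fintype.card_pos _
  have h2 := Nat.eq_of_mul_eq_mul_left hq h
  rw [← Finset.card_filter]
  convert h2 using 2
  · ext x
    simp only [Finset.mem_filter, Finset.mem_univ, true_and, hf, mul_sub, Finset.sum_sub_distrib]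
    constructor
    · rintro ⟨ha, hb⟩ u
      rw [ha u.2, hb u.1, sub_zero]
    · intro h
      refine ⟨fun c => ?_, fun c => ?_⟩
      · simpa using h (0, c)
      · simpa using h (c, 0)
  · ext u
    simp only [Finset.mem_filter, Finset.mem_univ, true_and, zero_add]
    constructor
    · intro h
      funext i
      rw [hf, ← Pi.mul_apply, h]; simp
    · intro h
      funext i
      have := congrFun h i
      rw [hf, Pi.zero_apply, sub_eq_zero] at this
      simpa using this

lemma XM (ℓ : H →ₗ[K] (ι → K)) (hN : Fintype.card ι = 2 * Module.finrank K H)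
    (h2 : 2 ≤ Module.finrank K H) (j : ℕ) (hj : j ≤ 3)
    (hM : Fintype.card K ^ j ∣ Fcount ℓ 0 0 0 0) : Fintype.card K ^ j ∣ Xdeg ℓ := by
  have hS2 := S2_eq ℓ hN
  have hS1 : Fintype.card K ^ 2 ∣ ∑ x : ι → K, Fintype.card (kerX ℓ x) := by
    have := S1_eq ℓ (fun _ => True)
    simp only [and_true, ← Fintype.card_subtype] at this
    have e : ∑ x : ι → K, Fintype.card (kerX ℓ x) = ∑ x : ι → K, Fintype.card {a // a ∈ kerX ℓ x} := rfl
    rw [e, this]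
    apply Finset.dvd_sum
    intro a _
    rw [Fintype.card_subtype]
    apply S1_term
    omega
  set q := Fintype.card K with hq
  have hq1 : 1 < q := Fintype.one_lt_card
  have hid : ∀ x, ((q : ℤ)^3) ∣ ((q:ℤ) - 1) * (q^2 - 1) * (if kerX ℓ x ≠ ⊥ then 0 else 1)
      - ((Fintype.card (kerX ℓ x) : ℤ)^2 - (q^2 + q) * (Fintype.card (kerX ℓ x) : ℤ)) := by
    intro x
    have hc := Module.card_eq_pow_finrank (K := K) (V := kerX ℓ x)
    rw [← hq] at hc
    rw [hc]
    have hb : kerX ℓ x = ⊥ ↔ Module.finrank K (kerX ℓ x) = 0 := Submodule.finrank_eq_zero.symm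
    have hb' : (if kerX ℓ x ≠ ⊥ then 0 else 1 : ℤ) = if Module.finrank K (kerX ℓ x) = 0 then 1 else 0 := by
      by_cases h : kerX ℓ x = ⊥
      · rw [if_neg (not_not.mpr h), if_pos (hb.1 h)]
      · rw [if_pos h, if_neg (fun h' => h (hb.2 h'))]
    rw [hb']
    generalize Module.finrank K (kerX ℓ x) = d
    match d with
    | 0 => exact ⟨1, by simp; ring⟩
    | 1 => exact ⟨1, by simp; ring⟩
    | 2 => exact ⟨1, by simp; ring⟩
    | d+3 => exact ⟨-((q:ℤ)^(2*d+3) - (q^2+q)*q^d), by simp; ring⟩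
  have hsum := Finset.dvd_sum (s := (Finset.univ : Finset (ι → K))) (fun x _ => hid x)
  rw [Finset.sum_sub_distrib, Finset.sum_sub_distrib, ← Finset.mul_sum, ← Finset.mul_sum] at hsum
  have hX : (∑ x : ι → K, (if kerX ℓ x ≠ ⊥ then 0 else 1 : ℤ)) = (q:ℤ)^(Fintype.card ι) - Xdeg ℓ := by
    have hh : (∑ x : ι → K, (if kerX ℓ x ≠ ⊥ then 0 else 1 : ℤ)) + (Xdeg ℓ : ℤ) = (q:ℤ)^(Fintype.card ι) := by
      unfold Xdeg
      rw [Finset.card_filter]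
      push_cast
      rw [← Finset.sum_add_distrib]
      simp only [deg_iff]
      have : ∀ x : ι → K, ((if kerX ℓ x ≠ ⊥ then 0 else 1 : ℤ) + (if kerX ℓ x ≠ ⊥ then 1 else 0 : ℤ)) = 1 := by
        intro x; split_ifs <;> simp
      simp only [this]
      simp [hq]
    linarith
  rw [hX] at hsum
  have hS2' : (∑ x : ι → K, (Fintype.card (kerX ℓ x) : ℤ)^2) = (Fcount ℓ 0 0 0 0 : ℤ) := by
    rw [← hS2]; push_cast; rfl
  rw [hS2'] at hsum
  have hS1' : (q:ℤ)^2 ∣ ∑ x : ι → K, (Fintype.card (kerX ℓ x) : ℤ) := by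
    exact_mod_cast hS1
  have hM' : (q:ℤ)^j ∣ (Fcount ℓ 0 0 0 0 : ℤ) := by exact_mod_cast hM
  have hjs : (q:ℤ)^j ∣ (q:ℤ)^3 := pow_dvd_pow _ hj
  have hN4 : (q:ℤ)^3 ∣ (q:ℤ)^(Fintype.card ι) := pow_dvd_pow _ (by omega)
  have h5 : (q:ℤ)^3 ∣ ((q:ℤ)^2+q) * ∑ x : ι → K, (Fintype.card (kerX ℓ x) : ℤ) := by
    obtain ⟨r, hr⟩ := hS1'
    rw [hr]; exact ⟨(q+1)*r, by ring⟩
  have h6 : (q:ℤ)^j ∣ ((q:ℤ) - 1) * (q^2 - 1) * Xdeg ℓ := by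
    have e1 := hjs.trans hsum
    have e2 := (hjs.trans hN4).mul_left (((q:ℤ) - 1) * (q^2 - 1))
    have e3 := hjs.trans h5
    have := dvd_add (dvd_sub (dvd_sub e2 e1) hM') e3
    refine ((this.trans (dvd_of_eq ?_)))
    ring
  have hcop : IsCoprime ((q:ℤ)^j) (((q:ℤ) - 1) * (q^2 - 1)) := by
    apply IsCoprime.pow_left
    apply IsCoprime.mul_right
    · exact ⟨1, -1, by ring⟩
    · exact ⟨q, -1, by ring⟩
  have := hcop.dvd_of_dvd_mul_left h6
  exact_mod_cast this

end algC

section algP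
set_option linter.unusedSectionVars false
variable {K : Type*} [Field K] [Fintype K]
variable {H : Type*} [AddCommGroup H] [Module K H] [Fintype H]

lemma fiber_count (β : H →ₗ[K] H →ₗ[K] K) (hs : ∀ a c, β a c = β c a) (μ : H →ₗ[K] K)
    (hμ : μ ≠ 0) :
    (Finset.univ.filter (fun y : K => ∃ a, a ≠ 0 ∧ ∀ c, β a c + y * (μ a * μ c) = 0)).card
    = (if ∃ a, a ≠ 0 ∧ μ a = 0 ∧ ∀ c, β a c = 0 then Fintype.card K else 0) +
      (if ∃ w, w ≠ 0 ∧ μ w = 0 ∧ ∀ c, μ c = 0 → β w c = 0 then 0 else 1) := by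
  obtain ⟨v, hv⟩ : ∃ v, μ v = 1 := by
    have : ∃ u, μ u ≠ 0 := by
      by_contra h
      push Not at h
      exact hμ (LinearMap.ext h)
    obtain ⟨u, hu⟩ := this
    exact ⟨(μ u)⁻¹ • u, by simp [hu]⟩
  by_cases hC : ∃ a, a ≠ 0 ∧ μ a = 0 ∧ ∀ c, β a c = 0
  · obtain ⟨a, ha, h1, h2⟩ := hC
    rw [if_pos ⟨a, ha, h1, h2⟩, if_pos ⟨a, ha, h1, fun c _ => h2 c⟩, add_zero,
      Finset.filter_true_of_mem, Finset.card_univ]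
    intro y _
    exact ⟨a, ha, fun c => by rw [h2, h1]; ring⟩
  rw [if_neg hC, zero_add]
  by_cases hW : ∃ w, w ≠ 0 ∧ μ w = 0 ∧ ∀ c, μ c = 0 → β w c = 0
  · rw [if_pos hW, Finset.card_eq_zero, Finset.filter_eq_empty_iff]
    rintro y _ ⟨a, ha, h⟩
    obtain ⟨w, hw, h1, h2⟩ := hW
    have hwc : ∀ c, β w c = μ c * β w v := by
      intro c
      have := h2 (c - μ c • v) (by simp [hv])
      rw [map_sub, map_smul, smul_eq_mul, sub_eq_zero] at this
      exact this
    have hwv : β w v ≠ 0 := by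
      intro h0
      exact hC ⟨w, hw, h1, fun c => by rw [hwc, h0, mul_zero]⟩
    have := h w
    rw [h1, hs, hwc] at this
    simp only [mul_zero, add_zero, mul_eq_zero, hwv, or_false] at this
    refine hC ⟨a, ha, this, fun c => ?_⟩
    simpa [this] using h c
  rw [if_neg hW]
  -- nondegenerate on the kernel
  let W := LinearMap.ker μ
  let g : W →ₗ[K] Module.Dual K W := (β.domRestrict₁₂ W W)
  have hg : ∀ w c : W, g w c = β w c := fun _ _ => rfl
  have hinj : Function.Injective g := by
    rw [← LinearMap.ker_eq_bot, LinearMap.ker_eq_bot']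
    intro w hw
    by_contra hne
    apply hW
    refine ⟨w, by simpa using hne, w.2, fun c hc => ?_⟩
    rw [← hg w ⟨c, hc⟩, hw]; rfl
  have hsurj : Function.Surjective g :=
    (LinearMap.injective_iff_surjective_of_finrank_eq_finrank
      (Subspace.dual_finrank_eq).symm).1 hinj
  obtain ⟨w0, hw0⟩ := hsurj ((β v).domRestrict W)
  have hw0' : ∀ c, μ c = 0 → β w0 c = β v c := by
    intro c hc
    have := LinearMap.congr_fun hw0 ⟨c, hc⟩
    simpa [hg] using this
  set a0 : H := v - w0 with ha0
  have hμ0 : μ a0 = 1 := by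
    have : μ (w0 : H) = 0 := w0.2
    rw [ha0, map_sub, hv, this, sub_zero]
  have hβ0 : ∀ c, μ c = 0 → β a0 c = 0 := by
    intro c hc
    rw [ha0, map_sub, LinearMap.sub_apply, hw0' c hc, sub_self]
  rw [Finset.card_eq_one]
  refine ⟨- β a0 a0, ?_⟩
  ext y
  simp only [Finset.mem_filter, Finset.mem_univ, true_and, Finset.mem_singleton]
  constructor
  · rintro ⟨a, ha, h⟩
    have hw : a - μ a • a0 = 0 := by
      by_contra hne
      apply hW
      refine ⟨_, hne, by simp [hμ0], fun c hc => ?_⟩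
      have := h c
      rw [hc, mul_zero, mul_zero, add_zero] at this
      simp [this, hβ0 c hc]
    have ha' : a = μ a • a0 := sub_eq_zero.1 hw
    have hma : μ a ≠ 0 := by
      intro h0
      rw [h0, zero_smul] at ha'
      exact ha ha'
    have := h a0
    rw [ha', map_smul, map_smul, LinearMap.smul_apply, hμ0] at this
    simp only [smul_eq_mul, mul_one] at this
    have h3 : μ a * (β a0 a0 + y) = 0 := by rw [← this]; ring
    have := (mul_eq_zero.1 h3).resolve_left hma
    exact eq_neg_of_add_eq_zero_right this
  · rintro rfl
    refine ⟨a0, ?_, fun c => ?_⟩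
    · intro h0
      rw [h0, map_zero] at hμ0
      exact zero_ne_one hμ0
    · have := hβ0 (c - μ c • a0) (by simp [hμ0])
      rw [map_sub, map_smul, smul_eq_mul, sub_eq_zero] at this
      rw [this, hμ0]; ring

variable {ι : Type*} [Fintype ι]

/-- The bilinear form attached to `x`. -/
noncomputable def bilX (ℓ : H →ₗ[K] (ι → K)) (x : ι → K) : H →ₗ[K] H →ₗ[K] K :=
  LinearMap.mk₂ K (fun a c => ∑ i, x i * (ℓ a i * ℓ c i))
    (by intro a b c; rw [← Finset.sum_add_distrib]; apply Finset.sum_congr rfl; intro i _; simp; ring)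
    (by intro s a c; rw [smul_eq_mul, Finset.mul_sum]; apply Finset.sum_congr rfl; intro i _; simp; ring)
    (by intro a b c; rw [← Finset.sum_add_distrib]; apply Finset.sum_congr rfl; intro i _; simp; ring)
    (by intro s a c; rw [smul_eq_mul, Finset.mul_sum]; apply Finset.sum_congr rfl; intro i _; simp; ring)

lemma bilX_apply (ℓ : H →ₗ[K] (ι → K)) (x : ι → K) (a c : H) :
    bilX ℓ x a c = ∑ i, x i * (ℓ a i * ℓ c i) := rfl

lemma partP (ℓ : H →ₗ[K] (ι → K)) (μ : H →ₗ[K] K) (hμ : μ ≠ 0)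
    (hN : Fintype.card ι + 2 = 2 * Module.finrank K H) (h3 : 3 ≤ Module.finrank K H) :
    Fintype.card K ^ 2 ∣ ∑ x : ι → K, (Finset.univ.filter (fun y : K =>
      ∃ a, a ≠ 0 ∧ ∀ c, ∑ i, x i * (ℓ a i * ℓ c i) + y * (μ a * μ c) = 0)).card := by
  have hW : Module.finrank K (LinearMap.ker μ) + 1 = Module.finrank K H := by
    have h1 := LinearMap.finrank_range_add_finrank_ker μ
    have h2 : LinearMap.range μ = ⊤ := by
      rw [LinearMap.range_eq_top]
      exact LinearMap.surjective hμ
    rw [h2, finrank_top, Module.finrank_self] at h1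
    omega
  have hkey : (∑ x : ι → K, (Finset.univ.filter (fun y : K =>
      ∃ a, a ≠ 0 ∧ ∀ c, ∑ i, x i * (ℓ a i * ℓ c i) + y * (μ a * μ c) = 0)).card) =
      ∑ x : ι → K, ((if ∃ a, a ≠ 0 ∧ μ a = 0 ∧ ∀ c, ∑ i, x i * (ℓ a i * ℓ c i) = 0 then
        Fintype.card K else 0) + (if ∃ w, w ≠ 0 ∧ μ w = 0 ∧ ∀ c, μ c = 0 →
        ∑ i, x i * (ℓ w i * ℓ c i) = 0 then 0 else 1)) :=
    Finset.sum_congr rfl (fun x _ => fiber_count (bilX ℓ x) (fun a c => by simp only [bilX_apply, mul_comm (ℓ a _)]) μ hμ)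
  rw [hkey, Finset.sum_add_distrib]
  have hqN : Fintype.card K ^ 2 ∣ Fintype.card (ι → K) := by
    rw [Fintype.card_fun]
    exact pow_dvd_pow _ (by omega)
  apply dvd_add
  · rw [← Finset.sum_filter, Finset.sum_const, smul_eq_mul, pow_two]
    apply mul_dvd_mul_right
    have hcomp : (Finset.univ.filter (fun x : ι → K => ∃ a, a ≠ 0 ∧ μ a = 0 ∧
        ∀ c, ∑ i, x i * (ℓ a i * ℓ c i) = 0)).card + (Finset.univ.filter (fun x : ι → K =>
        ¬ ∃ a, a ≠ 0 ∧ μ a = 0 ∧ ∀ c, ∑ i, x i * (ℓ a i * ℓ c i) = 0)).card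
        = Fintype.card (ι → K) := by
      rw [Finset.card_filter_add_card_filter_not, Finset.card_univ]
    rw [Nat.dvd_add_iff_left (n := (Finset.univ.filter (fun x : ι → K =>
        ¬ ∃ a, a ≠ 0 ∧ μ a = 0 ∧ ∀ c, ∑ i, x i * (ℓ a i * ℓ c i) = 0)).card), hcomp]
    · exact (Dvd.intro_left _ (pow_two _).symm).trans hqN
    rw [Finset.card_filter, ← Nat.modEq_zero_iff_dvd]
    have hS := S1_eq ℓ (fun a => μ a = 0)
    have hS0 : Fintype.card K ∣ ∑ x : ι → K, (Finset.univ.filter (fun a => a ∈ kerX ℓ x ∧ μ a = 0)).card := by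
      rw [hS]
      apply Finset.dvd_sum
      intro a _
      have := S1_term ℓ a 1 (by omega)
      rwa [pow_one] at this
    refine Nat.ModEq.trans ?_ (Nat.modEq_zero_iff_dvd.2 hS0)
    apply Nat.ModEq.sum
    intro x _
    have hker := card_ker_filter ((kerX ℓ x ⊓ LinearMap.ker μ).mkQ) (fun a => a ∈ kerX ℓ x ∧ μ a = 0)
      (fun u => by simp)
    rw [Submodule.ker_mkQ] at hker
    rw [hker]
    by_cases h : ¬ ∃ a, a ≠ 0 ∧ μ a = 0 ∧ ∀ c, ∑ i, x i * (ℓ a i * ℓ c i) = 0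
    · rw [if_pos h]
      have : kerX ℓ x ⊓ LinearMap.ker μ = ⊥ := by
        rw [Submodule.eq_bot_iff]
        rintro a ⟨h1, h2⟩
        by_contra ha
        exact h ⟨a, ha, h2, h1⟩
      rw [this]; simp [Nat.ModEq.refl]
    · rw [if_neg h]
      push Not at h
      obtain ⟨a, ha, h1, h2⟩ := h
      have : Module.finrank K (kerX ℓ x ⊓ LinearMap.ker μ : Submodule K H) ≠ 0 := by
        intro h0
        rw [Submodule.finrank_eq_zero, Submodule.eq_bot_iff] at h0
        exact ha (h0 a ⟨h2, h1⟩)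
      exact (Nat.modEq_zero_iff_dvd.2 (dvd_pow_self _ this)).symm
  · have hX : Fintype.card K ^ 2 ∣ Xdeg (ℓ ∘ₗ (LinearMap.ker μ).subtype) := by
      apply XM
      · omega
      · omega
      · omega
      · obtain ⟨f, hf⟩ := exists_linearIndependent_of_le_finrank (R := K) (M := LinearMap.ker μ) (n := 2) (by omega)
        refine Fcount_B _ _ (f 0) (f 1) ?_
        intro s t h
        have := Fintype.linearIndependent_iff.mp hf ![s, t] (by simpa [Fin.sum_univ_two] using h)
        exact ⟨this 0, this 1⟩
    have hsum : (∑ x : ι → K, (if ∃ w, w ≠ 0 ∧ μ w = 0 ∧ ∀ c, μ c = 0 →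
        ∑ i, x i * (ℓ w i * ℓ c i) = 0 then 0 else 1)) + Xdeg (ℓ ∘ₗ (LinearMap.ker μ).subtype)
        = Fintype.card (ι → K) := by
      unfold Xdeg
      rw [Finset.card_filter, ← Finset.sum_add_distrib, ← Finset.card_univ, Finset.card_eq_sum_ones]
      apply Finset.sum_congr rfl
      intro x _
      have : (∃ w, w ≠ 0 ∧ μ w = 0 ∧ ∀ c, μ c = 0 → ∑ i, x i * (ℓ w i * ℓ c i) = 0) ↔
        (∃ a : LinearMap.ker μ, a ≠ 0 ∧ ∀ c : LinearMap.ker μ, ∑ i, x i *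
          ((ℓ ∘ₗ (LinearMap.ker μ).subtype) a i * (ℓ ∘ₗ (LinearMap.ker μ).subtype) c i) = 0) := by
        constructor
        · rintro ⟨w, h1, h2, h3⟩
          exact ⟨⟨w, h2⟩, fun h => h1 (congrArg Subtype.val h), fun c => h3 c c.2⟩
        · rintro ⟨w, h1, h3⟩
          exact ⟨w, fun h => h1 (Subtype.ext h), w.2, fun c hc => h3 ⟨c, hc⟩⟩
      by_cases h : (∃ w, w ≠ 0 ∧ μ w = 0 ∧ ∀ c, μ c = 0 → ∑ i, x i * (ℓ w i * ℓ c i) = 0)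
      · rw [if_pos h, if_pos (this.1 h)]
      · rw [if_neg h, if_neg (fun h' => h (this.2 h'))]
    rw [← hsum] at hqN
    exact (Nat.dvd_add_left hX).1 hqN

/-- restriction of the coordinate functionals -/
def restr (ℓ : H →ₗ[K] (ι → K)) (e : ι) : H →ₗ[K] ({j // j ≠ e} → K) :=
  LinearMap.funLeft K K Subtype.val ∘ₗ ℓ

lemma restr_apply (ℓ : H →ₗ[K] (ι → K)) (e : ι) (a : H) (j : {j // j ≠ e}) :
    restr ℓ e a j = ℓ a j := rfl

lemma partP' (ℓ : H →ₗ[K] (ι → K)) (μ : H →ₗ[K] K) (hμ : μ ≠ 0)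
    (hN : Fintype.card ι + 2 = 2 * Module.finrank K H) (h3 : 3 ≤ Module.finrank K H) :
    Fintype.card K ^ 2 ∣ Nat.card {p : K × (ι → K) //
      ∃ a, a ≠ 0 ∧ ∀ c, ∑ i, p.2 i * (ℓ a i * ℓ c i) + p.1 * (μ a * μ c) = 0} := by
  rw [Nat.card_eq_fintype_card, Fintype.card_subtype, Finset.card_filter, Fintype.sum_prod_type,
    Finset.sum_comm]
  have := partP ℓ μ hμ hN h3
  simp only [Finset.card_filter] at this
  exact this

lemma Xdeg_natCard (ℓ : H →ₗ[K] (ι → K)) : Xdeg ℓ = Nat.card {x : ι → K //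
    ∃ a : H, a ≠ 0 ∧ ∀ c, ∑ i, x i * (ℓ a i * ℓ c i) = 0} := by
  unfold Xdeg
  rw [Nat.card_eq_fintype_card, Fintype.card_subtype]

lemma Xdeg_split (ℓ : H →ₗ[K] (ι → K)) (e : ι) :
    Xdeg ℓ = Nat.card {p : K × ({j // j ≠ e} → K) // ∃ a, a ≠ 0 ∧ ∀ c,
      ∑ i, p.2 i * (restr ℓ e a i * restr ℓ e c i) + p.1 * (ℓ a e * ℓ c e) = 0} := by
  rw [Xdeg_natCard]
  refine Nat.card_congr (Equiv.subtypeEquiv (Equiv.funSplitAt e K) ?_)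
  intro x
  have : ∀ a c, ∑ i, x i * (ℓ a i * ℓ c i) =
      ∑ i, (Equiv.funSplitAt e K x).2 i * (restr ℓ e a i * restr ℓ e c i) +
      (Equiv.funSplitAt e K x).1 * (ℓ a e * ℓ c e) := by
    intro a c
    rw [Fintype.sum_eq_add_sum_subtype_ne _ e, add_comm]
    rfl
  simp only [this]

lemma Xdeg_R1 (ℓ : H →ₗ[K] (ι → K)) (e1 e2 : ι) (he : e2 ≠ e1) (κ : K)
    (h : ∀ a c, ℓ a e1 * ℓ c e1 = κ * (ℓ a e2 * ℓ c e2)) :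
    Xdeg ℓ = Fintype.card K * Xdeg (restr ℓ e1) := by
  rw [Xdeg_split ℓ e1, Xdeg_natCard, ← Nat.card_eq_fintype_card, ← Nat.card_prod]
  let δ : K → ({j // j ≠ e1} → K) := fun y => Pi.single ⟨e2, he⟩ (κ * y)
  have key : ∀ (y : K) (x : {j // j ≠ e1} → K) (a c : H), ∑ i, (x + δ y) i *
      (restr ℓ e1 a i * restr ℓ e1 c i) =
      ∑ i, x i * (restr ℓ e1 a i * restr ℓ e1 c i) + y * (ℓ a e1 * ℓ c e1) := by
    intro y x a c
    simp only [Pi.add_apply, add_mul, Finset.sum_add_distrib, h]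
    congr 1
    rw [Finset.sum_eq_single ⟨e2, he⟩]
    · simp [restr_apply, δ]; ring
    · intro b _ hb
      simp [δ, Pi.single_apply, hb]
    · simp
  apply Nat.card_congr
  exact
    { toFun := fun p => (p.1.1, ⟨p.1.2 + δ p.1.1, by
        obtain ⟨a, ha, h1⟩ := p.2
        exact ⟨a, ha, fun c => by rw [key]; exact h1 c⟩⟩)
      invFun := fun t => ⟨(t.1, t.2.1 - δ t.1), by
        obtain ⟨a, ha, h1⟩ := t.2.2
        refine ⟨a, ha, fun c => ?_⟩
        have := key t.1 (t.2.1 - δ t.1) a c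
        rw [sub_add_cancel] at this
        rw [← this]; exact h1 c⟩
      left_inv := by
        rintro ⟨⟨y, x⟩, hp⟩
        simp
      right_inv := by
        rintro ⟨y, ⟨x, hx⟩⟩
        simp }

lemma card_ne_add_one (e : ι) : Fintype.card {j // j ≠ e} + 1 = Fintype.card ι := by
  have h1 := Fintype.card_subtype_compl (fun j => j = e)
  have h2 : 0 < Fintype.card ι := Fintype.card_pos_iff.2 ⟨e⟩
  simp only [Fintype.card_unique] at h1
  simp only [ne_eq]
  omega

lemma Abs3 (ℓ : H →ₗ[K] (ι → K)) (hN : Fintype.card ι + 1 = 2 * Module.finrank K H)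
    (h3 : 3 ≤ Module.finrank K H) (f : ι) (a : H) (hfa : ℓ a f ≠ 0) :
    Fintype.card K ^ 2 ∣ Xdeg ℓ := by
  rw [Xdeg_split _ f]
  have hc := card_ne_add_one f
  have hc2 : Fintype.card {j // j ≠ f} + 2 = 2 * Module.finrank K H := by omega
  have hμ : (LinearMap.proj f ∘ₗ ℓ : H →ₗ[K] K) ≠ 0 := fun h0 => hfa (LinearMap.congr_fun h0 a)
  have := partP' (restr ℓ f) (LinearMap.proj f ∘ₗ ℓ) hμ hc2 h3
  exact this

theorem Abs2 (ℓ : H →ₗ[K] (ι → K)) (hinj : Function.Injective ℓ)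
    (hN : Fintype.card ι = 2 * Module.finrank K H) (h3 : 3 ≤ Module.finrank K H)
    (e1 e2 : ι) (he : e2 ≠ e1) (κ : K)
    (h : ∀ a c, ℓ a e1 * ℓ c e1 = κ * (ℓ a e2 * ℓ c e2)) :
    Fintype.card K ^ 3 ∣ Xdeg ℓ := by
  rw [Xdeg_R1 ℓ e1 e2 he κ h, pow_succ']
  apply mul_dvd_mul_left
  have hf : ∃ f : {j // j ≠ e1}, ∃ a, ℓ a f ≠ 0 := by
    by_contra hcon
    push Not at hcon
    have : Nontrivial H := Module.nontrivial_of_finrank_pos (R := K) (by omega)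
    obtain ⟨a, ha⟩ := exists_ne (0 : H)
    apply ha
    apply hinj
    rw [map_zero]
    funext i
    by_cases hi : i = e1
    · subst hi
      have := h a a
      rw [hcon ⟨e2, he⟩ a] at this
      simpa using this
    · exact hcon ⟨i, hi⟩ a
  obtain ⟨f, a, hfa⟩ := hf
  have hc := card_ne_add_one e1
  exact Abs3 (restr ℓ e1) (by omega) h3 f a hfa

theorem Abs1 (ℓ : H →ₗ[K] (ι → K)) (hinj : Function.Injective ℓ)
    (hN : Fintype.card ι = 2 * Module.finrank K H) (p : ι → Prop)
    (Y : Submodule K H) (hY : ∀ a, a ∈ Y ↔ ∀ i, ¬ p i → ℓ a i = 0)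
    (hd : Fintype.card {i // p i} ≤ 2 * Module.finrank K Y) (h2 : 2 ≤ Module.finrank K Y)
    (z : H) (hz : z ≠ 0) (hzp : ∀ i, p i → ℓ z i = 0) :
    Fintype.card K ^ 3 ∣ Xdeg ℓ :=
  XM ℓ hN (h2.trans (Submodule.finrank_le Y)) 3 le_rfl (M_dvd ℓ hinj p Y hY hd h2 z hz hzp)

end algP

section graphG
set_option linter.unusedSectionVars false
variable {V E : Type*} [Fintype V] [Fintype E] (s t : E → V) (r : V)

/-- signed incidence -/
noncomputable def dInc (R : Type*) [Ring R] (e : E) (v : V) : R :=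
  (if s e = v then 1 else 0) - (if t e = v then 1 else 0)

lemma dInc_sum {R : Type*} [CommRing R] (e : E) (φ : V → R) :
    ∑ v, dInc s t R e v * φ v = φ (s e) - φ (t e) := by
  simp [dInc, sub_mul, Finset.sum_sub_distrib]

/-- reduced incidence matrix -/
noncomputable def DM (R : Type*) [Ring R] : Matrix E {v // v ≠ r} R :=
  Matrix.of fun e v => dInc s t R e v

lemma DM_mulVec {R : Type*} [CommRing R] (φ : V → R) (hr : φ r = 0) (e : E) :
    (DM s t r R *ᵥ (fun v => φ v)) e = φ (s e) - φ (t e) := by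
  rw [← dInc_sum, Fintype.sum_eq_add_sum_subtype_ne _ r, hr, mul_zero, zero_add]
  rfl

/-- extension by zero -/
noncomputable def extz {R : Type*} [CommRing R] (φ : {v // v ≠ r} → R) (v : V) : R :=
  if h : v ≠ r then φ ⟨v, h⟩ else 0

lemma extz_root {R : Type*} [CommRing R] (φ : {v // v ≠ r} → R) : extz r φ r = 0 := by
  simp [extz]

lemma extz_val {R : Type*} [CommRing R] (φ : {v // v ≠ r} → R) (v : {v // v ≠ r}) :
    extz r φ v = φ v := by
  simp [extz, v.2]

lemma DM_mulVec' {R : Type*} [CommRing R] (φ : {v // v ≠ r} → R) (e : E) :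
    (DM s t r R *ᵥ φ) e = extz r φ (s e) - extz r φ (t e) := by
  rw [← DM_mulVec s t r _ (extz_root r φ)]
  congr 2
  funext v
  rw [extz_val]

lemma DM_map (R : Type*) [CommRing R] : (DM s t r ℤ).map (Int.castRingHom R) = DM s t r R := by
  ext e v
  simp [DM, dInc, apply_ite (Int.cast : ℤ → R)]

/-- `T` connects everything to the root -/
def ConnTo (T : Finset E) : Prop :=
  ∀ (F : Type) [Field F] (φ : V → F), φ r = 0 → (∀ e ∈ T, φ (s e) = φ (t e)) → ∀ v, φ v = 0

lemma tree_det (T : Finset E) (hT : ConnTo s t r T) (σ : {v // v ≠ r} ≃ T) :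
    ((DM s t r ℤ).submatrix (fun v => (σ v : E)) id).det ^ 2 = 1 := by
  set P := (DM s t r ℤ).submatrix (fun v => (σ v : E)) id with hP
  have h1 : P.det.natAbs = 1 := by
    by_contra hne
    obtain ⟨p, hp, hpd⟩ := Nat.exists_prime_and_dvd hne
    have : Fact p.Prime := ⟨hp⟩
    have h0 : (P.map (Int.castRingHom (ZMod p))).det = 0 := by
      rw [← RingHom.mapMatrix_apply, ← RingHom.map_det]
      simp only [eq_intCast]
      rw [ZMod.intCast_zmod_eq_zero_iff_dvd]
      exact Int.natCast_dvd.2 hpd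
    obtain ⟨φ, hφ, h2⟩ := Matrix.exists_mulVec_eq_zero_iff.2 h0
    apply hφ
    funext v
    have := hT (ZMod p) (extz r φ) (extz_root r φ) (by
      intro e he
      have h3 := congrFun h2 (σ.symm ⟨e, he⟩)
      rw [← sub_eq_zero, ← DM_mulVec', ← DM_map]
      refine Eq.trans ?_ h3
      simp [Matrix.mulVec, dotProduct, hP]) v
    rw [extz_val] at this
    exact this
  rw [← Int.natAbs_sq, h1]; norm_num

variable {K : Type} [Field K]

/-- the matrix attached to an edge subset -/
noncomputable def MT (K : Type) [Field K] (T : Finset E) : Matrix (E ⊕ {v // v ≠ r}) (E ⊕ {v // v ≠ r}) K :=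
  Matrix.of (Sum.elim (fun e => if e ∈ T then Sum.elim 0 (DM s t r K e) else Sum.elim (Pi.single e 1) 0)
    (fun v => Sum.elim (fun e => - DM s t r K e v) 0))

/-- the big matrix -/
noncomputable def BX (x : E → K) : Matrix (E ⊕ {v // v ≠ r}) (E ⊕ {v // v ≠ r}) K :=
  Matrix.fromBlocks (Matrix.diagonal x) (DM s t r K) (-(DM s t r K)ᵀ) 0

lemma BX_det (x : E → K) :
    (BX s t r x).det = ∑ T : Finset E, (∏ e ∈ Tᶜ, x e) * (MT s t r K T).det := by
  let f := ((Matrix.detRowAlternating (n := E ⊕ {v // v ≠ r}) (R := K)).toMultilinearMap).currySum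
  have hf : ∀ m₁ m₂, f m₁ m₂ = (Matrix.of (Sum.elim m₁ m₂)).det := by
    intro m₁ m₂
    rfl
  let m₂ : {v // v ≠ r} → (E ⊕ {v // v ≠ r} → K) := fun v => Sum.elim (fun e => - DM s t r K e v) 0
  let m : E → (E ⊕ {v // v ≠ r} → K) := fun e => Sum.elim 0 (DM s t r K e)
  let m' : E → (E ⊕ {v // v ≠ r} → K) := fun e => Sum.elim (Pi.single e (x e)) 0
  have h1 : (BX s t r x).det = f (m + m') m₂ := by
    rw [hf]
    congr 1
    ext i j
    rcases i with e | v <;> rcases j with e' | v' <;>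
      simp [BX, m, m', m₂, Matrix.diagonal, Pi.single_apply, eq_comm]
  rw [h1, f.map_add_univ, _root_.sum_apply]
  apply Finset.sum_congr rfl
  intro T _
  rw [hf]
  have h2 := Matrix.det_mul_column (Sum.elim (fun e => if e ∈ T then 1 else x e) 1) (MT s t r K T)
  have h3 : ∏ i, (Sum.elim (fun e => if e ∈ T then 1 else x e) (1 : {v // v ≠ r} → K)) i = ∏ e ∈ Tᶜ, x e := by
    rw [Fintype.prod_sum_type]
    simp only [Sum.elim_inl, Sum.elim_inr, Pi.one_apply, Finset.prod_const_one, mul_one]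
    rw [Finset.prod_ite]
    simp only [Finset.prod_const_one, one_mul]
    apply Finset.prod_congr _ (fun _ _ => rfl)
    ext e; simp
  rw [h3] at h2
  rw [← h2]
  congr 1
  ext i j
  rcases i with e | v <;> rcases j with e' | v' <;> by_cases hT : ∃ h : E, h ∈ T <;>
    simp [MT, m, m', m₂, Finset.piecewise] 
  all_goals (by_cases h : e ∈ T <;> simp [h, Pi.single_apply])

end graphG

section graphG2
set_option linter.unusedSectionVars false
variable {V E : Type*} [Fintype V] [Fintype E] (s t : E → V) (r : V)
variable {K : Type} [Field K]

lemma det_antidiag {n R : Type*} [Fintype n] [DecidableEq n] [CommRing R] (P : Matrix n n R) :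
    (Matrix.fromBlocks 0 P (-Pᵀ) 0).det = P.det ^ 2 := by
  have h : Matrix.fromBlocks 0 P (-Pᵀ) 0 = Matrix.fromBlocks P 0 0 Pᵀ *
    (Matrix.fromBlocks 1 1 0 1 * (Matrix.fromBlocks 1 0 (-1) 1 * Matrix.fromBlocks 1 1 0 1)) := by
    simp [Matrix.fromBlocks_multiply]
  rw [h]
  simp only [Matrix.det_mul, Matrix.det_fromBlocks_zero₁₂, Matrix.det_fromBlocks_zero₂₁,
    Matrix.det_one, Matrix.det_transpose]
  ring

lemma MT_tree (T : Finset E) (hT : ConnTo s t r T) (hc : T.card + 1 = Fintype.card V) :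
    (MT s t r K T).det = 1 := by
  have hcard : Fintype.card {v // v ≠ r} = Fintype.card T := by
    have := card_ne_add_one r
    rw [Fintype.card_coe]
    omega
  let σ : {v // v ≠ r} ≃ T := Fintype.equivOfCardEq hcard
  let ρ₀ : {e // e ∉ T} ⊕ ({v // v ≠ r} ⊕ {v // v ≠ r}) → E ⊕ {v // v ≠ r} :=
    Sum.elim (fun e => Sum.inl e) (Sum.elim (fun v => Sum.inl (σ v)) (fun v => Sum.inr v))
  have hρ : Function.Bijective ρ₀ := by
    constructor
    · rintro (⟨e, he⟩ | v | v) (⟨e', he'⟩ | v' | v') h <;> simp [ρ₀] at h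
      · subst h; rfl
      · exact absurd (σ v').2 (h ▸ he)
      · exact absurd (σ v).2 (h ▸ he')
      · rw [h]
      · rw [h]
    · rintro (e | v)
      · by_cases he : e ∈ T
        · exact ⟨Sum.inr (Sum.inl (σ.symm ⟨e, he⟩)), by simp [ρ₀]⟩
        · exact ⟨Sum.inl ⟨e, he⟩, rfl⟩
      · exact ⟨Sum.inr (Sum.inr v), rfl⟩
  let ρ := Equiv.ofBijective ρ₀ hρ
  have hρe : ∀ i, ρ i = ρ₀ i := fun _ => rfl
  set P := (DM s t r ℤ).submatrix (fun v => (σ v : E)) id with hP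
  let PK := P.map (Int.castRingHom K)
  have hPK : ∀ v v', DM s t r K (σ v) v' = PK v v' := by
    intro v v'
    rw [← DM_map]
    rfl
  rw [← Matrix.det_submatrix_equiv_self ρ]
  have h1 : (MT s t r K T).submatrix ρ ρ = Matrix.fromBlocks 1 0
      (Matrix.of (Sum.elim 0 (fun v (e : {e // e ∉ T}) => - DM s t r K (e : E) v)))
      (Matrix.fromBlocks 0 PK (-PKᵀ) 0) := by
    ext i j
    rcases i with (⟨e, he⟩ | v | v) <;> rcases j with (⟨e', he'⟩ | v' | v') <;>
      simp [hρe, ρ₀, MT, hPK, Pi.single_apply, Matrix.one_apply, *]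
    · exact if_congr eq_comm rfl rfl
    · intro h
      exact absurd (σ v').2 (h ▸ he)
  rw [h1, Matrix.det_fromBlocks_zero₁₂, Matrix.det_one, one_mul, det_antidiag]
  have h2 := tree_det s t r T hT σ
  rw [← hP] at h2
  have h3 : PK.det = Int.castRingHom K P.det := by
    rw [RingHom.map_det]; rfl
  rw [h3, ← map_pow, h2, map_one]

lemma MT_disc (T : Finset E) (φ : V → K) (hr : φ r = 0) (h : ∀ e ∈ T, φ (s e) = φ (t e))
    (v : V) (hv : φ v ≠ 0) : (MT s t r K T).det = 0 := by
  rw [← Matrix.exists_mulVec_eq_zero_iff]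
  have hvr : v ≠ r := by rintro rfl; exact hv hr
  refine ⟨Sum.elim 0 (fun v => φ v), ?_, ?_⟩
  · intro h0
    exact hv (congrFun h0 (Sum.inr ⟨v, hvr⟩))
  · funext i
    rcases i with e | v
    · by_cases he : e ∈ T
      · have := DM_mulVec s t r φ hr e
        rw [h e he, sub_self] at this
        simpa [MT, Matrix.mulVec, dotProduct, he] using this
      · simp [MT, Matrix.mulVec, dotProduct, he]
    · simp [MT, Matrix.mulVec, dotProduct]

/-- flows supported on `p`, conserved at the vertices of `q` -/
noncomputable def EFlow (K : Type) [Field K] (p : E → Prop) (q : V → Prop) : Submodule K (E → K) :=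
  LinearMap.ker (LinearMap.prod (LinearMap.funLeft K K (Subtype.val : {e // ¬ p e} → E))
    (Matrix.toLin' (Matrix.of (fun (v : {v // q v}) (e : E) => dInc s t K e v))))

lemma mem_EFlow (p : E → Prop) (q : V → Prop) (a : E → K) : a ∈ EFlow s t K p q ↔
    (∀ e, ¬ p e → a e = 0) ∧ ∀ v, q v → ∑ e, dInc s t K e v * a e = 0 := by
  unfold EFlow
  rw [LinearMap.mem_ker]
  simp [funext_iff, LinearMap.funLeft_apply, Matrix.mulVec, dotProduct]

lemma EFlow_dim (p : E → Prop) (q : V → Prop) :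
    Nat.card {e // p e} ≤ Module.finrank K (EFlow s t K p q) + Nat.card {v // q v} := by
  rw [Nat.card_eq_fintype_card, Nat.card_eq_fintype_card]
  have h := LinearMap.finrank_range_add_finrank_ker
    (LinearMap.prod (LinearMap.funLeft K K (Subtype.val : {e // ¬ p e} → E))
    (Matrix.toLin' (Matrix.of (fun (v : {v // q v}) (e : E) => dInc s t K e v))))
  have h1 := Submodule.finrank_le (LinearMap.range
    (LinearMap.prod (LinearMap.funLeft K K (Subtype.val : {e // ¬ p e} → E))
    (Matrix.toLin' (Matrix.of (fun (v : {v // q v}) (e : E) => dInc s t K e v)))))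
  rw [Module.finrank_prod, Module.finrank_fintype_fun_eq_card,
    Module.finrank_fintype_fun_eq_card] at h1
  rw [Module.finrank_fintype_fun_eq_card] at h
  have h2 : Fintype.card {e // p e} + Fintype.card {e // ¬ p e} = Fintype.card E := by
    have h3 := Fintype.card_subtype_compl p
    have h4 := Fintype.card_subtype_le p
    omega
  have : Module.finrank K (EFlow s t K p q) = Module.finrank K (LinearMap.ker 
    (LinearMap.prod (LinearMap.funLeft K K (Subtype.val : {e // ¬ p e} → E))
    (Matrix.toLin' (Matrix.of (fun (v : {v // q v}) (e : E) => dInc s t K e v))))) := rfl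
  omega

lemma MT_cyc (T : Finset E) (hc : Fintype.card V < T.card + 1) : (MT s t r K T).det = 0 := by
  rw [← Matrix.exists_mulVec_eq_zero_iff]
  have h1 := EFlow_dim (K := K) s t (fun e => e ∈ T) (fun v => v ≠ r)
  have h2 := card_ne_add_one r
  rw [← Nat.card_eq_fintype_card] at h2
  have h1' : Nat.card {e // e ∈ T} = T.card := by
    rw [Nat.card_eq_fintype_card, Fintype.card_coe]
  rw [h1'] at h1
  have h3 : EFlow s t K (fun e => e ∈ T) (fun v => v ≠ r) ≠ ⊥ := by
    intro h0
    rw [h0, finrank_bot] at h1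
    omega
  obtain ⟨a, ha, ha0⟩ := (Submodule.ne_bot_iff _).1 h3
  rw [mem_EFlow] at ha
  refine ⟨Sum.elim a 0, ?_, ?_⟩
  · intro h0
    apply ha0
    funext e
    exact congrFun h0 (Sum.inl e)
  · funext i
    rcases i with e | v
    · by_cases he : e ∈ T
      · simp [MT, Matrix.mulVec, dotProduct, he]
      · simp [MT, Matrix.mulVec, dotProduct, he, Pi.single_apply, ha.1 e he]
    · have := ha.2 v v.2
      simpa [MT, Matrix.mulVec, dotProduct, DM] using this

end graphG2

section graphG3
set_option linter.unusedSectionVars false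
variable {V E : Type*} [Fintype V] [Fintype E] (s t : E → V) (r : V)
variable {K : Type} [Field K]

/-- the cycle space -/
noncomputable abbrev HF (K : Type) [Field K] : Submodule K (E → K) :=
  EFlow s t K (fun _ => True) (fun v => v ≠ r)

lemma mem_HF (a : E → K) : a ∈ HF s t r K ↔ (DM s t r K)ᵀ *ᵥ a = 0 := by
  rw [mem_EFlow]
  simp [funext_iff, Matrix.mulVec, dotProduct, DM]

lemma dInc_tot (e : E) : ∑ v, dInc s t K e v = 0 := by
  have := dInc_sum s t (R := K) e (fun _ => 1)
  simpa using this

lemma DM_inj (hc : ConnTo s t r Finset.univ) (φ : {v // v ≠ r} → K)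
    (h : DM s t r K *ᵥ φ = 0) : φ = 0 := by
  funext v
  rw [← extz_val r φ v]
  refine hc K (extz r φ) (extz_root r φ) (fun e _ => ?_) v
  rw [← sub_eq_zero, ← DM_mulVec', h]; rfl

lemma HF_dim (hc : ConnTo s t r Finset.univ) :
    Module.finrank K (HF s t r K) + Fintype.card V = Fintype.card E + 1 := by
  have h1 : HF s t r K = LinearMap.ker (Matrix.toLin' (DM s t r K)ᵀ) := by
    ext a
    rw [mem_HF, LinearMap.mem_ker, Matrix.toLin'_apply]
  have h2 := LinearMap.finrank_range_add_finrank_ker (Matrix.toLin' (DM s t r K)ᵀ)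
  have h3 : Module.finrank K (LinearMap.range (Matrix.toLin' (DM s t r K)ᵀ)) =
      (DM s t r K)ᵀ.rank := rfl
  rw [h3, Matrix.rank_transpose] at h2
  have h4 : (DM s t r K).rank = Nat.card {v // v ≠ r} := by
    have h5 : (DM s t r K).rank = Module.finrank K (LinearMap.range (DM s t r K).mulVecLin) := rfl
    rw [h5, LinearMap.finrank_range_of_inj, Module.finrank_fintype_fun_eq_card,
      Nat.card_eq_fintype_card]
    rw [← LinearMap.ker_eq_bot, LinearMap.ker_eq_bot']
    intro φ hφ
    exact DM_inj s t r hc φ hφ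
  rw [← h1, h4, Module.finrank_fintype_fun_eq_card] at h2
  have h6 := card_ne_add_one r
  rw [← Nat.card_eq_fintype_card] at h6
  omega

lemma BX_zero_iff (hc : ConnTo s t r Finset.univ) (x : E → K) :
    (BX s t r x).det = 0 ↔ ∃ a : HF s t r K, a ≠ 0 ∧ ∀ c : HF s t r K,
      ∑ i, x i * ((HF s t r K).subtype a i * (HF s t r K).subtype c i) = 0 := by
  rw [← Matrix.exists_mulVec_eq_zero_iff]
  have key : ∀ (a : E → K) (φ : {v // v ≠ r} → K),
      BX s t r x *ᵥ Sum.elim a φ = Sum.elim (fun e => x e * a e + (DM s t r K *ᵥ φ) e)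
        (-((DM s t r K)ᵀ *ᵥ a)) := by
    intro a φ
    rw [BX, Matrix.fromBlocks_mulVec]
    funext i
    rcases i with e | v
    · simp [Matrix.mulVec_diagonal]
    · simp [Matrix.neg_mulVec]
  constructor
  · rintro ⟨w, hw, h0⟩
    obtain ⟨a, φ, rfl⟩ : ∃ a φ, w = Sum.elim a φ := ⟨w ∘ Sum.inl, w ∘ Sum.inr, by simp⟩
    rw [key] at h0
    have h1 : ∀ e, x e * a e + (DM s t r K *ᵥ φ) e = 0 := fun e => congrFun h0 (Sum.inl e)
    have h2 : (DM s t r K)ᵀ *ᵥ a = 0 := by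
      funext v
      have := congrFun h0 (Sum.inr v)
      simpa using this
    refine ⟨⟨a, (mem_HF s t r a).2 h2⟩, ?_, ?_⟩
    · intro ha
      have ha' : a = 0 := congrArg Subtype.val ha
      apply hw
      have : φ = 0 := by
        apply DM_inj s t r hc
        funext e
        have := h1 e
        simpa [ha'] using this
      rw [ha', this]
      funext i
      rcases i with e | v <;> rfl
    · rintro ⟨c, hcc⟩
      have hc' := (mem_HF s t r c).1 hcc
      have h3 : ∀ e, x e * (a e * c e) = - ((DM s t r K *ᵥ φ) e * c e) := by
        intro e
        linear_combination (c e) * h1 e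
      simp only [Submodule.subtype_apply]
      rw [Finset.sum_congr rfl (fun e _ => h3 e), Finset.sum_neg_distrib, neg_eq_zero]
      change (DM s t r K *ᵥ φ) ⬝ᵥ c = 0
      rw [dotProduct_comm, Matrix.dotProduct_mulVec, ← Matrix.mulVec_transpose, hc',
        zero_dotProduct]
  · rintro ⟨⟨a, ha⟩, ha0, h⟩
    let f : Module.Dual K (E → K) := ∑ i, (x i * a i) • LinearMap.proj i
    have hf : ∀ c, f c = ∑ i, x i * (a i * c i) := by
      intro c
      simp [f, mul_assoc]
    have hfm : f ∈ LinearMap.range (Matrix.toLin' (DM s t r K)ᵀ).dualMap := by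
      rw [LinearMap.range_dualMap_eq_dualAnnihilator_ker, Submodule.mem_dualAnnihilator]
      intro c hcc
      rw [hf]
      exact h ⟨c, (mem_HF s t r c).2 hcc⟩
    obtain ⟨g, hg⟩ := hfm
    refine ⟨Sum.elim a (fun v => - g (Pi.single v 1)), ?_, ?_⟩
    · intro h0
      apply ha0
      ext e
      exact congrFun h0 (Sum.inl e)
    · rw [key, (mem_HF s t r a).1 ha]
      funext i
      rcases i with e | v
      · simp only [Sum.elim_inl, Pi.zero_apply]
        have h5 := hf (Pi.single e 1)
        rw [← hg] at h5
        have h6 : (Matrix.toLin' (DM s t r K)ᵀ).dualMap g (Pi.single e 1) =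
            ∑ v, DM s t r K e v * g (Pi.single v 1) := by
          rw [LinearMap.dualMap_apply, Matrix.toLin'_apply, Matrix.mulVec_single_one]
          rw [LinearMap.pi_apply_eq_sum_univ g]
          simp only [Matrix.col_apply, Matrix.transpose_apply, smul_eq_mul]
          refine Finset.sum_congr rfl (fun v _ => ?_)
          congr 2
          funext j
          rw [Pi.single_apply]
          exact if_congr eq_comm rfl rfl
        rw [h6] at h5
        have h7 : ∑ i, x i * (a i * (Pi.single e 1 : E → K) i) = x e * a e := by
          simp [Pi.single_apply]
        rw [h7] at h5
        rw [← h5]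
        simp [Matrix.mulVec, dotProduct]
      · simp

end graphG3

section graphG4
set_option linter.unusedSectionVars false
variable {V E : Type*} [Fintype V] [Fintype E] (s t : E → V)
variable {K : Type} [Field K]

/-- subgraph of an edge set -/
def FT (T : Finset E) : SimpleGraph V :=
  SimpleGraph.fromEdgeSet ((fun e => s(s e, t e)) '' (T : Set E))

lemma FT_adj (hne : ∀ e, s e ≠ t e) (T : Finset E) (e : E) (he : e ∈ T) :
    (FT s t T).Adj (s e) (t e) := by
  rw [FT, SimpleGraph.fromEdgeSet_adj]
  exact ⟨⟨e, he, rfl⟩, hne e⟩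

lemma FT_const {F : Type} (T : Finset E) (φ : V → F)
    (h : ∀ e ∈ T, φ (s e) = φ (t e)) (u v : V) (huv : (FT s t T).Reachable u v) : φ u = φ v := by
  obtain ⟨w⟩ := huv
  induction w with
  | nil => rfl
  | cons hadj _ ih =>
    rw [← ih]
    rw [FT, SimpleGraph.fromEdgeSet_adj] at hadj
    obtain ⟨⟨e, he, h1⟩, _⟩ := hadj
    have := h e he
    rw [Sym2.eq_iff] at h1
    rcases h1 with ⟨h1, h2⟩ | ⟨h1, h2⟩
    · rw [← h1, ← h2, this]
    · rw [← h1, ← h2, this]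

lemma FT_conn (T : Finset E) (r : V) (h : (FT s t T).Connected) :
    ConnTo s t r T := by
  intro F _ φ hr hT v
  rw [← hr]
  exact FT_const s t T φ hT v r (h.preconnected v r)

lemma FT_card (hne : ∀ e, s e ≠ t e) (hinj : Function.Injective (fun e => s(s e, t e)))
    (T : Finset E) : Nat.card (FT s t T).edgeSet = T.card := by
  have h : (FT s t T).edgeSet = (fun e => s(s e, t e)) '' (T : Set E) := by
    rw [FT, SimpleGraph.edgeSet_fromEdgeSet, sdiff_eq_left]
    rw [Set.disjoint_left]
    rintro _ ⟨e, _, rfl⟩ h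
    exact hne e (by simpa using h)
  rw [h, Nat.card_image_of_injective hinj]
  simp

lemma MT_eq (hne : ∀ e, s e ≠ t e) (hinj : Function.Injective (fun e => s(s e, t e)))
    (T : Finset E) (r : V) :
    (MT s t r K T).det = if (FT s t T).IsTree then 1 else 0 := by
  by_cases hc : (FT s t T).Connected
  · have h1 := hc.card_vert_le_card_edgeSet_add_one
    rw [FT_card s t hne hinj, Nat.card_eq_fintype_card] at h1
    have h2 : (FT s t T).IsTree ↔ T.card + 1 = Fintype.card V := by
      rw [SimpleGraph.isTree_iff_connected_and_card, FT_card s t hne hinj,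
        Nat.card_eq_fintype_card]
      exact ⟨fun h => h.2, fun h => ⟨hc, h⟩⟩
    split_ifs with h
    · exact MT_tree _ _ r T (FT_conn s t T r hc) (h2.1 h)
    · apply MT_cyc
      rw [h2] at h
      omega
  · rw [if_neg (fun h => hc h.connected)]
    have : ∃ v, ¬ (FT s t T).Reachable v r := by
      by_contra hcon
      push Not at hcon
      apply hc
      have : Nonempty V := ⟨r⟩
      exact ⟨fun u v => (hcon u).trans (hcon v).symm⟩
    obtain ⟨v, hv⟩ := this
    refine MT_disc _ _ r T (fun v => if (FT s t T).Reachable v r then 0 else 1) ?_ ?_ v ?_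
    · simp
    · intro e he
      have := (FT_adj s t hne T e he).reachable
      refine if_congr ⟨fun h => this.symm.trans h, fun h => this.trans h⟩ rfl rfl
    · simp [hv]

lemma sum_tree_iff (hne : ∀ e, s e ≠ t e) (hinj : Function.Injective (fun e => s(s e, t e)))
    (r : V) (hc : ConnTo s t r Finset.univ) [DecidableEq E] (x : E → K) :
    (∑ T : Finset E, if (FT s t T).IsTree then ∏ e ∈ Tᶜ, x e else 0) = 0 ↔
      ∃ a : HF s t r K, a ≠ 0 ∧ ∀ c : HF s t r K,
      ∑ i, x i * ((HF s t r K).subtype a i * (HF s t r K).subtype c i) = 0 := by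
  have hi : ‹DecidableEq E› = (fun a b => Classical.propDecidable (a = b)) := Subsingleton.elim _ _
  subst hi
  rw [← BX_zero_iff s t r hc, BX_det]
  have : ∀ T : Finset E, (if (FT s t T).IsTree then ∏ e ∈ Tᶜ, x e else 0) =
      (∏ e ∈ Tᶜ, x e) * (MT s t r K T).det := by
    intro T
    rw [MT_eq s t hne hinj]
    split_ifs with h
    · rw [mul_one]
    · simp
  rw [Finset.sum_congr rfl (fun T _ => this T)]

end graphG4

section graphG5
variable {V : Type*} [Fintype V] (G : SimpleGraph V)
variable {K : Type} [Field K]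

/-- source -/
noncomputable def gs (e : G.edgeSet) : V := (Quot.out e.1).1
/-- target -/
noncomputable def gt (e : G.edgeSet) : V := (Quot.out e.1).2

lemma gst (e : G.edgeSet) : e.1 = s(gs G e, gt G e) := (Quot.out_eq e.1).symm

lemma gadj (e : G.edgeSet) : G.Adj (gs G e) (gt G e) := by
  rw [← SimpleGraph.mem_edgeSet, ← gst]; exact e.2

lemma gne (e : G.edgeSet) : gs G e ≠ gt G e := (gadj G e).ne

lemma ginj : Function.Injective (fun e : G.edgeSet => s(gs G e, gt G e)) := by
  intro e f h
  apply Subtype.ext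
  rw [gst G e, gst G f]
  exact h

lemma gFT (T : Finset G.edgeSet) : FT (gs G) (gt G) T =
    SimpleGraph.fromEdgeSet (Subtype.val '' (T : Set G.edgeSet)) := by
  unfold FT
  congr 2
  funext e
  exact (gst G e).symm

variable [Fintype G.edgeSet]

lemma G_conn (hG : G.Connected) (r : V) : ConnTo (gs G) (gt G) r Finset.univ := by
  apply FT_conn
  have : FT (gs G) (gt G) Finset.univ = G := by
    rw [gFT]; simp
  rwa [this]

lemma Xcount_eq [Fintype K] (hG : G.Connected) (r : V) :
    Xcount G K = Nat.card {x : G.edgeSet → K // ∃ a : HF (gs G) (gt G) r K, a ≠ 0 ∧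
      ∀ c : HF (gs G) (gt G) r K, ∑ i, x i * ((HF (gs G) (gt G) r K).subtype a i *
        (HF (gs G) (gt G) r K).subtype c i) = 0} := by
  unfold Xcount
  apply Nat.card_congr
  apply Equiv.subtypeEquivRight
  intro x
  rw [← sum_tree_iff (gs G) (gt G) (gne G) (ginj G) r (G_conn G hG r)]
  have hinst : ‹Fintype G.edgeSet› = Fintype.ofFinite _ := Subsingleton.elim _ _
  subst hinst
  unfold graphPoly
  rw [map_sum]
  simp only [gFT, apply_ite (MvPolynomial.aeval x), map_prod, MvPolynomial.aeval_X, map_zero]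
  
end graphG5

section graphG6
set_option linter.unusedSectionVars false
variable {V E : Type*} [Fintype V] [Fintype E] (s t : E → V) (r : V)
variable {K : Type} [Field K]

lemma cons_last (a : E → K) (w : V)
    (h : ∀ v, v ≠ w → ∑ e, dInc s t K e v * a e = 0) (v : V) : ∑ e, dInc s t K e v * a e = 0 := by
  by_cases hv : v = w
  · subst hv
    have h1 : ∑ v, ∑ e, dInc s t K e v * a e = 0 := by
      rw [Finset.sum_comm]
      apply Finset.sum_eq_zero
      intro e _
      rw [← Finset.sum_mul, dInc_tot, zero_mul]
    rw [Finset.sum_eq_single v (fun u _ hu => h u hu) (by simp)] at h1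
    exact h1
  · exact h v hv

/-- number of edges inside `A` -/
noncomputable def NE (A : Finset V) : ℕ := Nat.card {e // s e ∈ A ∧ t e ∈ A}

lemma flow_dim (A : Finset V) (hA : A.Nonempty) :
    NE s t A + 1 ≤ Module.finrank K
      (EFlow s t K (fun e => s e ∈ A ∧ t e ∈ A) (fun _ => True)) + A.card := by
  obtain ⟨a0, ha0⟩ := hA
  have h1 := EFlow_dim (K := K) s t (fun e => s e ∈ A ∧ t e ∈ A) (fun v => v ∈ A.erase a0)
  have h2 : Nat.card {v // v ∈ A.erase a0} + 1 = A.card := by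
    rw [Nat.card_eq_fintype_card, Fintype.card_coe]
    exact Finset.card_erase_add_one ha0
  have h3 : EFlow s t K (fun e => s e ∈ A ∧ t e ∈ A) (fun v => v ∈ A.erase a0) ≤
      EFlow s t K (fun e => s e ∈ A ∧ t e ∈ A) (fun _ => True) := by
    intro a ha
    rw [mem_EFlow] at ha ⊢
    refine ⟨ha.1, fun v _ => cons_last s t a a0 (fun v hv => ?_) v⟩
    by_cases hvA : v ∈ A
    · exact ha.2 v (Finset.mem_erase.2 ⟨hv, hvA⟩)
    · apply Finset.sum_eq_zero
      intro e _
      by_cases he : s e ∈ A ∧ t e ∈ A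
      · have e1 : s e ≠ v := fun h => hvA (h ▸ he.1)
        have e2 : t e ≠ v := fun h => hvA (h ▸ he.2)
        simp [dInc, e1, e2]
      · rw [ha.1 e he, mul_zero]
  have h4 := Submodule.finrank_mono h3
  unfold NE
  omega

/-- incident edges -/
noncomputable def inc (v : V) : Finset E := Finset.univ.filter (fun e => s e = v ∨ t e = v)

lemma inc_nonempty (hc : ∀ r, ConnTo s t r Finset.univ) (hV : 2 ≤ Fintype.card V) (v : V) :
    (inc s t v).Nonempty := by
  by_contra hcon
  rw [Finset.not_nonempty_iff_eq_empty] at hcon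
  have h0 : ∀ e, s e ≠ v ∧ t e ≠ v := by
    intro e
    have : e ∉ inc s t v := by rw [hcon]; simp
    simpa [inc, not_or] using this
  have : Nontrivial V := Fintype.one_lt_card_iff_nontrivial.1 (by omega)
  obtain ⟨r, hr⟩ := exists_ne v
  have := hc r ℚ (fun u => if u = v then 1 else 0) (by simp [hr])
    (fun e _ => by simp [(h0 e).1, (h0 e).2]) v
  simp at this

lemma dInc_sq (hne : ∀ e, s e ≠ t e) (e : E) (v : V) (h : e ∈ inc s t v) :
    dInc s t K e v * dInc s t K e v = 1 := by
  simp only [inc, Finset.mem_filter, Finset.mem_univ, true_and] at h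
  rcases h with h | h
  · have : t e ≠ v := by rw [← h]; exact (hne e).symm
    simp [dInc, h, this]
  · have : s e ≠ v := by rw [← h]; exact hne e
    simp [dInc, h, this]

lemma dInc_inc (a : E → K) (v : V) :
    ∑ e, dInc s t K e v * a e = ∑ e ∈ inc s t v, dInc s t K e v * a e := by
  symm
  apply Finset.sum_subset (Finset.subset_univ _)
  intro e _ he
  simp only [inc, Finset.mem_filter, Finset.mem_univ, true_and, not_or] at he
  simp [dInc, he.1, he.2]

lemma HF_cons (a : E → K) (ha : a ∈ HF s t r K) (v : V) :
    ∑ e ∈ inc s t v, dInc s t K e v * a e = 0 := by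
  rw [← dInc_inc]
  rw [mem_EFlow] at ha
  exact cons_last s t a r (fun v hv => ha.2 v hv) v

lemma handshake (hne : ∀ e, s e ≠ t e) (A : Finset V) :
    ∑ v ∈ Aᶜ, (inc s t v).card + NE s t A = Fintype.card E + NE s t Aᶜ := by
  have h1 : ∀ A : Finset V, NE s t A = ∑ e, if s e ∈ A ∧ t e ∈ A then 1 else 0 := by
    intro A
    rw [NE, Nat.card_eq_fintype_card, Fintype.card_subtype, Finset.card_filter]
  have h2 : ∑ v ∈ Aᶜ, (inc s t v).card =
      ∑ e, ((if s e ∈ Aᶜ then 1 else 0) + (if t e ∈ Aᶜ then 1 else 0)) := by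
    simp only [inc, Finset.card_filter]
    rw [Finset.sum_comm]
    apply Finset.sum_congr rfl
    intro e _
    have : ∀ v, (if s e = v ∨ t e = v then 1 else 0) =
        (if s e = v then 1 else 0) + (if t e = v then 1 else 0) := by
      intro v
      by_cases h : s e = v
      · have : t e ≠ v := by rw [← h]; exact (hne e).symm
        simp [h, this]
      · simp [h]
    simp only [this, Finset.sum_add_distrib, Finset.sum_ite_eq]
  rw [h2, h1, h1, ← Finset.sum_add_distrib, ← Finset.card_univ, Finset.card_eq_sum_ones,
    ← Finset.sum_add_distrib]
  apply Finset.sum_congr rfl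
  intro e _
  by_cases h3 : s e ∈ A <;> by_cases h4 : t e ∈ A <;> simp [h3, h4]

theorem Abs1n [Fintype K] {ι H : Type*} [Fintype ι] [AddCommGroup H] [Module K H] [Fintype H]
    (ℓ : H →ₗ[K] (ι → K)) (hinj : Function.Injective ℓ)
    (hN : Fintype.card ι = 2 * Module.finrank K H) (p : ι → Prop)
    (Y : Submodule K H) (hY : ∀ a, a ∈ Y ↔ ∀ i, ¬ p i → ℓ a i = 0)
    (hd : Nat.card {i // p i} ≤ 2 * Module.finrank K Y) (h2 : 2 ≤ Module.finrank K Y)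
    (z : H) (hz : z ≠ 0) (hzp : ∀ i, p i → ℓ z i = 0) :
    Fintype.card K ^ 3 ∣ Xdeg ℓ := by
  rw [Nat.card_eq_fintype_card] at hd
  exact Abs1 ℓ hinj hN p Y hY hd h2 z hz hzp

theorem final_gen [Fintype K] (hne : ∀ e, s e ≠ t e) (hc : ∀ r, ConnTo s t r Finset.univ)
    (hN : Fintype.card E + 2 = 2 * Fintype.card V) (A : Finset V) (hA3 : 3 ≤ A.card)
    (hA : A ≠ Finset.univ) (hNA : 2 * A.card ≤ NE s t A + 2) :
    Fintype.card K ^ 3 ∣ Nat.card {x : E → K // ∃ a : HF s t r K, a ≠ 0 ∧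
      ∀ c : HF s t r K, ∑ i, x i * ((HF s t r K).subtype a i *
        (HF s t r K).subtype c i) = 0} := by
  rw [← Xdeg_natCard]
  have hV : A.card < Fintype.card V := by
    rw [← Finset.card_univ]
    exact Finset.card_lt_card (Finset.ssubset_univ_iff.2 hA)
  have hdim := HF_dim (K := K) s t r (hc r)
  have hinj : Function.Injective (HF s t r K).subtype := Subtype.val_injective
  have hN2 : Fintype.card E = 2 * Module.finrank K (HF s t r K) := by omega
  have hd3 : 3 ≤ Module.finrank K (HF s t r K) := by omega
  by_cases hdeg : ∃ v, (inc s t v).card ≤ 2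
  · obtain ⟨v, hv⟩ := hdeg
    have hpos := (inc_nonempty s t hc (by omega) v).card_pos
    have h12 : (inc s t v).card = 1 ∨ (inc s t v).card = 2 := by omega
    rcases h12 with h1 | h1
    · obtain ⟨e1, he1⟩ := Finset.card_eq_one.1 h1
      have hm : e1 ∈ inc s t v := by rw [he1]; simp
      have : Nontrivial E := Fintype.one_lt_card_iff_nontrivial.1 (by omega)
      obtain ⟨e2, he2⟩ := exists_ne e1
      have hz : ∀ a : HF s t r K, (HF s t r K).subtype a e1 = 0 := by
        rintro ⟨a, ha⟩
        have h := HF_cons s t r a ha v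
        rw [he1, Finset.sum_singleton] at h
        have h2 := dInc_sq (K := K) s t hne e1 v hm
        simp only [Submodule.subtype_apply]
        linear_combination (dInc s t K e1 v) * h - a e1 * h2
      exact Abs2 _ hinj hN2 hd3 e1 e2 he2 0 (fun a c => by rw [hz a]; ring)
    · obtain ⟨e1, e2, h12, he⟩ := Finset.card_eq_two.1 h1
      have hm1 : e1 ∈ inc s t v := by rw [he]; simp
      have hm2 : e2 ∈ inc s t v := by rw [he]; simp
      have hd1 := dInc_sq (K := K) s t hne e1 v hm1
      have hd2 := dInc_sq (K := K) s t hne e2 v hm2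
      have hz : ∀ a : HF s t r K, (HF s t r K).subtype a e1 =
          - (dInc s t K e1 v * dInc s t K e2 v) * (HF s t r K).subtype a e2 := by
        rintro ⟨a, ha⟩
        have h := HF_cons s t r a ha v
        rw [he, Finset.sum_pair h12] at h
        simp only [Submodule.subtype_apply]
        linear_combination (dInc s t K e1 v) * h - a e1 * hd1
      refine Abs2 _ hinj hN2 hd3 e1 e2 h12.symm 1 (fun a c => ?_)
      rw [hz a, hz c]
      generalize (HF s t r K).subtype a e2 = y
      generalize (HF s t r K).subtype c e2 = z
      linear_combination (dInc s t K e2 v * dInc s t K e2 v * y * z) * hd1 + y * z * hd2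
  · push Not at hdeg
    have hh := handshake s t hne A
    have hB : 3 * (Aᶜ).card ≤ ∑ v ∈ Aᶜ, (inc s t v).card := by
      have := Finset.card_nsmul_le_sum Aᶜ (fun v => (inc s t v).card) 3 (fun v _ => hdeg v)
      rw [smul_eq_mul] at this
      omega
    have hcA : A.card + (Aᶜ).card = Fintype.card V := Finset.card_add_card_compl A
    have hBne : (Aᶜ).Nonempty := by
      rw [← Finset.card_pos]; omega
    have hAne : A.Nonempty := by
      rw [← Finset.card_pos]; omega
    have hfB := flow_dim (K := K) s t Aᶜ hBne
    have hfA := flow_dim (K := K) s t A hAne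
    have hBot : EFlow s t K (fun e => s e ∈ Aᶜ ∧ t e ∈ Aᶜ) (fun _ => True) ≠ ⊥ := by
      intro h0
      rw [h0, finrank_bot] at hfB
      omega
    obtain ⟨z, hz, hz0⟩ := (Submodule.ne_bot_iff _).1 hBot
    rw [mem_EFlow] at hz
    have hzH : z ∈ HF s t r K := by
      rw [mem_EFlow]
      exact ⟨fun e he => absurd trivial he, fun v _ => hz.2 v trivial⟩
    set Y0 := EFlow s t K (fun e => s e ∈ A ∧ t e ∈ A) (fun _ => True) with hY0
    have hle : Y0 ≤ HF s t r K := by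
      intro a ha
      rw [hY0, mem_EFlow] at ha
      rw [mem_EFlow]
      exact ⟨fun e he => absurd trivial he, fun v _ => ha.2 v trivial⟩
    have hfr : Module.finrank K (Y0.comap (HF s t r K).subtype) = Module.finrank K Y0 :=
      (Submodule.comapSubtypeEquivOfLe hle).finrank_eq
    refine Abs1n _ hinj hN2 (fun e => s e ∈ A ∧ t e ∈ A) (Y0.comap (HF s t r K).subtype) ?_ ?_ ?_
      ⟨z, hzH⟩ ?_ ?_
    · rintro ⟨a, ha⟩
      rw [Submodule.mem_comap, hY0, mem_EFlow]
      constructor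
      · exact fun h => h.1
      · intro h
        rw [mem_EFlow] at ha
        exact ⟨h, fun v _ => cons_last s t a r (fun v hv => ha.2 v hv) v⟩
    · rw [hfr]
      change NE s t A ≤ _
      omega
    · rw [hfr]; omega
    · intro h
      exact hz0 (congrArg Subtype.val h)
    · intro e he
      apply hz.1
      intro h
      exact (Finset.mem_compl.1 h.1) he.1

theorem find_A (hne : ∀ e, s e ≠ t e) (hinj : Function.Injective (fun e => s(s e, t e)))
    (hN : Fintype.card E + 2 = 2 * Fintype.card V)
    (γ : Finset E) (hγ : γ.Nonempty) (hγ2 : γ ≠ Finset.univ)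
    (hdiv : 2 * Fintype.card V ≤ γ.card + 2 * Nat.card (FT s t γ).ConnectedComponent) :
    ∃ A : Finset V, 3 ≤ A.card ∧ A ≠ Finset.univ ∧ 2 * A.card ≤ NE s t A + 2 := by
  let mk := (FT s t γ).connectedComponentMk
  let n : (FT s t γ).ConnectedComponent → Finset V := fun c => Finset.univ.filter (fun v => mk v = c)
  let m : (FT s t γ).ConnectedComponent → Finset E := fun c => γ.filter (fun e => mk (s e) = c)
  have hst : ∀ e ∈ γ, mk (s e) = mk (t e) := fun e he =>
    SimpleGraph.ConnectedComponent.connectedComponentMk_eq_of_adj (FT_adj s t hne γ e he)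
  have hn : ∑ c, (n c).card = Fintype.card V := by
    rw [← Finset.card_univ (α := V)]
    exact (Finset.card_eq_sum_card_fiberwise (fun v _ => Finset.mem_univ _)).symm
  have hm : ∑ c, (m c).card = γ.card := 
    (Finset.card_eq_sum_card_fiberwise (fun v _ => Finset.mem_univ _)).symm
  have hsub : ∀ c, ∀ e ∈ m c, s e ∈ n c ∧ t e ∈ n c := by
    intro c e he
    simp only [m, Finset.mem_filter] at he
    simp only [n, Finset.mem_filter, Finset.mem_univ, true_and]
    exact ⟨he.2, (hst e he.1) ▸ he.2⟩
  have hmNE : ∀ c, (m c).card ≤ NE s t (n c) := by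
    intro c
    rw [NE, Nat.card_eq_fintype_card, Fintype.card_subtype]
    apply Finset.card_le_card
    intro e he
    simpa using hsub c e he
  have hex : ∃ c, 2 ≤ (n c).card ∧ 2 * (n c).card ≤ (m c).card + 2 := by
    by_contra hcon
    push Not at hcon
    obtain ⟨e0, he0⟩ := hγ
    have hn1 : ∀ c, 1 ≤ (n c).card := by
      intro c
      induction c using SimpleGraph.ConnectedComponent.ind with
      | h v => exact Finset.card_pos.2 ⟨v, by simp [n, mk]⟩
    have hn2 : ∀ c, ∀ e ∈ m c, 2 ≤ (n c).card := by
      intro c e he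
      exact Finset.one_lt_card.2 ⟨s e, (hsub c e he).1, t e, (hsub c e he).2, hne e⟩
    have hle : ∀ c, (m c).card + 2 ≤ 2 * (n c).card := by
      intro c
      by_cases h : 2 ≤ (n c).card
      · exact (hcon c h).le
      · have : (m c) = ∅ := by
          by_contra h2
          obtain ⟨e, he⟩ := Finset.nonempty_iff_ne_empty.2 h2
          exact h (hn2 c e he)
        rw [this, Finset.card_empty]
        have := hn1 c
        omega
    have hlt := Finset.sum_lt_sum (s := Finset.univ) (fun c _ => hle c)
      ⟨mk (s e0), Finset.mem_univ _, hcon _ (hn2 _ e0 (by simp [m, he0]))⟩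
    rw [Finset.sum_add_distrib, ← Finset.mul_sum, hn, hm, Finset.sum_const, Finset.card_univ,
      smul_eq_mul, ← Nat.card_eq_fintype_card] at hlt
    omega
  obtain ⟨c, hc1, hc2⟩ := hex
  have hγc : γ.card < Fintype.card E := by
    rw [← Finset.card_univ]
    exact Finset.card_lt_card (Finset.ssubset_univ_iff.2 hγ2)
  have hmγ : (m c).card ≤ γ.card := Finset.card_le_card (Finset.filter_subset _ _)
  refine ⟨n c, ?_, ?_, ?_⟩
  · by_contra h3
    have h2 : (n c).card = 2 := by omega
    obtain ⟨u, v, huv, hnc⟩ := Finset.card_eq_two.1 h2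
    have h4 : ∀ e ∈ m c, s(s e, t e) = s(u, v) := by
      intro e he
      have h5 := hsub c e he
      rw [hnc] at h5
      simp only [Finset.mem_insert, Finset.mem_singleton] at h5
      have h6 := hne e
      rw [Sym2.eq_iff]
      rcases h5 with ⟨h7 | h7, h8 | h8⟩
      · exact absurd (h7.trans h8.symm) h6
      · exact Or.inl ⟨h7, h8⟩
      · exact Or.inr ⟨h7, h8⟩
      · exact absurd (h7.trans h8.symm) h6
    have h1 : (m c).card ≤ 1 := by
      rw [Finset.card_le_one]
      intro e he f hf
      exact hinj ((h4 e he).trans (h4 f hf).symm)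
    omega
  · intro h
    rw [h, Finset.card_univ] at hc2
    omega
  · have := hmNE c
    omega

end graphG6

theorem stmt10 {V : Type*} [Fintype V] (G : SimpleGraph V) (hG : G.Connected)
    (hV : 3 ≤ Fintype.card V) (hphi4 : InPhi4 G)
    (hlog : (Nat.card G.edgeSet : ℤ) =
      2 * ((Nat.card G.edgeSet : ℤ) - (Fintype.card V : ℤ) + 1))
    (γ : Set (Sym2 V)) (hsub : γ ⊆ G.edgeSet) (hne : γ.Nonempty)
    (hproper : γ ≠ G.edgeSet)
    (hdiv : (Nat.card γ : ℤ) ≤ 2 * edgeBetti γ)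
    (K : Type) [Field K] [Fintype K] :
    Xcount G K ≡ 0 [MOD (Fintype.card K) ^ 3] := by
  let _ : Fintype G.edgeSet := Fintype.ofFinite _
  obtain ⟨r⟩ := hG.nonempty
  rw [Nat.modEq_zero_iff_dvd, Xcount_eq G hG r]
  have hN : Fintype.card G.edgeSet + 2 = 2 * Fintype.card V := by
    rw [Nat.card_eq_fintype_card] at hlog
    omega
  let γ' : Finset G.edgeSet := Finset.univ.filter (fun e => e.1 ∈ γ)
  have hγ' : Subtype.val '' (γ' : Set G.edgeSet) = γ := by
    ext e
    simp only [γ', Set.mem_image, Finset.coe_filter, Finset.mem_univ, true_and, Set.mem_ofPred_eq]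
    constructor
    · rintro ⟨f, hf, rfl⟩
      exact hf
    · intro he
      exact ⟨⟨e, hsub he⟩, he, rfl⟩
  have hcard : Nat.card γ = γ'.card := by
    rw [← hγ', Nat.card_image_of_injective Subtype.val_injective]
    simp
  have hA := find_A (gs G) (gt G) (gne G) (ginj G) hN γ' (by
      obtain ⟨e, he⟩ := hne
      exact ⟨⟨e, hsub he⟩, by simp [γ', he]⟩) (by
      intro h
      apply hproper
      rw [← hγ', h]
      simp) (by
      rw [gFT, hγ']
      rw [edgeBetti, hcard] at hdiv
      omega)
  obtain ⟨A, h3, hu, hA⟩ := hA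
  exact final_gen (gs G) (gt G) r (gne G) (G_conn G hG) hN A h3 hu hA
end
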